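/- Let C = {v, w} be a mild contour from x to y in a ray category P such that v⃗ is transit, with v = v_1⋯v_n and w = w_1⋯w_m paths in Q_P. Then every path u = u_1⋯u_r in Q_P with u⃗ = v⃗ is equal to v or to w. -/

import Mathlib

set_option autoImplicit false

/-- A ray category (Bautista–Gabriel–Roiter–Salmerón).  The fields `pipow x`
record the powers of the generator `π(x)` of the radical of `P(x,x)`. -/
structure RayCategory : Type 1 where
  Obj : Type
  Hom : Obj → Obj → Type
  id : ∀ x : Obj, Hom x x
  comp : ∀ {x y z : Obj}, Hom y z → Hom x y → Hom x z
  zero : ∀ x y : Obj, Hom x y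
  comp_id : ∀ {x y : Obj} (f : Hom x y), comp f (id x) = f
  id_comp : ∀ {x y : Obj} (f : Hom x y), comp (id y) f = f
  assoc : ∀ {x y z w : Obj} (h : Hom z w) (g : Hom y z) (f : Hom x y),
      comp (comp h g) f = comp h (comp g f)
  /-- axiom b : zero morphisms -/
  zero_comp : ∀ {x y z : Obj} (f : Hom x y), comp (zero y z) f = zero x z
  comp_zero : ∀ {x y z : Obj} (f : Hom y z), comp f (zero x y) = zero x z
  /-- axiom a : the objects are pairwise non-isomorphic -/
  no_iso : ∀ {x y : Obj} (f : Hom x y) (g : Hom y x),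
      comp g f = id x → comp f g = id y → x = y
  /-- axiom c : local finiteness -/
  finite_target : ∀ x : Obj, {y : Obj | ∃ f : Hom x y, f ≠ zero x y}.Finite
  finite_source : ∀ x : Obj, {y : Obj | ∃ f : Hom y x, f ≠ zero y x}.Finite
  /-- the powers of the generator `π(x)` of `P(x,x)`; `pipow x 1 = π(x)`. -/
  pipow : ∀ x : Obj, ℕ → Hom x x
  pipow_zero : ∀ x, pipow x 0 = id x
  pipow_succ : ∀ x n, pipow x (n + 1) = comp (pipow x 1) (pipow x n)
  nilp : Obj → ℕ
  nilp_pos : ∀ x, 1 ≤ nilp x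
  /-- axiom d : `P(x,x) = {id, σ, …, σ^{n-1} ≠ 0 = σ^n}` -/
  endo_cyclic : ∀ (x : Obj) (f : Hom x x), ∃ i : ℕ, f = pipow x i
  pipow_nilp : ∀ x, pipow x (nilp x) = zero x x
  pipow_nilp_ne : ∀ x, pipow x (nilp x - 1) ≠ zero x x
  /-- axiom e : `P(x,y)` is cyclic under the action of `P(x,x)` or of `P(y,y)` -/
  hom_cyclic : ∀ x y : Obj, ∃ g : Hom x y,
      (∀ f : Hom x y, ∃ i : ℕ, f = comp (pipow y i) g) ∨
      (∀ f : Hom x y, ∃ i : ℕ, f = comp g (pipow x i))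
  /-- axiom f : cancellation -/
  cancel : ∀ {x y z w : Obj} (kappa : Hom x y) (mu nu : Hom y z) (lam : Hom z w),
      comp lam (comp mu kappa) = comp lam (comp nu kappa) →
      comp lam (comp mu kappa) ≠ zero x w → mu = nu

namespace RayCategory

variable (P : RayCategory)

/-- the generator of the radical of `P(x,x)` -/
def pi (x : P.Obj) : P.Hom x x := P.pipow x 1

/-- powers of an endomorphism -/
def pow {x : P.Obj} (f : P.Hom x x) : ℕ → P.Hom x x
  | 0 => P.id x
  | n + 1 => P.comp f (pow f n)

/-- `f` is an identity morphism -/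
def IsId {x y : P.Obj} (f : P.Hom x y) : Prop := ∃ _ : x = y, HEq f (P.id x)

/-- irreducible morphisms (= arrows of the quiver of `P`): nonzero morphisms which are
not identities and cannot be written as a product of two non-identity morphisms -/
def IsIrreducible {x y : P.Obj} (f : P.Hom x y) : Prop :=
  f ≠ P.zero x y ∧ ¬ P.IsId f ∧
    ∀ (z : P.Obj) (g : P.Hom z y) (h : P.Hom x z), f = P.comp g h → P.IsId g ∨ P.IsId h

/-- irreducibility inside the full subcategory supported by `S` -/
def IsIrreducibleOn (S : Set P.Obj) {x y : P.Obj} (f : P.Hom x y) : Prop :=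
  f ≠ P.zero x y ∧ ¬ P.IsId f ∧
    ∀ z ∈ S, ∀ (g : P.Hom z y) (h : P.Hom x z), f = P.comp g h → P.IsId g ∨ P.IsId h

/-- the sub-bimodule `P(y,y) μ P(x,x)` of `P(x,y)` generated by `μ` -/
def Bimod {x y : P.Obj} (mu : P.Hom x y) : Set (P.Hom x y) :=
  {f | ∃ i j : ℕ, f = P.comp (P.pipow y i) (P.comp mu (P.pipow x j))}

/-- `μ` is transit : the sub-bimodule generated by `μ` is cyclic over `P(y,y)` -/
def IsTransit {x y : P.Obj} (mu : P.Hom x y) : Prop :=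
  mu ≠ P.zero x y ∧
    ∃ g ∈ P.Bimod mu, ∀ f ∈ P.Bimod mu, ∃ i : ℕ, f = P.comp (P.pipow y i) g

/-- `μ` is cotransit : the sub-bimodule generated by `μ` is cyclic over `P(x,x)` -/
def IsCotransit {x y : P.Obj} (mu : P.Hom x y) : Prop :=
  mu ≠ P.zero x y ∧
    ∃ g ∈ P.Bimod mu, ∀ f ∈ P.Bimod mu, ∃ j : ℕ, f = P.comp g (P.pipow x j)

/-- `μ` is deep : `π(y)μ = 0 = μπ(x)` -/
def IsDeep {x y : P.Obj} (mu : P.Hom x y) : Prop :=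
  mu ≠ P.zero x y ∧ P.comp (P.pi y) mu = P.zero x y ∧ P.comp mu (P.pi x) = P.zero x y

/-- transport of a morphism along equalities of objects -/
def castHom {a b c d : P.Obj} (h1 : a = c) (h2 : b = d) (f : P.Hom a b) : P.Hom c d :=
  cast (by rw [h1, h2]) f

/-- the composite `a_{i+j-1} ⋯ a_{i+1} a_i : x_i → x_{i+j}` of a chain of morphisms -/
def chain (x : ℕ → P.Obj) (a : ∀ i : ℕ, P.Hom (x i) (x (i + 1))) (i : ℕ) :
    ∀ j : ℕ, P.Hom (x i) (x (i + j))
  | 0 => P.id (x i)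
  | j + 1 => P.comp (a (i + j)) (chain x a i j)

end RayCategory

/-- Paths in the quiver `Q_P` of a ray category `P` (the arrow `f` of `cons f hf p`
is the *last* arrow of the path). -/
inductive RPath (P : RayCategory) : P.Obj → P.Obj → Type
  | nil (x : P.Obj) : RPath P x x
  | cons {x y z : P.Obj} (f : P.Hom y z) (hf : P.IsIrreducible f) (p : RPath P x y) :
      RPath P x z

namespace RPath

variable {P : RayCategory}

/-- the morphism `v⃗` of `P` obtained by composing the arrows of a path `v` -/
def toHom : ∀ {x y : P.Obj}, RPath P x y → P.Hom x y
  | _, _, .nil x => P.id x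
  | _, _, .cons f _ p => P.comp f p.toHom

def length : ∀ {x y : P.Obj}, RPath P x y → ℕ
  | _, _, .nil _ => 0
  | _, _, .cons _ _ p => p.length + 1

/-- the set of points visited by a path -/
def points : ∀ {x y : P.Obj}, RPath P x y → Set P.Obj
  | _, _, .nil x => {x}
  | _, _, @RPath.cons _ _ _ z _ _ p => insert z p.points

/-- concatenation of paths -/
def append : ∀ {x y z : P.Obj}, RPath P y z → RPath P x y → RPath P x z
  | _, _, _, .nil _, p => p
  | _, _, _, .cons f hf q, p => .cons f hf (q.append p)

/-- the arrow `g` occurs in the path -/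
def HasArrow : ∀ {x y : P.Obj}, RPath P x y → ∀ {a b : P.Obj}, P.Hom a b → Prop
  | _, _, .nil _, _, _, _ => False
  | _, _, .cons f _ p, _, _, g => HEq f g ∨ p.HasArrow g

/-- one step of the interlacing relation: `v = p v' q`, `w = p w' q` with
`v⃗' = w⃗' ≠ 0` and `p`, `q` not both identities -/
def InterlaceStep {x y : P.Obj} (v w : RPath P x y) : Prop :=
  ∃ (a b : P.Obj) (p : RPath P b y) (v' w' : RPath P a b) (q : RPath P x a),
    v = p.append (v'.append q) ∧ w = p.append (w'.append q) ∧
    v'.toHom = w'.toHom ∧ v'.toHom ≠ P.zero a b ∧ ¬ (p.length = 0 ∧ q.length = 0)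

/-- two paths are interlaced if they lie in the transitive closure of the relation above -/
def Interlaced {x y : P.Obj} (v w : RPath P x y) : Prop :=
  Relation.TransGen (fun v' w' : RPath P x y => InterlaceStep v' w') v w

end RPath

/-- a chain of arrows as a path -/
def pchain (P : RayCategory) (x : ℕ → P.Obj) (a : ∀ i : ℕ, P.Hom (x i) (x (i + 1)))
    (ha : ∀ i, P.IsIrreducible (a i)) (i : ℕ) : ∀ j : ℕ, RPath P (x i) (x (i + j))
  | 0 => .nil (x i)
  | j + 1 => .cons (a (i + j)) (ha (i + j)) (pchain P x a ha i j)

/-- A contour `C = {v,w}` of `P` from `x` to `y` : a pair of different, non-interlaced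
paths with `v⃗ = w⃗ ≠ 0`. -/
structure Contour (P : RayCategory) (x y : P.Obj) : Type where
  v : RPath P x y
  w : RPath P x y
  ne : v ≠ w
  hom_eq : v.toHom = w.toHom
  nz : v.toHom ≠ P.zero x y
  nint : ¬ RPath.Interlaced v w
/-- A module over the linearization `k(D/I)` of the quotient by the ideal generated by the
morphisms in `I` of the full subcategory of `P` supported by `D`:
a `k`-linear functor defined on the morphisms between points of `D`, vanishing on `I`.
For `D = Set.univ` and `I = fun _ _ _ => False` this is exactly a `k(P)`-module. -/
structure RMod (P : RayCategory) (k : Type) [Field k] (D : Set P.Obj)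
    (I : ∀ a b : P.Obj, P.Hom a b → Prop) where
  M : P.Obj → Type
  [acg : ∀ x, AddCommGroup (M x)]
  [mod : ∀ x, Module k (M x)]
  act : ∀ {x y : P.Obj}, P.Hom x y → (M x →ₗ[k] M y)
  act_id : ∀ x ∈ D, act (P.id x) = LinearMap.id
  act_comp : ∀ {x y z : P.Obj}, x ∈ D → y ∈ D → z ∈ D →
      ∀ (g : P.Hom y z) (f : P.Hom x y), act (P.comp g f) = (act g).comp (act f)
  act_zero : ∀ {x y : P.Obj}, x ∈ D → y ∈ D → act (P.zero x y) = 0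
  supp : ∀ x : P.Obj, x ∉ D → ∀ m : M x, m = 0
  killed : ∀ {a b : P.Obj} (f : P.Hom a b), I a b f → act f = 0

attribute [instance] RMod.acg RMod.mod

/-- morphisms of modules -/
structure RModHom {P : RayCategory} {k : Type} [Field k] {D : Set P.Obj}
    {I : ∀ a b : P.Obj, P.Hom a b → Prop} (M N : RMod P k D I) where
  app : ∀ x : P.Obj, M.M x →ₗ[k] N.M x
  natural : ∀ {x y : P.Obj} (f : P.Hom x y), (N.act f).comp (app x) = (app y).comp (M.act f)

/-- isomorphism of modules -/
def RModIso {P : RayCategory} {k : Type} [Field k] {D : Set P.Obj}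
    {I : ∀ a b : P.Obj, P.Hom a b → Prop} (M N : RMod P k D I) : Prop :=
  ∃ φ : RModHom M N, ∀ x, Function.Bijective (φ.app x)

namespace RMod

variable {P : RayCategory} {k : Type} [Field k] {D : Set P.Obj}
  {I : ∀ a b : P.Obj, P.Hom a b → Prop}

/-- finite-dimensional: the sum of the dimensions of all `M x` is finite -/
def FinDim (M : RMod P k D I) : Prop :=
  (∀ x, FiniteDimensional k (M.M x)) ∧ {x : P.Obj | ∃ m : M.M x, m ≠ 0}.Finite

def Nonzero (M : RMod P k D I) : Prop := ∃ x, ∃ m : M.M x, m ≠ 0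

/-- indecomposable: nonzero, and the only idempotent endomorphisms are `0` and `id` -/
def Indec (M : RMod P k D I) : Prop :=
  M.Nonzero ∧ ∀ e : RModHom M M, (∀ x, (e.app x).comp (e.app x) = e.app x) →
    (∀ x, e.app x = 0) ∨ (∀ x, e.app x = LinearMap.id)

end RMod

/-- the full subcategory supported by `D` of the quotient of `P` by the ideal generated
by `I` is (locally) representation-finite: for any field `k`, every point lies in the
support of only finitely many isomorphism classes of finite-dimensional indecomposables -/
def RepFin (P : RayCategory) (D : Set P.Obj) (I : ∀ a b : P.Obj, P.Hom a b → Prop) : Prop :=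
  ∀ (k : Type) [Field k], ∀ x : P.Obj,
    ∃ (ι : Type) (_ : Finite ι) (rep : ι → RMod P k D I),
      ∀ M : RMod P k D I, M.FinDim → M.Indec → (∃ m : M.M x, m ≠ 0) →
        ∃ i : ι, RModIso (rep i) M

/-- the trivial ideal -/
def RayCategory.noIdeal (P : RayCategory) : ∀ a b : P.Obj, P.Hom a b → Prop :=
  fun _ _ _ => False

/-- `P` is locally representation-finite -/
def LocRepFin (P : RayCategory) : Prop := RepFin P Set.univ P.noIdeal

/-- the ideal of `P` generated by the morphism `μ` -/
def IdealOf (P : RayCategory) {a b : P.Obj} (mu : P.Hom a b) :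
    ∀ s t : P.Obj, P.Hom s t → Prop :=
  fun s t f => ∃ (g : P.Hom b t) (h : P.Hom s a), f = P.comp g (P.comp mu h)

/-- an ideal of a ray category -/
structure RIdeal (P : RayCategory) where
  mem : ∀ a b : P.Obj, P.Hom a b → Prop
  zero_mem : ∀ a b : P.Obj, mem a b (P.zero a b)
  comp_mem_left : ∀ {a b c : P.Obj} (g : P.Hom b c) (f : P.Hom a b),
      mem a b f → mem a c (P.comp g f)
  comp_mem_right : ∀ {a b c : P.Obj} (g : P.Hom b c) (f : P.Hom a b),
      mem b c g → mem a c (P.comp g f)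

/-- `P` is minimal representation-infinite: not locally representation-finite, but every
proper quotient (quotient by an ideal containing a nonzero morphism) is locally
representation-finite -/
def MinRepInfinite (P : RayCategory) : Prop :=
  ¬ LocRepFin P ∧ ∀ J : RIdeal P,
    (∃ (a b : P.Obj) (f : P.Hom a b), f ≠ P.zero a b ∧ J.mem a b f) →
      RepFin P Set.univ J.mem

/-- support of the indecomposable projective module `P_x` over the quotient of `P` by `I` -/
def ProjSupp (P : RayCategory) (I : ∀ a b : P.Obj, P.Hom a b → Prop) (x : P.Obj) :
    Set P.Obj :=
  {y : P.Obj | ∃ f : P.Hom x y, f ≠ P.zero x y ∧ ¬ I x y f}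

/-- support of the indecomposable injective module `I_y` over the quotient of `P` by `I` -/
def InjSupp (P : RayCategory) (I : ∀ a b : P.Obj, P.Hom a b → Prop) (y : P.Obj) :
    Set P.Obj :=
  {z : P.Obj | ∃ f : P.Hom z y, f ≠ P.zero z y ∧ ¬ I z y f}

namespace Contour

variable {P : RayCategory} {x y : P.Obj} (C : Contour P x y)

/-- points of the contour = points of the full subcategory `P(C)` -/
def points : Set P.Obj := C.v.points ∪ C.w.points

/-- the contour is non-deep -/
def NonDeep : Prop := ¬ P.IsDeep C.v.toHom

/-- the ideal generated by `π(y)v⃗`, so that `P' = P/π(y)v⃗` (transit case) -/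
def It : ∀ a b : P.Obj, P.Hom a b → Prop := IdealOf P (P.comp (P.pi y) C.v.toHom)

/-- the ideal generated by `v⃗π(x)` (cotransit case) -/
def Ic : ∀ a b : P.Obj, P.Hom a b → Prop := IdealOf P (P.comp C.v.toHom (P.pi x))

/-- decisive subcategories of `P' = P/π(y)v⃗` for `C` (transit case) -/
def DecisiveT (D : Set P.Obj) : Prop :=
  x ∈ D ∧ y ∈ D ∧ D ⊆ ProjSupp P C.It x ∪ InjSupp P C.It y

/-- decisive subcategories (cotransit case) -/
def DecisiveC (D : Set P.Obj) : Prop :=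
  x ∈ D ∧ y ∈ D ∧ D ⊆ ProjSupp P C.Ic x ∪ InjSupp P C.Ic y

/-- mildness in the transit case: `C` is non-deep, `v⃗` is transit, and every decisive
full subcategory of `P/π(y)v⃗` with at most 4 points is representation-finite -/
def MildTransit : Prop :=
  C.NonDeep ∧ P.IsTransit C.v.toHom ∧
    ∀ D : Set P.Obj, C.DecisiveT D → D.Finite → D.ncard ≤ 4 → RepFin P D C.It

/-- mildness in the cotransit case (dual) -/
def MildCotransit : Prop :=
  C.NonDeep ∧ P.IsCotransit C.v.toHom ∧
    ∀ D : Set P.Obj, C.DecisiveC D → D.Finite → D.ncard ≤ 4 → RepFin P D C.Ic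

/-- a mild contour -/
def Mild : Prop := C.MildTransit ∨ C.MildCotransit

/-- equality of contours (with possibly different endpoints), as sets `{v,w}` -/
def Same {x' y' : P.Obj} (C' : Contour P x' y') : Prop :=
  ∃ (_ : x = x') (_ : y = y'),
    (HEq C.v C'.v ∧ HEq C.w C'.w) ∨ (HEq C.v C'.w ∧ HEq C.w C'.v)

end Contour
/-- the full subcategory on `{x,y}` is a dumb-bell with loops `lam`, `rho`, arrow `mu`
and nilpotency indices `r`, `s` -/
def DumbBellData (P : RayCategory) (x y : P.Obj) (lam : P.Hom x x) (mu : P.Hom x y)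
    (rho : P.Hom y y) (r s : ℕ) : Prop :=
  x ≠ y ∧
  P.IsIrreducibleOn {x, y} lam ∧ P.IsIrreducibleOn {x, y} mu ∧ P.IsIrreducibleOn {x, y} rho ∧
  (∀ a b : P.Obj, a ∈ ({x, y} : Set P.Obj) → b ∈ ({x, y} : Set P.Obj) →
      ∀ f : P.Hom a b, P.IsIrreducibleOn {x, y} f → HEq f lam ∨ HEq f mu ∨ HEq f rho) ∧
  P.comp mu lam = P.comp rho mu ∧
  P.pow lam r = P.zero x x ∧ P.pow rho s = P.zero y y ∧
  P.pow lam (r - 1) ≠ P.zero x x ∧ P.pow rho (s - 1) ≠ P.zero y y ∧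
  min r s = 3 ∧ max r s ≤ 5 ∧
  (∀ f : P.Hom x x, ∃ i : ℕ, f = P.pow lam i) ∧
  (∀ f : P.Hom y y, ∃ i : ℕ, f = P.pow rho i) ∧
  (∀ f : P.Hom x y, f = P.zero x y ∨ ∃ i : ℕ, f = P.comp mu (P.pow lam i)) ∧
  (∀ i : ℕ, i < min r s → P.comp mu (P.pow lam i) ≠ P.zero x y) ∧
  (∀ f : P.Hom y x, f = P.zero y x)

/-- the full subcategory supported by `S` is a dumb-bell -/
def IsDumbBellOn (P : RayCategory) (S : Set P.Obj) : Prop :=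
  ∃ (x y : P.Obj) (lam : P.Hom x x) (mu : P.Hom x y) (rho : P.Hom y y) (r s : ℕ),
    DumbBellData P x y lam mu rho r s ∧ S = {x, y}

/-- the full subcategory on the points `x 0, …, x (n-1)` is a penny-farthing with arrows
`a i` (`a i = α_{i+1} : x_i → x_{i+1}`, indices mod `n`) and loop `rho` at `x 0` -/
def PennyData (P : RayCategory) (n : ℕ) (x : ℕ → P.Obj)
    (a : ∀ i : ℕ, P.Hom (x i) (x (i + 1))) (rho : P.Hom (x 0) (x 0)) : Prop :=
  1 ≤ n ∧
  (∀ i, x (i + n) = x i) ∧ (∀ i, HEq (a (i + n)) (a i)) ∧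
  (∀ i j, i < n → j < n → x i = x j → i = j) ∧
  (∀ i, P.IsIrreducibleOn (Set.range x) (a i)) ∧
  P.IsIrreducibleOn (Set.range x) rho ∧
  (∀ b c : P.Obj, b ∈ Set.range x → c ∈ Set.range x → ∀ f : P.Hom b c,
      P.IsIrreducibleOn (Set.range x) f → HEq f rho ∨ ∃ i, i < n ∧ HEq f (a i)) ∧
  -- relation α₁αₙ = 0
  P.chain x a (n - 1) 2 = P.zero (x (n - 1)) (x (n - 1 + 2)) ∧
  -- relation αₙ⋯α₁ = ρ²
  (∀ h : x (0 + n) = x 0, P.castHom rfl h (P.chain x a 0 n) = P.comp rho rho) ∧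
  -- relations 0 = α_{e i}⋯α₁ ρ αₙ⋯α_{i+1} for a non-decreasing e : {1,…,n-1} → {1,…,n}
  ∃ e : ℕ → ℕ,
    (∀ i, 1 ≤ i → i ≤ n - 1 → 1 ≤ e i ∧ e i ≤ n) ∧
    (∀ i j, 1 ≤ i → i ≤ j → j ≤ n - 1 → e i ≤ e j) ∧
    (∀ i, 1 ≤ i → i ≤ n - 1 → ∀ h : x (i + (n - i)) = x 0,
      P.comp (P.chain x a 0 (e i))
        (P.comp rho (P.castHom rfl h (P.chain x a i (n - i)))) =
      P.zero (x i) (x (0 + e i)))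

/-- the full subcategory supported by `S` is a penny-farthing -/
def IsPennyFarthingOn (P : RayCategory) (S : Set P.Obj) : Prop :=
  ∃ (n : ℕ) (x : ℕ → P.Obj) (a : ∀ i : ℕ, P.Hom (x i) (x (i + 1))) (rho : P.Hom (x 0) (x 0)),
    PennyData P n x a rho ∧ S = Set.range x

/-- the full subcategory on `{x,z,t,y}` is a diamond with arrows
`gam : x → z`, `lam : z → x`, `del : x → t`, `bet : t → y`, `alp : z → y`, `kap : y → z` -/
def DiamondData (P : RayCategory) (x z t y : P.Obj) (gam : P.Hom x z) (lam : P.Hom z x)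
    (del : P.Hom x t) (bet : P.Hom t y) (alp : P.Hom z y) (kap : P.Hom y z) : Prop :=
  (x ≠ z ∧ x ≠ t ∧ x ≠ y ∧ z ≠ t ∧ z ≠ y ∧ t ≠ y) ∧
  P.IsIrreducibleOn {x, z, t, y} gam ∧ P.IsIrreducibleOn {x, z, t, y} lam ∧
  P.IsIrreducibleOn {x, z, t, y} del ∧ P.IsIrreducibleOn {x, z, t, y} bet ∧
  P.IsIrreducibleOn {x, z, t, y} alp ∧ P.IsIrreducibleOn {x, z, t, y} kap ∧
  (∀ a b : P.Obj, a ∈ ({x, z, t, y} : Set P.Obj) → b ∈ ({x, z, t, y} : Set P.Obj) →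
      ∀ f : P.Hom a b, P.IsIrreducibleOn {x, z, t, y} f →
        HEq f gam ∨ HEq f lam ∨ HEq f del ∨ HEq f bet ∨ HEq f alp ∨ HEq f kap) ∧
  P.comp alp gam = P.comp bet del ∧
  P.comp lam kap = P.zero y x ∧
  P.comp kap alp = P.comp gam lam

/-- the full subcategory supported by `S` is a diamond -/
def IsDiamondOn (P : RayCategory) (S : Set P.Obj) : Prop :=
  ∃ (x z t y : P.Obj) (gam : P.Hom x z) (lam : P.Hom z x) (del : P.Hom x t)
    (bet : P.Hom t y) (alp : P.Hom z y) (kap : P.Hom y z),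
    DiamondData P x z t y gam lam del bet alp kap ∧ S = {x, z, t, y}

namespace RayCategory

/-- composition in a ray category -/
notation:80 g:81 "⬝" f:80 => RayCategory.comp _ g f

section Basic

variable {P : RayCategory}

theorem cancel_left {x y z : P.Obj} {l : P.Hom y z} {m n : P.Hom x y}
    (h : l ⬝ m = l ⬝ n) (h0 : l ⬝ m ≠ P.zero x z) : m = n := by
  refine P.cancel (P.id x) m n l ?_ ?_ <;> simpa only [P.comp_id] using ‹_›

theorem cancel_right {x y z : P.Obj} {k : P.Hom x y} {m n : P.Hom y z}
    (h : m ⬝ k = n ⬝ k) (h0 : m ⬝ k ≠ P.zero x z) : m = n := by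
  refine P.cancel k m n (P.id z) ?_ ?_ <;> simpa only [P.id_comp] using ‹_›

theorem ne_zero_left {x y z : P.Obj} {g : P.Hom y z} {f : P.Hom x y}
    (h : g ⬝ f ≠ P.zero x z) : g ≠ P.zero y z := by
  rintro rfl
  exact h (P.zero_comp f)

theorem ne_zero_right {x y z : P.Obj} {g : P.Hom y z} {f : P.Hom x y}
    (h : g ⬝ f ≠ P.zero x z) : f ≠ P.zero x y := by
  rintro rfl
  exact h (P.comp_zero g)

theorem pipow_add (x : P.Obj) (i j : ℕ) :
    P.pipow x (i + j) = P.pipow x i ⬝ P.pipow x j := by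
  induction i with
  | zero => rw [Nat.zero_add, P.pipow_zero, P.id_comp]
  | succ i ih => rw [Nat.add_right_comm, P.pipow_succ, ih, P.pipow_succ x i, P.assoc]

theorem endo_comm {x : P.Obj} (e f : P.Hom x x) : e ⬝ f = f ⬝ e := by
  obtain ⟨i, rfl⟩ := P.endo_cyclic x e
  obtain ⟨j, rfl⟩ := P.endo_cyclic x f
  rw [← pipow_add, ← pipow_add, Nat.add_comm]

theorem pipow_eq_zero {x : P.Obj} {n : ℕ} (h : P.nilp x ≤ n) : P.pipow x n = P.zero x x := by
  obtain ⟨m, rfl⟩ := Nat.exists_eq_add_of_le h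
  rw [pipow_add, P.pipow_nilp, P.zero_comp]

theorem id_ne_zero (x : P.Obj) : P.id x ≠ P.zero x x := by
  intro h
  apply P.pipow_nilp_ne x
  rw [← P.id_comp (P.pipow x _), h, P.zero_comp]

theorem pi_ne_id (x : P.Obj) : P.pi x ≠ P.id x := by
  intro h
  have h1 : ∀ n, P.pipow x n = P.id x := by
    intro n
    induction n with
    | zero => exact P.pipow_zero x
    | succ n ih => rw [P.pipow_succ, ih, P.comp_id]; exact h
  exact id_ne_zero x ((h1 _).symm.trans (P.pipow_nilp x))

theorem isId_iff {x : P.Obj} (f : P.Hom x x) : P.IsId f ↔ f = P.id x := by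
  constructor
  · rintro ⟨_, h⟩
    exact eq_of_heq h
  · rintro rfl
    exact ⟨rfl, HEq.rfl⟩

theorem isId_id (x : P.Obj) : P.IsId (P.id x) := ⟨rfl, HEq.rfl⟩

theorem not_isId_pi (x : P.Obj) : ¬ P.IsId (P.pi x) := fun h => pi_ne_id x ((isId_iff _).1 h)

/-- an endomorphism is the identity or a multiple of the generator of the radical -/
theorem endo_cases {x : P.Obj} (e : P.Hom x x) : e = P.id x ∨ ∃ e', e = P.pi x ⬝ e' := by
  obtain ⟨i, rfl⟩ := P.endo_cyclic x e
  cases i with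
  | zero => exact Or.inl (P.pipow_zero x)
  | succ i => exact Or.inr ⟨_, P.pipow_succ x i⟩

theorem pipow_eq_id {x y : P.Obj} {m : P.Hom x y} (hm : m ≠ P.zero x y) (i j : ℕ)
    (h : m = P.pipow y i ⬝ m ⬝ P.pipow x j) : i = 0 ∧ j = 0 := by
  have key : ∀ n, m = P.pipow y (n * i) ⬝ m ⬝ P.pipow x (n * j) := by
    intro n
    induction n with
    | zero => rw [Nat.zero_mul, Nat.zero_mul, P.pipow_zero, P.pipow_zero, P.id_comp, P.comp_id]
    | succ n ih =>
      have hj : (n + 1) * j = j + n * j := by ring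
      rw [Nat.succ_mul, hj, pipow_add, pipow_add]
      conv_lhs => rw [ih, h]
      simp only [P.assoc]
  constructor
  · by_contra hi
    apply hm
    rw [key (P.nilp y), pipow_eq_zero (Nat.le_mul_of_pos_right _ (Nat.pos_of_ne_zero hi)),
      P.zero_comp]
  · by_contra hj
    apply hm
    rw [key (P.nilp x),
      pipow_eq_zero (x := x) (Nat.le_mul_of_pos_right _ (Nat.pos_of_ne_zero hj)),
      P.comp_zero, P.comp_zero]

/-- a nonzero morphism absorbs no nontrivial endomorphisms -/
theorem absorb {x y : P.Obj} {m : P.Hom x y} (hm : m ≠ P.zero x y) {a : P.Hom y y}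
    {b : P.Hom x x} (h : m = a ⬝ m ⬝ b) : a = P.id y ∧ b = P.id x := by
  obtain ⟨i, rfl⟩ := P.endo_cyclic y a
  obtain ⟨j, rfl⟩ := P.endo_cyclic x b
  obtain ⟨rfl, rfl⟩ := pipow_eq_id hm i j h
  exact ⟨P.pipow_zero y, P.pipow_zero x⟩

theorem absorb_left {x y : P.Obj} {m : P.Hom x y} (hm : m ≠ P.zero x y) {a : P.Hom y y}
    (h : m = a ⬝ m) : a = P.id y :=
  (absorb hm (b := P.id x) (by rw [P.comp_id]; exact h)).1

theorem absorb_right {x y : P.Obj} {m : P.Hom x y} (hm : m ≠ P.zero x y) {b : P.Hom x x}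
    (h : m = m ⬝ b) : b = P.id x :=
  (absorb hm (a := P.id y) (by rw [P.id_comp]; exact h)).2

theorem isId_of_comp_eq_id {x y : P.Obj} {g : P.Hom y x} {f : P.Hom x y}
    (h : g ⬝ f = P.id x) : P.IsId g ∧ P.IsId f := by
  have hf : f ≠ P.zero x y := by
    rintro rfl
    rw [P.comp_zero] at h
    exact id_ne_zero x h.symm
  have h1 : f ⬝ g = P.id y := by
    refine absorb_left hf ?_
    rw [P.assoc, h, P.comp_id]
  obtain rfl := P.no_iso f g h h1
  have h2 : P.id x = g ⬝ P.id x ⬝ f := by rw [P.id_comp, h]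
  obtain ⟨rfl, rfl⟩ := absorb (id_ne_zero x) h2
  exact ⟨isId_id x, isId_id x⟩

theorem isId_of_comp_isId {x y z : P.Obj} {g : P.Hom y z} {f : P.Hom x y}
    (h : P.IsId (g ⬝ f)) : P.IsId g ∧ P.IsId f := by
  obtain ⟨rfl, _⟩ := h
  exact isId_of_comp_eq_id (eq_of_heq ‹_›)

/-- if `m = a m' b` and `m' = c m d`, all identities -/
theorem absorb_comp_left {x y z : P.Obj} {m : P.Hom x y} (hm : m ≠ P.zero x y)
    {a : P.Hom z y} {b : P.Hom y z} (h : m = a ⬝ b ⬝ m) : P.IsId a ∧ P.IsId b := by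
  rw [← P.assoc] at h
  exact isId_of_comp_eq_id (absorb_left hm h)

theorem cyc {x y : P.Obj} (f f' : P.Hom x y) :
    (∃ e, f' = e ⬝ f) ∨ (∃ e, f = e ⬝ f') ∨ (∃ e, f' = f ⬝ e) ∨ (∃ e, f = f' ⬝ e) := by
  obtain ⟨g, hg | hg⟩ := P.hom_cyclic x y
  · obtain ⟨i, rfl⟩ := hg f
    obtain ⟨j, rfl⟩ := hg f'
    rcases le_total i j with h | h
    · obtain ⟨m, rfl⟩ := Nat.exists_eq_add_of_le' h
      exact Or.inl ⟨P.pipow y m, by rw [pipow_add, P.assoc]⟩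
    · obtain ⟨m, rfl⟩ := Nat.exists_eq_add_of_le' h
      exact Or.inr (Or.inl ⟨P.pipow y m, by rw [pipow_add, P.assoc]⟩)
  · obtain ⟨i, rfl⟩ := hg f
    obtain ⟨j, rfl⟩ := hg f'
    rcases le_total i j with h | h
    · obtain ⟨m, rfl⟩ := Nat.exists_eq_add_of_le h
      exact Or.inr (Or.inr (Or.inl ⟨P.pipow x m, by rw [pipow_add, P.assoc]⟩))
    · obtain ⟨m, rfl⟩ := Nat.exists_eq_add_of_le h
      exact Or.inr (Or.inr (Or.inr ⟨P.pipow x m, by rw [pipow_add, P.assoc]⟩))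

theorem comp_dichotomy {x y : P.Obj} (f : P.Hom x y) :
    (∀ e, ∃ e', f ⬝ e = e' ⬝ f) ∨ (∀ e', ∃ e, e' ⬝ f = f ⬝ e) := by
  obtain ⟨g, hg | hg⟩ := P.hom_cyclic x y
  · left
    intro e
    obtain ⟨i, rfl⟩ := hg f
    obtain ⟨k, hk⟩ := hg (g ⬝ e)
    refine ⟨P.pipow y k, ?_⟩
    rw [P.assoc, hk, ← P.assoc, ← P.assoc, endo_comm]
  · right
    intro e
    obtain ⟨i, rfl⟩ := hg f
    obtain ⟨k, hk⟩ := hg (e ⬝ g)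
    refine ⟨P.pipow x k, ?_⟩
    rw [← P.assoc, hk, P.assoc, P.assoc, endo_comm]

instance hom_finite (x y : P.Obj) : Finite (P.Hom x y) := by
  obtain ⟨g, hg | hg⟩ := P.hom_cyclic x y
  · refine Finite.of_surjective (fun i : Fin (P.nilp y + 1) => P.pipow y i ⬝ g) ?_
    intro f
    obtain ⟨i, rfl⟩ := hg f
    rcases lt_or_ge i (P.nilp y) with h | h
    · exact ⟨⟨i, by omega⟩, rfl⟩
    · refine ⟨⟨P.nilp y, by omega⟩, ?_⟩
      simp only [pipow_eq_zero h, P.pipow_nilp]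
  · refine Finite.of_surjective (fun i : Fin (P.nilp x + 1) => g ⬝ P.pipow x i) ?_
    intro f
    obtain ⟨i, rfl⟩ := hg f
    rcases lt_or_ge i (P.nilp x) with h | h
    · exact ⟨⟨i, by omega⟩, rfl⟩
    · refine ⟨⟨P.nilp x, by omega⟩, ?_⟩
      simp only [pipow_eq_zero h, P.pipow_nilp]

/-- neither of two morphisms with the same target factors through the other one -/
def RInc {a b y : P.Obj} (f : P.Hom a y) (g : P.Hom b y) : Prop :=
  (¬ ∃ h, g = f ⬝ h) ∧ ¬ ∃ h, f = g ⬝ h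

/-- neither of two morphisms with the same source factors through the other one -/
def LInc {x a b : P.Obj} (f : P.Hom x a) (g : P.Hom x b) : Prop :=
  (¬ ∃ h, g = h ⬝ f) ∧ ¬ ∃ h, f = h ⬝ g

theorem RInc.symm {a b y : P.Obj} {f : P.Hom a y} {g : P.Hom b y} (h : RInc f g) : RInc g f :=
  ⟨h.2, h.1⟩

theorem LInc.symm {x a b : P.Obj} {f : P.Hom x a} {g : P.Hom x b} (h : LInc f g) : LInc g f :=
  ⟨h.2, h.1⟩

/-- a two-sided ideal of morphisms, given as a predicate -/
structure IsIdeal (I : ∀ a b : P.Obj, P.Hom a b → Prop) : Prop where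
  zero : ∀ a b, I a b (P.zero a b)
  left : ∀ {a b c : P.Obj} (g : P.Hom b c) (f : P.Hom a b), I a b f → I a c (g ⬝ f)
  right : ∀ {a b c : P.Obj} (g : P.Hom b c) (f : P.Hom a b), I b c g → I a c (g ⬝ f)

theorem isIdeal_idealOf {a b : P.Obj} (m : P.Hom a b) : IsIdeal (IdealOf P m) where
  zero s t := ⟨P.zero b t, P.zero s a, by rw [P.zero_comp]⟩
  left := by
    rintro _ _ _ g _ ⟨u, v, rfl⟩
    exact ⟨g ⬝ u, v, by rw [P.assoc]⟩
  right := by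
    rintro _ _ _ _ f ⟨u, v, rfl⟩
    exact ⟨u, v ⬝ f, by rw [P.assoc, P.assoc]⟩

theorem IsIdeal.ne_zero {I : ∀ a b : P.Obj, P.Hom a b → Prop} (hI : IsIdeal I) {a b : P.Obj}
    {f : P.Hom a b} (hf : ¬ I a b f) : f ≠ P.zero a b := by
  rintro rfl
  exact hf (hI.zero a b)

end Basic

end RayCategory

namespace RayCategory

/-- A zigzag of morphisms in a full subcategory of a quotient of a ray category: sources `c i`,
sinks `d t` and, for each edge, a nonzero morphism `p t i` from the source to the sink, such
that no edge factors through another edge. -/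
structure Zigzag (P : RayCategory) (D : Set P.Obj) (I : ∀ a b : P.Obj, P.Hom a b → Prop) where
  S : Type
  T : Type
  finite_T : Finite T
  finite_D : D.Finite
  ideal : IsIdeal I
  c : S → P.Obj
  d : T → P.Obj
  d_inj : Function.Injective d
  c_mem : ∀ i, c i ∈ D
  d_mem : ∀ t, d t ∈ D
  p : ∀ t i, P.Hom (c i) (d t)
  E : T → S → Prop
  not_I : ∀ t i, E t i → ¬ I _ _ (p t i)
  right_inc : ∀ t i j, E t i → E t j → ∀ g, p t i ⬝ g = p t j → i = j
  left_inc : ∀ t t' i, E t i → E t' i → ∀ h, h ⬝ p t i = p t' i → t = t'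

namespace Zigzag

variable {P : RayCategory} {D : Set P.Obj} {I : ∀ a b : P.Obj, P.Hom a b → Prop}
  (Z : Zigzag P D I) {U : Type} [AddCommGroup U] [Module ℚ U]

/-- the ambient injective module -/
abbrev Amb (U : Type) (z : P.Obj) : Type := ∀ t, P.Hom z (Z.d t) → U

/-- the action of a morphism on the ambient module -/
def pre {z z' : P.Obj} (f : P.Hom z z') : Z.Amb U z →ₗ[ℚ] Z.Amb U z' where
  toFun φ := fun t h => φ t (h ⬝ f)
  map_add' _ _ := rfl
  map_smul' _ _ := rfl

variable (A : Z.T → Z.S → U →ₗ[ℚ] U)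

open Classical in
/-- the generators of the zigzag module -/
noncomputable def gen (z : P.Obj) (i : Z.S) (g : P.Hom (Z.c i) z) (v : U) : Z.Amb U z :=
  fun t h => if h ⬝ g = Z.p t i then A t i v else 0

theorem pre_gen {z z' : P.Obj} (f : P.Hom z z') (i : Z.S) (g : P.Hom (Z.c i) z) (v : U) :
    Z.pre f (Z.gen A z i g v) = Z.gen A z' i (f ⬝ g) v := by
  funext t h
  simp only [pre, gen, LinearMap.coe_mk, AddHom.coe_mk]
  rw [P.assoc]

/-- the value of the zigzag module at a point -/
def sub (z : P.Obj) : Submodule ℚ (Z.Amb U z) :=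
  Submodule.span ℚ {φ | z ∈ D ∧ ∃ i g v, φ = Z.gen A z i g v}

theorem gen_mem {z : P.Obj} (hz : z ∈ D) (i : Z.S) (g : P.Hom (Z.c i) z) (v : U) :
    Z.gen A z i g v ∈ Z.sub A z :=
  Submodule.subset_span ⟨hz, i, g, v, rfl⟩

theorem sub_induction {z : P.Obj} {Q : Z.Amb U z → Prop}
    (hgen : ∀ i g v, Q (Z.gen A z i g v)) (h0 : Q 0) (hadd : ∀ a b, Q a → Q b → Q (a + b))
    (hsmul : ∀ (r : ℚ) a, Q a → Q (r • a)) {φ : Z.Amb U z} (hφ : φ ∈ Z.sub A z) : Q φ := by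
  refine Submodule.span_induction (p := fun x _ => Q x) ?_ h0 (fun a b _ _ => hadd a b)
    (fun r a _ => hsmul r a) hφ
  rintro _ ⟨_, i, g, v, rfl⟩
  exact hgen i g v

theorem sub_eq_bot {z : P.Obj} (hz : z ∉ D) : Z.sub A z = ⊥ := by
  have : {φ : Z.Amb U z | z ∈ D ∧ ∃ i g v, φ = Z.gen A z i g v} = ∅ := by
    ext φ
    simp [hz]
  rw [sub, this, Submodule.span_empty]

theorem pre_mem {z z' : P.Obj} (hz : z' ∈ D) (f : P.Hom z z') :
    ∀ φ ∈ Z.sub A z, Z.pre f φ ∈ Z.sub A z' := by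
  intro φ hφ
  refine Z.sub_induction A (Q := fun φ => Z.pre f φ ∈ Z.sub A z') ?_ ?_ ?_ ?_ hφ
  · intro i g v
    rw [Z.pre_gen]
    exact Z.gen_mem A hz _ _ _
  · rw [map_zero]
    exact Submodule.zero_mem _
  · intro a b ha hb
    rw [map_add]
    exact Submodule.add_mem _ ha hb
  · intro r a ha
    rw [map_smul]
    exact Submodule.smul_mem _ _ ha

variable (hA : ∀ t i, ¬ Z.E t i → A t i = 0)

theorem apply_eq_zero (hA : ∀ t i, ¬ Z.E t i → A t i = 0)
    {z : P.Obj} {φ : Z.Amb U z} (hφ : φ ∈ Z.sub A z) (t : Z.T)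
    (h : P.Hom z (Z.d t)) (hh : I _ _ h) : φ t h = 0 := by
  refine Z.sub_induction A (Q := fun φ => φ t h = 0) ?_ rfl ?_ ?_ hφ
  · intro i g v
    by_cases hE : Z.E t i
    · have : h ⬝ g ≠ Z.p t i := by
        intro h1
        apply Z.not_I t i hE
        rw [← h1]
        exact Z.ideal.right _ _ hh
      simp only [gen, if_neg this]
    · simp only [gen, hA t i hE, LinearMap.zero_apply, ite_self]
  · intro a b ha hb
    simp [ha, hb]
  · intro r a ha
    simp [ha]

open Classical in
/-- the zigzag module -/
noncomputable def module : RMod P ℚ D I where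
  M z := Z.sub A z
  act {z z'} f := if hz : z' ∈ D then (Z.pre f).restrict (Z.pre_mem A hz f) else 0
  act_id z hz := by
    rw [dif_pos hz]
    ext φ : 2
    funext t h
    simp only [pre, LinearMap.coe_restrict_apply, LinearMap.coe_mk, AddHom.coe_mk, P.comp_id,
      LinearMap.id_apply]
  act_comp {x y z} hx hy hz g f := by
    rw [dif_pos hz, dif_pos hz, dif_pos hy]
    ext φ : 2
    funext t h
    simp only [pre, LinearMap.coe_restrict_apply, LinearMap.coe_mk, AddHom.coe_mk, P.assoc,
      LinearMap.comp_apply]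
  act_zero {x y} hx hy := by
    rw [dif_pos hy]
    ext φ : 2
    funext t h
    simp only [pre, LinearMap.coe_restrict_apply, LinearMap.coe_mk, AddHom.coe_mk, P.comp_zero,
      LinearMap.zero_apply, Submodule.coe_zero, Pi.zero_apply]
    exact Z.apply_eq_zero A hA φ.2 t _ (Z.ideal.zero _ _)
  supp z hz m := by
    have h := (Z.sub_eq_bot A hz).le m.2
    rw [Submodule.mem_bot] at h
    exact Subtype.ext h
  killed {a b} f hf := by
    split_ifs with hb
    · ext φ : 2
      funext t h
      simp only [pre, LinearMap.coe_restrict_apply, LinearMap.coe_mk, AddHom.coe_mk,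
        LinearMap.zero_apply, Submodule.coe_zero, Pi.zero_apply]
      exact Z.apply_eq_zero A hA φ.2 t _ (Z.ideal.left _ _ hf)
    · rfl

theorem act_coe {z z' : P.Obj} (hz : z' ∈ D) (f : P.Hom z z') (φ : Z.sub A z) :
    ((Z.module A hA).act f φ : Z.sub A z').1 = Z.pre f φ.1 := by
  simp only [module, dif_pos hz]
  rfl

theorem finDim [FiniteDimensional ℚ U] : (Z.module A hA).FinDim := by
  have := Z.finite_T
  constructor
  · intro z
    change FiniteDimensional ℚ (Z.sub A z)
    infer_instance
  · refine Z.finite_D.subset ?_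
    rintro z ⟨m, hm⟩
    by_contra hz
    exact hm ((Z.module A hA).supp z hz m)

open Classical in
/-- the socle element at the sink `t` -/
noncomputable def del (t : Z.T) : U →ₗ[ℚ] Z.Amb U (Z.d t) where
  toFun u := fun _ h => if P.IsId h then u else 0
  map_add' a b := by
    funext t h
    dsimp
    split_ifs <;> simp
  map_smul' r a := by
    funext t h
    dsimp
    split_ifs <;> simp

theorem del_id (t : Z.T) (u : U) : Z.del t u t (P.id _) = u := by
  simp only [del, LinearMap.coe_mk, AddHom.coe_mk, if_pos (isId_id _)]

theorem del_of_not_isId (t : Z.T) (u : U) {t' : Z.T} {h : P.Hom (Z.d t) (Z.d t')}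
    (hh : ¬ P.IsId h) : Z.del t u t' h = 0 := by
  simp only [del, LinearMap.coe_mk, AddHom.coe_mk, if_neg hh]

theorem eq_del {t : Z.T} {φ : Z.Amb U (Z.d t)}
    (h0 : ∀ t' (h : P.Hom (Z.d t) (Z.d t')), ¬ P.IsId h → φ t' h = 0) :
    φ = Z.del t (φ t (P.id _)) := by
  funext t' h
  by_cases hh : P.IsId h
  · obtain ⟨h1, h2⟩ := hh
    obtain rfl := Z.d_inj h1
    rw [eq_of_heq h2, Z.del_id]
  · rw [h0 _ _ hh, Z.del_of_not_isId t _ hh]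

theorem pre_gen_edge (hA : ∀ t i, ¬ Z.E t i → A t i = 0)
    {t : Z.T} {i : Z.S} (hE : Z.E t i) (v : U) :
    Z.pre (Z.p t i) (Z.gen A _ i (P.id _) v) = Z.del t (A t i v) := by
  rw [pre_gen, P.comp_id]
  have h1 : Z.gen A (Z.d t) i (Z.p t i) v t (P.id _) = A t i v := by
    simp only [gen, P.id_comp, if_true]
  rw [← h1]
  apply Z.eq_del
  intro t' h hh
  by_cases hE' : Z.E t' i
  · have : h ⬝ Z.p t i ≠ Z.p t' i := by
      intro h2
      obtain rfl := Z.left_inc t t' i hE hE' h h2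
      exact hh ((isId_iff h).2 (absorb_left (Z.ideal.ne_zero (Z.not_I _ _ hE)) h2.symm))
    simp only [gen, if_neg this]
  · simp only [gen, hA _ _ hE', LinearMap.zero_apply, ite_self]

theorem del_mem (hA : ∀ t i, ¬ Z.E t i → A t i = 0)
    (t : Z.T) (i : Z.S) (v : U) : Z.del t (A t i v) ∈ Z.sub A (Z.d t) := by
  by_cases hE : Z.E t i
  · rw [← Z.pre_gen_edge A hA hE]
    exact Z.pre_mem A (Z.d_mem t) _ _ (Z.gen_mem A (Z.c_mem i) _ _ _)
  · rw [hA t i hE, LinearMap.zero_apply, map_zero]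
    exact Submodule.zero_mem _

theorem exists_source (hA : ∀ t i, ¬ Z.E t i → A t i = 0)
    {i : Z.S} {φ : Z.Amb U (Z.c i)} (hφ : φ ∈ Z.sub A (Z.c i)) :
    ∃ w, ∀ t, Z.E t i → φ t (Z.p t i) = A t i w := by
  refine Z.sub_induction A (Q := fun φ => ∃ w, ∀ t, Z.E t i → φ t (Z.p t i) = A t i w)
    ?_ ?_ ?_ ?_ hφ
  · intro j g v
    by_cases hex : ∃ t, Z.E t i ∧ Z.E t j ∧ Z.p t i ⬝ g = Z.p t j
    · obtain ⟨t, h1, h2, h3⟩ := hex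
      obtain rfl := Z.right_inc t i j h1 h2 g h3
      obtain rfl := absorb_right (Z.ideal.ne_zero (Z.not_I _ _ h1)) h3.symm
      refine ⟨v, fun t _ => ?_⟩
      simp only [gen, P.comp_id, if_true]
    · refine ⟨0, fun t ht => ?_⟩
      rw [map_zero]
      by_cases hj : Z.E t j
      · have : Z.p t i ⬝ g ≠ Z.p t j := fun h => hex ⟨t, ht, hj, h⟩
        simp only [gen, if_neg this]
      · simp only [gen, hA _ _ hj, LinearMap.zero_apply, ite_self]
  · exact ⟨0, fun t _ => by simp⟩
  · rintro a b ⟨w, hw⟩ ⟨w', hw'⟩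
    exact ⟨w + w', fun t ht => by simp [hw t ht, hw' t ht]⟩
  · rintro r a ⟨w, hw⟩
    exact ⟨r • w, fun t ht => by simp [hw t ht]⟩

theorem apply_mem_range {z : P.Obj} {φ : Z.Amb U z} (hφ : φ ∈ Z.sub A z) (t : Z.T)
    (h : P.Hom z (Z.d t)) : φ t h ∈ ⨆ i, LinearMap.range (A t i) := by
  refine Z.sub_induction A (Q := fun φ => φ t h ∈ ⨆ i, LinearMap.range (A t i)) ?_ ?_ ?_ ?_ hφ
  · intro i g v
    simp only [gen]
    split_ifs
    · exact Submodule.mem_iSup_of_mem i ⟨v, rfl⟩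
    · exact Submodule.zero_mem _
  · exact Submodule.zero_mem _
  · exact fun a b ha hb => Submodule.add_mem _ ha hb
  · exact fun r a ha => Submodule.smul_mem _ _ ha

theorem essential_socle (hA : ∀ t i, ¬ Z.E t i → A t i = 0)
    {z : P.Obj} {φ : Z.Amb U z} (hφ : φ ∈ Z.sub A z) (h0 : φ ≠ 0) :
    ∃ (t : Z.T) (f : P.Hom z (Z.d t)) (u : U), u ≠ 0 ∧ Z.pre f φ = Z.del t u := by
  have := Z.finite_T
  let X : Type := {s : Σ t, P.Hom z (Z.d t) // φ s.1 s.2 ≠ 0}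
  have hX0 : ∀ s : X, s.1.2 ≠ P.zero _ _ := by
    intro s hs
    apply s.2
    rw [hs]
    exact Z.apply_eq_zero A hA hφ _ _ (Z.ideal.zero _ _)
  let r : X → X → Prop := fun s s' => ∃ k : P.Hom (Z.d s'.1.1) (Z.d s.1.1),
    ¬ P.IsId k ∧ s.1.2 = k ⬝ s'.1.2
  have hirr : ∀ s, ¬ r s s := by
    rintro s ⟨k, hk, h⟩
    exact hk ((isId_iff k).2 (absorb_left (hX0 s) h))
  have htr : ∀ a b c, r a b → r b c → r a c := by
    rintro a b c ⟨k, hk, h⟩ ⟨k', hk', h'⟩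
    refine ⟨k ⬝ k', fun hi => hk (isId_of_comp_isId hi).1, ?_⟩
    rw [h, h', P.assoc]
  have : IsTrans X r := ⟨htr⟩
  have : Std.Irrefl r := ⟨hirr⟩
  have hwf : WellFounded r := Finite.wellFounded_of_trans_of_irrefl r
  have hne : ∃ t h, φ t h ≠ 0 := by
    by_contra hcon
    push Not at hcon
    exact h0 (funext fun t => funext fun h => hcon t h)
  obtain ⟨t, h, hth⟩ := hne
  obtain ⟨s, -, hs⟩ := hwf.has_min Set.univ ⟨(⟨⟨t, h⟩, hth⟩ : X), trivial⟩
  refine ⟨s.1.1, s.1.2, φ s.1.1 s.1.2, s.2, ?_⟩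
  have h1 : Z.pre s.1.2 φ s.1.1 (P.id _) = φ s.1.1 s.1.2 := by
    simp only [pre, LinearMap.coe_mk, AddHom.coe_mk, P.id_comp]
  rw [← h1]
  apply Z.eq_del
  intro t' k hk
  by_contra hcon
  exact hs ⟨⟨t', k ⬝ s.1.2⟩, hcon⟩ trivial ⟨k, hk, rfl⟩

variable (A' : Z.T → Z.S → U →ₗ[ℚ] U) (hA' : ∀ t i, ¬ Z.E t i → A' t i = 0)

theorem hom_pre (θ : RModHom (Z.module A hA) (Z.module A' hA')) {z z' : P.Obj} (hz : z' ∈ D)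
    (f : P.Hom z z') (φ : Z.sub A z) (hf : Z.pre f φ.1 ∈ Z.sub A z') :
    (θ.app z' ⟨Z.pre f φ.1, hf⟩ : Z.sub A' z').1 = Z.pre f (θ.app z φ : Z.sub A' z).1 := by
  have h1 := LinearMap.congr_fun (θ.natural f) φ
  have h2 : (Z.module A hA).act f φ = (⟨Z.pre f φ.1, hf⟩ : Z.sub A z') :=
    Subtype.ext (Z.act_coe A hA hz f φ)
  change (Z.module A' hA').act f (θ.app z φ) = θ.app z' ((Z.module A hA).act f φ) at h1
  rw [h2] at h1
  rw [← h1]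
  exact Z.act_coe A' hA' hz f _

theorem exists_socle_map (θ : RModHom (Z.module A hA) (Z.module A' hA')) :
    ∃ B : Z.T → U →ₗ[ℚ] U,
      (∀ t u (hu : Z.del t u ∈ Z.sub A (Z.d t)),
        (θ.app (Z.d t) ⟨Z.del t u, hu⟩ : Z.sub A' (Z.d t)).1 = Z.del t (B t u)) ∧
      ∀ i v, ∃ w, ∀ t, B t (A t i v) = A' t i w := by
  let R : ∀ t, Submodule ℚ U := fun t => (Z.sub A (Z.d t)).comap (Z.del t)
  let f : ∀ t, R t →ₗ[ℚ] U := fun t =>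
    { toFun := fun u => (θ.app (Z.d t) ⟨Z.del t u.1, u.2⟩ : Z.sub A' (Z.d t)).1 t (P.id _)
      map_add' := by
        intro a b
        have : (⟨Z.del t (a + b : R t).1, (a + b).2⟩ : Z.sub A (Z.d t)) =
            ⟨Z.del t a.1, a.2⟩ + ⟨Z.del t b.1, b.2⟩ := Subtype.ext (map_add (Z.del t) a.1 b.1)
        rw [this]
        erw [map_add]
        rfl
      map_smul' := by
        intro r a
        have : (⟨Z.del t (r • a : R t).1, (r • a).2⟩ : Z.sub A (Z.d t)) =
            r • ⟨Z.del t a.1, a.2⟩ := Subtype.ext (map_smul (Z.del t) r a.1)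
        rw [this]
        erw [map_smul]
        rfl }
  choose B hB using fun t => LinearMap.exists_extend (f t)
  have hBe : ∀ t u (hu : Z.del t u ∈ Z.sub A (Z.d t)),
      (θ.app (Z.d t) ⟨Z.del t u, hu⟩ : Z.sub A' (Z.d t)).1 = Z.del t (B t u) := by
    intro t u hu
    have h1 : B t u = f t ⟨u, hu⟩ := by
      rw [← hB t]
      rfl
    rw [h1]
    apply Z.eq_del
    intro t' h hh
    have h2 : Z.pre h (Z.del t u) = 0 := by
      funext t'' k
      change Z.del t u t'' (k ⬝ h) = 0
      exact Z.del_of_not_isId t u (fun hi => hh (isId_of_comp_isId hi).2)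
    have hm : Z.pre h (Z.del t u) ∈ Z.sub A (Z.d t') := by
      rw [h2]
      exact Submodule.zero_mem _
    have h3 := Z.hom_pre A hA A' hA' θ (Z.d_mem t') h ⟨Z.del t u, hu⟩ hm
    have h4 : (⟨Z.pre h (Z.del t u), hm⟩ : Z.sub A (Z.d t')) = 0 := Subtype.ext h2
    rw [h4] at h3
    erw [map_zero] at h3
    have h5 := congrFun (congrFun h3 t') (P.id _)
    simp only [pre, LinearMap.coe_mk, AddHom.coe_mk, P.id_comp] at h5
    exact h5.symm
  refine ⟨B, hBe, fun i v => ?_⟩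
  have hg := Z.gen_mem A (Z.c_mem i) i (P.id _) v
  obtain ⟨w, hw⟩ := Z.exists_source A' hA'
    (θ.app (Z.c i) ⟨Z.gen A _ i (P.id _) v, hg⟩ : Z.sub A' (Z.c i)).2
  refine ⟨w, fun t => ?_⟩
  by_cases hE : Z.E t i
  · rw [← hw t hE]
    have hm := Z.pre_mem A (Z.d_mem t) (Z.p t i) _ hg
    have h3 := Z.hom_pre A hA A' hA' θ (Z.d_mem t) (Z.p t i) ⟨_, hg⟩ hm
    have hd : Z.del t (A t i v) ∈ Z.sub A (Z.d t) := Z.del_mem A hA t i v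
    have h4 : (⟨Z.pre (Z.p t i) (Z.gen A _ i (P.id _) v), hm⟩ : Z.sub A (Z.d t)) =
        ⟨Z.del t (A t i v), hd⟩ := Subtype.ext (Z.pre_gen_edge A hA hE v)
    rw [h4, hBe t _ hd] at h3
    have h5 := congrFun (congrFun h3 t) (P.id _)
    rw [Z.del_id] at h5
    rw [h5]
    simp only [pre, LinearMap.coe_mk, AddHom.coe_mk, P.id_comp]
  · rw [hA t i hE, hA' t i hE, LinearMap.zero_apply, LinearMap.zero_apply, map_zero]

end Zigzag

end RayCategory

namespace RayCategory

namespace Zigzag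

variable {P : RayCategory} {D : Set P.Obj} {I : ∀ a b : P.Obj, P.Hom a b → Prop}
  (Z : Zigzag P D I) {U : Type} [AddCommGroup U] [Module ℚ U]

theorem eq_zero_of_forall_del (A : Z.T → Z.S → U →ₗ[ℚ] U) (hA : ∀ t i, ¬ Z.E t i → A t i = 0)
    {z : P.Obj} (φ : (Z.module A hA).M z)
    (h : ∀ (t : Z.T) (f : P.Hom z (Z.d t)) (u : U),
      ((Z.module A hA).act f φ : Z.sub A (Z.d t)).1 = Z.del t u → u = 0) : φ = 0 := by
  by_contra hφ
  have hφ' : (φ : Z.sub A z).1 ≠ 0 := fun h' => hφ (Subtype.ext h')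
  obtain ⟨t, f, u, hu, hf⟩ := Z.essential_socle A hA (φ : Z.sub A z).2 hφ'
  exact hu (h t f u ((Z.act_coe A hA (Z.d_mem t) f φ).trans hf))

theorem mem_iSup_range (A : Z.T → Z.S → U →ₗ[ℚ] U) {t : Z.T} {u : U}
    (hu : Z.del t u ∈ Z.sub A (Z.d t)) : u ∈ ⨆ i, LinearMap.range (A t i) := by
  have := Z.apply_mem_range A hu t (P.id _)
  rwa [Z.del_id] at this

theorem map_eq_smul {V : Type} [AddCommGroup V] [Module ℚ V] {S : Type} {A : S → V →ₗ[ℚ] V}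
    {B : V →ₗ[ℚ] V} {r : ℚ} (h : ∀ i v, B (A i v) = r • A i v) {u : V}
    (hu : u ∈ ⨆ i, LinearMap.range (A i)) : B u = r • u := by
  have h1 : (⨆ i, LinearMap.range (A i)) ≤ LinearMap.ker (B - r • LinearMap.id) := by
    refine iSup_le fun i => ?_
    rintro _ ⟨v, rfl⟩
    simp [h i v]
  have h2 := h1 hu
  rw [LinearMap.mem_ker, LinearMap.sub_apply, sub_eq_zero] at h2
  exact h2

theorem indec (A : Z.T → Z.S → U →ₗ[ℚ] U) (hA : ∀ t i, ¬ Z.E t i → A t i = 0)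
    (hBr : ∀ B : Z.T → U →ₗ[ℚ] U, (∀ i v, ∃ w, ∀ t, B t (A t i v) = A t i w) →
      ∃ r : ℚ, ∀ t i v, B t (A t i v) = r • A t i v)
    {t₀ : Z.T} {i₀ : Z.S} {v₀ : U} (h₀ : A t₀ i₀ v₀ ≠ 0) : (Z.module A hA).Indec := by
  have hd : Z.del t₀ (A t₀ i₀ v₀) ∈ Z.sub A (Z.d t₀) := Z.del_mem A hA t₀ i₀ v₀
  have hne : ∀ {t : Z.T} {u : U}, Z.del t u = 0 → u = 0 := by
    intro t u h
    have := congrFun (congrFun h t) (P.id _)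
    rwa [Z.del_id] at this
  have hinj : ∀ {t : Z.T} {u u' : U}, Z.del t u = Z.del t u' → u = u' := by
    intro t u u' h
    rw [← sub_eq_zero, ← map_sub] at h
    exact sub_eq_zero.1 (hne h)
  refine ⟨⟨Z.d t₀, (⟨_, hd⟩ : Z.sub A (Z.d t₀)), fun h => h₀ (hne (congrArg Subtype.val h))⟩, ?_⟩
  intro e he
  obtain ⟨B, hB, hBw⟩ := Z.exists_socle_map A hA A hA e
  obtain ⟨r, hr⟩ := hBr B hBw
  have hBr' : ∀ t u, Z.del t u ∈ Z.sub A (Z.d t) → B t u = r • u := fun t u hu =>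
    map_eq_smul (fun i v => hr t i v) (Z.mem_iSup_range A hu)
  have hmem : ∀ {t u}, Z.del t u ∈ Z.sub A (Z.d t) → Z.del t (r • u) ∈ Z.sub A (Z.d t) := by
    intro t u hu
    rw [map_smul]
    exact Submodule.smul_mem _ _ hu
  have hdel : ∀ t u (hu : Z.del t u ∈ Z.sub A (Z.d t)),
      (e.app (Z.d t) (⟨_, hu⟩ : Z.sub A (Z.d t)) : Z.sub A (Z.d t)) = ⟨_, hmem hu⟩ := by
    intro t u hu
    apply Subtype.ext
    rw [hB t u hu, hBr' t u hu]
  have he' : ∀ z (φ : (Z.module A hA).M z), e.app z (e.app z φ) = e.app z φ := fun z φ =>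
    LinearMap.congr_fun (he z) φ
  have hrr : r * r = r := by
    have h1 := he' (Z.d t₀) (⟨_, hd⟩ : Z.sub A (Z.d t₀))
    rw [hdel _ _ hd, hdel _ _ (hmem hd)] at h1
    have h2 := hinj (congrArg Subtype.val h1)
    rw [smul_smul] at h2
    exact smul_left_injective ℚ h₀ h2
  have hnat : ∀ {z z' : P.Obj} (f : P.Hom z z') (φ : (Z.module A hA).M z),
      (Z.module A hA).act f (e.app z φ) = e.app z' ((Z.module A hA).act f φ) := fun f φ =>
    LinearMap.congr_fun (e.natural f) φ
  have hact : ∀ {z : P.Obj} {t : Z.T} {u : U} (f : P.Hom z (Z.d t)) (φ : (Z.module A hA).M z),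
      ((Z.module A hA).act f φ : Z.sub A (Z.d t)).1 = Z.del t u →
      (e.app (Z.d t) ((Z.module A hA).act f φ) : Z.sub A (Z.d t)).1 = Z.del t (r • u) := by
    intro z t u f φ h
    have hu : Z.del t u ∈ Z.sub A (Z.d t) := by
      rw [← h]
      exact ((Z.module A hA).act f φ : Z.sub A (Z.d t)).2
    have h1 : (Z.module A hA).act f φ = (⟨_, hu⟩ : Z.sub A (Z.d t)) := Subtype.ext h
    rw [h1]
    exact congrArg Subtype.val (hdel t u hu)
  have hr01 : r = 0 ∨ r = 1 := by
    rcases eq_or_ne r 0 with h | h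
    · exact Or.inl h
    · exact Or.inr (mul_left_cancel₀ h (by rw [hrr, mul_one]))
  rcases hr01 with rfl | rfl
  · left
    intro z
    ext φ
    refine Z.eq_zero_of_forall_del A hA _ fun t f u hf => ?_
    have h1 := hact f _ hf
    rw [← hnat, he', hf, zero_smul] at h1
    exact hinj (h1.trans rfl)
  · right
    intro z
    ext φ
    rw [LinearMap.id_apply, ← sub_eq_zero]
    refine Z.eq_zero_of_forall_del A hA _ fun t f u hf => ?_
    have h1 := hact f _ hf
    rw [← hnat, map_sub, he', sub_self, map_zero, one_smul] at h1
    exact hne h1.symm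

/-- A one-parameter family of bricks on a zigzag shows that the category is not
representation-finite. -/
theorem not_repFin [FiniteDimensional ℚ U] (A : ℚ → Z.T → Z.S → U →ₗ[ℚ] U)
    (hA : ∀ l t i, ¬ Z.E t i → A l t i = 0)
    (hBr : ∀ l l' (B : Z.T → U →ₗ[ℚ] U), (∀ i v, ∃ w, ∀ t, B t (A l t i v) = A l' t i w) →
      (l = l' ∧ ∃ r : ℚ, ∀ t i v, B t (A l t i v) = r • A l t i v) ∨
        ∀ t i v, B t (A l t i v) = 0)
    (t₀ : Z.T) (i₀ : Z.S) (v₀ : U) (h₀ : ∀ l, A l t₀ i₀ v₀ ≠ 0) : ¬ RepFin P D I := by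
  intro hrep
  obtain ⟨ι, _, rep, h⟩ := hrep ℚ (Z.d t₀)
  have hd : ∀ l, Z.del t₀ (A l t₀ i₀ v₀) ∈ Z.sub (A l) (Z.d t₀) := fun l =>
    Z.del_mem (A l) (hA l) t₀ i₀ v₀
  have hd0 : ∀ l, (⟨_, hd l⟩ : Z.sub (A l) (Z.d t₀)) ≠ 0 := by
    intro l h
    have h1 : Z.del t₀ (A l t₀ i₀ v₀) t₀ (P.id _) = 0 :=
      congrFun (congrFun (congrArg Subtype.val h) t₀) (P.id _)
    rw [Z.del_id] at h1
    exact h₀ l h1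
  have hiso : ∀ l, ∃ i, RModIso (rep i) (Z.module (A l) (hA l)) := by
    intro l
    refine h _ (Z.finDim (A l) (hA l)) (Z.indec (A l) (hA l) ?_ (h₀ l)) ⟨_, hd0 l⟩
    intro B hB
    rcases hBr l l B hB with ⟨-, hr⟩ | h0
    · exact hr
    · exact ⟨0, fun t i v => by rw [h0, zero_smul]⟩
  choose f hf using hiso
  obtain ⟨l, l', hne, hll⟩ := Finite.exists_ne_map_eq_of_infinite f
  obtain ⟨φ, hφ⟩ := hf l
  have hf' := hf l'
  rw [← hll] at hf'
  obtain ⟨ψ, hψ⟩ := hf'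
  let ε : ∀ z, (rep (f l)).M z ≃ₗ[ℚ] (Z.module (A l) (hA l)).M z := fun z =>
    LinearEquiv.ofBijective (φ.app z) (hφ z)
  let θ : RModHom (Z.module (A l) (hA l)) (Z.module (A l') (hA l')) :=
    { app := fun z => (ψ.app z).comp (ε z).symm.toLinearMap
      natural := by
        intro z z' g
        ext m
        obtain ⟨n, rfl⟩ := (ε z).surjective m
        have h1 := LinearMap.congr_fun (φ.natural g) n
        have h2 := LinearMap.congr_fun (ψ.natural g) n
        change (Z.module (A l) (hA l)).act g (ε z n) = ε z' ((rep (f l)).act g n) at h1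
        change (Z.module (A l') (hA l')).act g (ψ.app z ((ε z).symm (ε z n))) =
          ψ.app z' ((ε z').symm ((Z.module (A l) (hA l)).act g (ε z n)))
        rw [h1, LinearEquiv.symm_apply_apply, LinearEquiv.symm_apply_apply]
        exact h2 }
  obtain ⟨B, hB, hBw⟩ := Z.exists_socle_map (A l) (hA l) (A l') (hA l') θ
  rcases hBr l l' B hBw with ⟨rfl, -⟩ | h0
  · exact hne rfl
  · have h1 := hB t₀ _ (hd l)
    rw [h0, map_zero] at h1
    have h2 : ψ.app (Z.d t₀) ((ε (Z.d t₀)).symm (⟨_, hd l⟩ : Z.sub (A l) (Z.d t₀))) = 0 :=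
      Subtype.ext h1
    have h3 := (hψ (Z.d t₀)).1 (h2.trans (map_zero _).symm)
    exact hd0 l ((LinearEquiv.map_eq_zero_iff _).1 h3)

end Zigzag

end RayCategory

namespace RayCategory

section Shapes

variable {P : RayCategory} {D : Set P.Obj} {I : ∀ a b : P.Obj, P.Hom a b → Prop}

/-- Four pairwise incomparable morphisms with the same target (the four subspace problem). -/
theorem not_repFin_of_four (hD : D.Finite) (hI : IsIdeal I) {z a₁ a₂ a₃ a₄ : P.Obj}
    (hz : z ∈ D) (ha₁ : a₁ ∈ D) (ha₂ : a₂ ∈ D) (ha₃ : a₃ ∈ D) (ha₄ : a₄ ∈ D)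
    {q₁ : P.Hom a₁ z} {q₂ : P.Hom a₂ z} {q₃ : P.Hom a₃ z} {q₄ : P.Hom a₄ z}
    (h₁ : ¬ I _ _ q₁) (h₂ : ¬ I _ _ q₂) (h₃ : ¬ I _ _ q₃) (h₄ : ¬ I _ _ q₄)
    (h₁₂ : RInc q₁ q₂) (h₁₃ : RInc q₁ q₃) (h₁₄ : RInc q₁ q₄) (h₂₃ : RInc q₂ q₃)
    (h₂₄ : RInc q₂ q₄) (h₃₄ : RInc q₃ q₄) : ¬ RepFin P D I := by
  let Z : Zigzag P D I :=
    { S := Fin 4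
      T := Unit
      finite_T := inferInstance
      finite_D := hD
      ideal := hI
      c := fun i => match i with | 0 => a₁ | 1 => a₂ | 2 => a₃ | 3 => a₄
      d := fun _ => z
      d_inj := fun _ _ _ => rfl
      c_mem := fun i => match i with | 0 => ha₁ | 1 => ha₂ | 2 => ha₃ | 3 => ha₄
      d_mem := fun _ => hz
      p := fun _ i => match i with | 0 => q₁ | 1 => q₂ | 2 => q₃ | 3 => q₄
      E := fun _ _ => True
      not_I := fun _ i _ => match i with | 0 => h₁ | 1 => h₂ | 2 => h₃ | 3 => h₄
      right_inc := by
        intro t i j _ _ g hg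
        fin_cases i <;> fin_cases j <;> first
          | rfl
          | exact (h₁₂.1 ⟨g, hg.symm⟩).elim | exact (h₁₂.2 ⟨g, hg.symm⟩).elim
          | exact (h₁₃.1 ⟨g, hg.symm⟩).elim | exact (h₁₃.2 ⟨g, hg.symm⟩).elim
          | exact (h₁₄.1 ⟨g, hg.symm⟩).elim | exact (h₁₄.2 ⟨g, hg.symm⟩).elim
          | exact (h₂₃.1 ⟨g, hg.symm⟩).elim | exact (h₂₃.2 ⟨g, hg.symm⟩).elim
          | exact (h₂₄.1 ⟨g, hg.symm⟩).elim | exact (h₂₄.2 ⟨g, hg.symm⟩).elim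
          | exact (h₃₄.1 ⟨g, hg.symm⟩).elim | exact (h₃₄.2 ⟨g, hg.symm⟩).elim
      left_inc := fun _ _ _ _ _ _ _ => rfl }
  let line : ℚ → Fin 4 → ℚ × ℚ := fun l i =>
    match i with | 0 => (1, 0) | 1 => (0, 1) | 2 => (1, 1) | 3 => (1, l)
  refine Z.not_repFin (U := ℚ × ℚ)
    (fun l _ i => LinearMap.toSpanSingleton ℚ _ (line l i) ∘ₗ LinearMap.fst ℚ ℚ ℚ)
    (fun _ _ _ h => absurd trivial h) ?_ () (0 : Fin 4) (1, 0) ?_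
  · intro l l' B hB
    obtain ⟨w₁, k₁⟩ := hB (0 : Fin 4) (1, 0)
    obtain ⟨w₂, k₂⟩ := hB (1 : Fin 4) (1, 0)
    obtain ⟨w₃, k₃⟩ := hB (2 : Fin 4) (1, 0)
    obtain ⟨w₄, k₄⟩ := hB (3 : Fin 4) (1, 0)
    replace k₁ := k₁ ()
    replace k₂ := k₂ ()
    replace k₃ := k₃ ()
    replace k₄ := k₄ ()
    simp only [LinearMap.comp_apply, LinearMap.fst_apply, LinearMap.toSpanSingleton_apply, line,
      one_smul] at k₁ k₂ k₃ k₄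
    have e : ∀ v : ℚ × ℚ, B () v = (v.1 * w₁.1, v.2 * w₂.1) := by
      rintro ⟨a, b⟩
      have : ((a, b) : ℚ × ℚ) = a • (1, 0) + b • (0, 1) := by simp
      rw [this, map_add, map_smul, map_smul, k₁, k₂]
      simp
    rw [e] at k₃ k₄
    simp only [Prod.smul_mk, smul_eq_mul, Prod.mk.injEq] at k₃ k₄
    obtain ⟨m₁, m₂⟩ := k₃
    obtain ⟨m₃, m₄⟩ := k₄
    have hab : w₁.1 = w₂.1 := by linarith
    by_cases h0 : w₁.1 = 0
    · right
      intro t i v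
      cases t
      rw [e, ← hab, h0]
      simp
    · left
      refine ⟨mul_right_cancel₀ h0 ?_, w₁.1, fun t i v => ?_⟩
      · have h4 : w₄.1 = w₁.1 := by linarith
        rw [h4, ← hab] at m₄
        linarith
      · cases t
        rw [e, ← hab]
        ext <;> simp [mul_comm]
  · intro l h
    have := congrArg Prod.fst h
    simp [line] at this

/-- A four-cycle. -/
theorem not_repFin_of_cycle_four (hD : D.Finite) (hI : IsIdeal I) {c₁ c₂ d₁ d₂ : P.Obj}
    (hc₁ : c₁ ∈ D) (hc₂ : c₂ ∈ D) (hd₁ : d₁ ∈ D) (hd₂ : d₂ ∈ D) (hd : d₁ ≠ d₂)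
    {p₁₁ : P.Hom c₁ d₁} {p₁₂ : P.Hom c₂ d₁} {p₂₁ : P.Hom c₁ d₂} {p₂₂ : P.Hom c₂ d₂}
    (n₁₁ : ¬ I _ _ p₁₁) (n₁₂ : ¬ I _ _ p₁₂) (n₂₁ : ¬ I _ _ p₂₁) (n₂₂ : ¬ I _ _ p₂₂)
    (r₁ : RInc p₁₁ p₁₂) (r₂ : RInc p₂₁ p₂₂) (l₁ : LInc p₁₁ p₂₁) (l₂ : LInc p₁₂ p₂₂) :
    ¬ RepFin P D I := by
  let Z : Zigzag P D I :=
    { S := Fin 2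
      T := Fin 2
      finite_T := inferInstance
      finite_D := hD
      ideal := hI
      c := fun i => match i with | 0 => c₁ | 1 => c₂
      d := fun i => match i with | 0 => d₁ | 1 => d₂
      d_inj := by
        intro i j h
        fin_cases i <;> fin_cases j <;> first | rfl | exact absurd h hd | exact absurd h.symm hd
      c_mem := fun i => match i with | 0 => hc₁ | 1 => hc₂
      d_mem := fun i => match i with | 0 => hd₁ | 1 => hd₂
      p := fun t i => match t, i with | 0, 0 => p₁₁ | 0, 1 => p₁₂ | 1, 0 => p₂₁ | 1, 1 => p₂₂
      E := fun _ _ => True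
      not_I := fun t i _ =>
        match t, i with | 0, 0 => n₁₁ | 0, 1 => n₁₂ | 1, 0 => n₂₁ | 1, 1 => n₂₂
      right_inc := by
        intro t i j _ _ g hg
        fin_cases t <;> fin_cases i <;> fin_cases j <;> first
          | rfl
          | exact (r₁.1 ⟨g, hg.symm⟩).elim | exact (r₁.2 ⟨g, hg.symm⟩).elim
          | exact (r₂.1 ⟨g, hg.symm⟩).elim | exact (r₂.2 ⟨g, hg.symm⟩).elim
      left_inc := by
        intro t t' i _ _ g hg
        fin_cases i <;> fin_cases t <;> fin_cases t' <;> first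
          | rfl
          | exact (l₁.1 ⟨g, hg.symm⟩).elim | exact (l₁.2 ⟨g, hg.symm⟩).elim
          | exact (l₂.1 ⟨g, hg.symm⟩).elim | exact (l₂.2 ⟨g, hg.symm⟩).elim }
  let m : ℚ → Fin 2 → Fin 2 → ℚ := fun l t i =>
    match t, i with | 0, 0 => 1 | 0, 1 => 1 | 1, 0 => 1 | 1, 1 => l
  refine Z.not_repFin (U := ℚ) (fun l t i => m l t i • LinearMap.id)
    (fun _ _ _ h => absurd trivial h) ?_ (0 : Fin 2) (0 : Fin 2) 1 ?_
  · intro l l' B hB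
    have e : ∀ t (v : ℚ), B t v = v * B t 1 := by
      intro t v
      rw [← smul_eq_mul, ← map_smul, smul_eq_mul, mul_one]
    obtain ⟨w₁, k₁⟩ := hB (0 : Fin 2) 1
    obtain ⟨w₂, k₂⟩ := hB (1 : Fin 2) 1
    have k₁₁ := k₁ (0 : Fin 2)
    have k₁₂ := k₁ (1 : Fin 2)
    have k₂₁ := k₂ (0 : Fin 2)
    have k₂₂ := k₂ (1 : Fin 2)
    simp only [LinearMap.smul_apply, LinearMap.id_apply, m, smul_eq_mul, one_mul, mul_one]
      at k₁₁ k₁₂ k₂₁ k₂₂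
    rw [e] at k₂₂
    have hb : ∀ t, B t 1 = w₁ := by
      intro t
      fin_cases t
      · exact k₁₁
      · exact k₁₂
    by_cases h0 : w₁ = 0
    · right
      intro t i v
      rw [e, hb, h0, mul_zero]
    · left
      refine ⟨mul_right_cancel₀ h0 ?_, w₁, fun t i v => ?_⟩
      · rw [← k₂₁, k₁₁, hb] at k₂₂
        exact k₂₂
      · rw [e, hb, smul_eq_mul, mul_comm]
  · intro l h
    simp [m] at h

/-- A six-cycle. -/
theorem not_repFin_of_cycle_six (hD : D.Finite) (hI : IsIdeal I) {c₁ c₂ c₃ d₁ d₂ d₃ : P.Obj}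
    (hc₁ : c₁ ∈ D) (hc₂ : c₂ ∈ D) (hc₃ : c₃ ∈ D) (hd₁ : d₁ ∈ D) (hd₂ : d₂ ∈ D) (hd₃ : d₃ ∈ D)
    (h₁₂ : d₁ ≠ d₂) (h₁₃ : d₁ ≠ d₃) (h₂₃ : d₂ ≠ d₃)
    {p₁₁ : P.Hom c₁ d₁} {p₂₁ : P.Hom c₁ d₂} {p₂₂ : P.Hom c₂ d₂} {p₃₂ : P.Hom c₂ d₃}
    {p₃₃ : P.Hom c₃ d₃} {p₁₃ : P.Hom c₃ d₁}
    (n₁₁ : ¬ I _ _ p₁₁) (n₂₁ : ¬ I _ _ p₂₁) (n₂₂ : ¬ I _ _ p₂₂) (n₃₂ : ¬ I _ _ p₃₂)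
    (n₃₃ : ¬ I _ _ p₃₃) (n₁₃ : ¬ I _ _ p₁₃)
    (r₁ : RInc p₁₁ p₁₃) (r₂ : RInc p₂₁ p₂₂) (r₃ : RInc p₃₂ p₃₃)
    (l₁ : LInc p₁₁ p₂₁) (l₂ : LInc p₂₂ p₃₂) (l₃ : LInc p₃₃ p₁₃) :
    ¬ RepFin P D I := by
  let E : Fin 3 → Fin 3 → Prop := fun t i =>
    match t, i with | 0, 0 => True | 1, 0 => True | 1, 1 => True | 2, 1 => True | 2, 2 => True
                    | 0, 2 => True | 0, 1 => False | 1, 2 => False | 2, 0 => False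
  let Z : Zigzag P D I :=
    { S := Fin 3
      T := Fin 3
      finite_T := inferInstance
      finite_D := hD
      ideal := hI
      c := fun i => match i with | 0 => c₁ | 1 => c₂ | 2 => c₃
      d := fun i => match i with | 0 => d₁ | 1 => d₂ | 2 => d₃
      d_inj := by
        intro i j h
        fin_cases i <;> fin_cases j <;> first
          | rfl
          | exact absurd h h₁₂ | exact absurd h.symm h₁₂
          | exact absurd h h₁₃ | exact absurd h.symm h₁₃
          | exact absurd h h₂₃ | exact absurd h.symm h₂₃
      c_mem := fun i => match i with | 0 => hc₁ | 1 => hc₂ | 2 => hc₃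
      d_mem := fun i => match i with | 0 => hd₁ | 1 => hd₂ | 2 => hd₃
      p := fun t i => match t, i with
        | 0, 0 => p₁₁ | 1, 0 => p₂₁ | 1, 1 => p₂₂ | 2, 1 => p₃₂ | 2, 2 => p₃₃ | 0, 2 => p₁₃
        | 0, 1 => P.zero _ _ | 1, 2 => P.zero _ _ | 2, 0 => P.zero _ _
      E := E
      not_I := fun t i => match t, i with
        | 0, 0 => fun _ => n₁₁ | 1, 0 => fun _ => n₂₁ | 1, 1 => fun _ => n₂₂
        | 2, 1 => fun _ => n₃₂ | 2, 2 => fun _ => n₃₃ | 0, 2 => fun _ => n₁₃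
        | 0, 1 => False.elim | 1, 2 => False.elim | 2, 0 => False.elim
      right_inc := by
        intro t i j hi hj g hg
        fin_cases t <;> fin_cases i <;> fin_cases j <;> first
          | rfl
          | exact False.elim hi | exact False.elim hj
          | exact (r₁.1 ⟨g, hg.symm⟩).elim | exact (r₁.2 ⟨g, hg.symm⟩).elim
          | exact (r₂.1 ⟨g, hg.symm⟩).elim | exact (r₂.2 ⟨g, hg.symm⟩).elim
          | exact (r₃.1 ⟨g, hg.symm⟩).elim | exact (r₃.2 ⟨g, hg.symm⟩).elim
      left_inc := by
        intro t t' i hi hj g hg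
        fin_cases i <;> fin_cases t <;> fin_cases t' <;> first
          | rfl
          | exact False.elim hi | exact False.elim hj
          | exact (l₁.1 ⟨g, hg.symm⟩).elim | exact (l₁.2 ⟨g, hg.symm⟩).elim
          | exact (l₂.1 ⟨g, hg.symm⟩).elim | exact (l₂.2 ⟨g, hg.symm⟩).elim
          | exact (l₃.1 ⟨g, hg.symm⟩).elim | exact (l₃.2 ⟨g, hg.symm⟩).elim }
  let m : ℚ → Fin 3 → Fin 3 → ℚ := fun l t i =>
    match t, i with | 0, 0 => 1 | 1, 0 => 1 | 1, 1 => 1 | 2, 1 => 1 | 2, 2 => 1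
                    | 0, 2 => l | 0, 1 => 0 | 1, 2 => 0 | 2, 0 => 0
  refine Z.not_repFin (U := ℚ) (fun l t i => m l t i • LinearMap.id) ?_ ?_
    (0 : Fin 3) (0 : Fin 3) 1 ?_
  · intro l t i hE
    fin_cases t <;> fin_cases i <;> first
      | exact absurd trivial hE
      | exact zero_smul _ _
  · intro l l' B hB
    have e : ∀ t (v : ℚ), B t v = v * B t 1 := by
      intro t v
      rw [← smul_eq_mul, ← map_smul, smul_eq_mul, mul_one]
    obtain ⟨w₁, k₁⟩ := hB (0 : Fin 3) 1
    obtain ⟨w₂, k₂⟩ := hB (1 : Fin 3) 1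
    obtain ⟨w₃, k₃⟩ := hB (2 : Fin 3) 1
    have k₁₁ := k₁ (0 : Fin 3)
    have k₁₂ := k₁ (1 : Fin 3)
    have k₂₂ := k₂ (1 : Fin 3)
    have k₂₃ := k₂ (2 : Fin 3)
    have k₃₃ := k₃ (2 : Fin 3)
    have k₃₁ := k₃ (0 : Fin 3)
    simp only [LinearMap.smul_apply, LinearMap.id_apply, m, smul_eq_mul, one_mul, mul_one]
      at k₁₁ k₁₂ k₂₂ k₂₃ k₃₃ k₃₁
    rw [e] at k₃₁
    have hb : ∀ t, B t 1 = w₁ := by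
      intro t
      fin_cases t
      · exact k₁₁
      · exact k₁₂
      · exact k₂₃.trans (k₂₂.symm.trans k₁₂)
    by_cases h0 : w₁ = 0
    · right
      intro t i v
      rw [e, hb, h0, mul_zero]
    · left
      refine ⟨mul_right_cancel₀ h0 ?_, w₁, fun t i v => ?_⟩
      · rw [← k₃₃, hb, hb] at k₃₁
        exact k₃₁
      · rw [e, hb, smul_eq_mul, mul_comm]
  · intro l h
    simp [m] at h

end Shapes

end RayCategory

namespace RayCategory

section Shapes

variable {P : RayCategory} {D : Set P.Obj} {I : ∀ a b : P.Obj, P.Hom a b → Prop}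

/-- A set with three elements. -/
inductive Three : Type
  | a | b | c

/-- A set with four elements. -/
inductive Four : Type
  | a | b | c | d

instance : Finite Three :=
  Finite.of_surjective (fun o : Option Bool => match o with
    | none => Three.a | some false => Three.b | some true => Three.c)
    fun t => match t with | .a => ⟨none, rfl⟩ | .b => ⟨some false, rfl⟩ | .c => ⟨some true, rfl⟩

instance : Finite Four :=
  Finite.of_surjective (fun o : Bool × Bool => match o with
    | (false, false) => Four.a | (false, true) => Four.b
    | (true, false) => Four.c | (true, true) => Four.d)
    fun t => match t with
      | .a => ⟨(false, false), rfl⟩ | .b => ⟨(false, true), rfl⟩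
      | .c => ⟨(true, false), rfl⟩ | .d => ⟨(true, true), rfl⟩

/-- A one-parameter family of pencils `ℚ² → ℚ²`, embedded as `v ↦ (l v₁ - v₂, 0)`. -/
def pencil (l : ℚ) : ℚ × ℚ →ₗ[ℚ] ℚ × ℚ :=
  LinearMap.inl ℚ ℚ ℚ ∘ₗ (l • LinearMap.fst ℚ ℚ ℚ - LinearMap.snd ℚ ℚ ℚ)

theorem pencil_apply (l : ℚ) (v : ℚ × ℚ) : pencil l v = (l * v.1 - v.2, 0) := by
  simp [pencil]

/-- Projection onto the first coordinate axis. -/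
def axisFst : ℚ × ℚ →ₗ[ℚ] ℚ × ℚ := LinearMap.inl ℚ ℚ ℚ ∘ₗ LinearMap.fst ℚ ℚ ℚ

/-- Projection onto the second coordinate axis. -/
def axisSnd : ℚ × ℚ →ₗ[ℚ] ℚ × ℚ := LinearMap.inr ℚ ℚ ℚ ∘ₗ LinearMap.snd ℚ ℚ ℚ

theorem axisFst_apply (v : ℚ × ℚ) : axisFst v = (v.1, 0) := by simp [axisFst]

theorem axisSnd_apply (v : ℚ × ℚ) : axisSnd v = (0, v.2) := by simp [axisSnd]

/-- A diagonal endomorphism compatible with two members of the pencil family is a scalar. -/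
theorem pencil_rigid {l l' : ℚ} {B₀ B₁ B₂ : ℚ × ℚ →ₗ[ℚ] ℚ × ℚ}
    (h₁ : ∃ w : ℚ × ℚ, B₀ (1, 0) = (w.1, 0)) (h₂ : ∃ w : ℚ × ℚ, B₀ (0, 1) = (0, w.2))
    (h : ∀ v : ℚ × ℚ, B₁ (1 * v.1 - v.2, 0) = (1 * (B₀ v).1 - (B₀ v).2, 0) ∧
      B₂ (l * v.1 - v.2, 0) = (l' * (B₀ v).1 - (B₀ v).2, 0)) :
    (l = l' ∧ ∃ r : ℚ, (∀ v, B₀ v = r • v) ∧ (∀ v, B₁ (pencil 1 v) = r • pencil 1 v) ∧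
      ∀ v, B₂ (pencil l v) = r • pencil l v) ∨
    ((∀ v, B₀ v = 0) ∧ (∀ v, B₁ (pencil 1 v) = 0) ∧ ∀ v, B₂ (pencil l v) = 0) := by
  obtain ⟨w₁, k₁⟩ := h₁
  obtain ⟨w₂, k₂⟩ := h₂
  have e : ∀ v : ℚ × ℚ, B₀ v = (v.1 * w₁.1, v.2 * w₂.2) := by
    rintro ⟨a, b⟩
    have : ((a, b) : ℚ × ℚ) = a • (1, 0) + b • (0, 1) := by simp
    rw [this, map_add, map_smul, map_smul, k₁, k₂]
    simp
  have z : ∀ B : ℚ × ℚ →ₗ[ℚ] ℚ × ℚ, B (0, 0) = (0, 0) := fun B => B.map_zero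
  have h₃ := (h (1, 1)).1
  have h₄ := (h (1, l)).2
  simp only [e, one_mul, mul_one, sub_self, z, Prod.mk.injEq, and_true] at h₃ h₄
  have hab : w₁.1 = w₂.2 := by linarith
  have e' : ∀ v : ℚ × ℚ, B₀ v = w₁.1 • v := by
    intro v
    rw [e, ← hab]
    ext <;> simp [mul_comm]
  simp only [e', Prod.smul_fst, Prod.smul_snd, smul_eq_mul] at h
  by_cases h0 : w₁.1 = 0
  · right
    refine ⟨fun v => by rw [e', h0, zero_smul], fun v => ?_, fun v => ?_⟩
    · rw [pencil_apply, (h v).1, h0]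
      simp
    · rw [pencil_apply, (h v).2, h0]
      simp
  · left
    have hl : l = l' := by
      refine mul_right_cancel₀ h0 ?_
      rw [← hab] at h₄
      linarith
    refine ⟨hl, w₁.1, e', fun v => ?_, fun v => ?_⟩
    · rw [pencil_apply, (h v).1]
      ext <;> simp
      ring
    · rw [pencil_apply, (h v).2, ← hl]
      ext <;> simp
      ring

/-- Two vertices of valency three, joined by an edge. -/
theorem not_repFin_of_fork (hD : D.Finite) (hI : IsIdeal I) {x b₁ b₂ d t₁ t₂ : P.Obj}
    (hx : x ∈ D) (hb₁ : b₁ ∈ D) (hb₂ : b₂ ∈ D) (hd : d ∈ D) (ht₁ : t₁ ∈ D) (ht₂ : t₂ ∈ D)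
    (hdt₁ : d ≠ t₁) (hdt₂ : d ≠ t₂) (ht : t₁ ≠ t₂)
    {c : P.Hom x d} {r₁ : P.Hom x t₁} {r₂ : P.Hom x t₂} {q₁ : P.Hom b₁ d} {q₂ : P.Hom b₂ d}
    (nc : ¬ I _ _ c) (nr₁ : ¬ I _ _ r₁) (nr₂ : ¬ I _ _ r₂) (nq₁ : ¬ I _ _ q₁) (nq₂ : ¬ I _ _ q₂)
    (k₁ : RInc c q₁) (k₂ : RInc c q₂) (k₃ : RInc q₁ q₂)
    (l₁ : LInc c r₁) (l₂ : LInc c r₂) (l₃ : LInc r₁ r₂) : ¬ RepFin P D I := by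
  let E : Three → Three → Prop := fun t i =>
    match t, i with | .a, .a => True | .b, .a => True | .c, .a => True | .a, .b => True | .a, .c => True
                    | .b, .b => False | .b, .c => False | .c, .b => False | .c, .c => False
  let Z : Zigzag P D I :=
    { S := Three
      T := Three
      finite_T := inferInstance
      finite_D := hD
      ideal := hI
      c := fun i => match i with | .a => x | .b => b₁ | .c => b₂
      d := fun i => match i with | .a => d | .b => t₁ | .c => t₂
      d_inj := by
        intro i j h
        cases i <;> cases j <;> first
          | rfl
          | exact (hdt₁ h).elim | exact (hdt₁ h.symm).elim
          | exact (hdt₂ h).elim | exact (hdt₂ h.symm).elim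
          | exact (ht h).elim | exact (ht h.symm).elim
      c_mem := fun i => match i with | .a => hx | .b => hb₁ | .c => hb₂
      d_mem := fun i => match i with | .a => hd | .b => ht₁ | .c => ht₂
      p := fun t i => match t, i with
        | .a, .a => c | .b, .a => r₁ | .c, .a => r₂ | .a, .b => q₁ | .a, .c => q₂
        | .b, .b => P.zero _ _ | .b, .c => P.zero _ _ | .c, .b => P.zero _ _ | .c, .c => P.zero _ _
      E := E
      not_I := fun t i => match t, i with
        | .a, .a => fun _ => nc | .b, .a => fun _ => nr₁ | .c, .a => fun _ => nr₂
        | .a, .b => fun _ => nq₁ | .a, .c => fun _ => nq₂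
        | .b, .b => False.elim | .b, .c => False.elim | .c, .b => False.elim | .c, .c => False.elim
      right_inc := by
        intro t i j hi hj g hg
        cases t <;> cases i <;> cases j <;> first
          | rfl
          | exact False.elim hi | exact False.elim hj
          | exact (k₁.1 ⟨g, hg.symm⟩).elim | exact (k₁.2 ⟨g, hg.symm⟩).elim
          | exact (k₂.1 ⟨g, hg.symm⟩).elim | exact (k₂.2 ⟨g, hg.symm⟩).elim
          | exact (k₃.1 ⟨g, hg.symm⟩).elim | exact (k₃.2 ⟨g, hg.symm⟩).elim
      left_inc := by
        intro t t' i hi hj g hg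
        cases i <;> cases t <;> cases t' <;> first
          | rfl
          | exact False.elim hi | exact False.elim hj
          | exact (l₁.1 ⟨g, hg.symm⟩).elim | exact (l₁.2 ⟨g, hg.symm⟩).elim
          | exact (l₂.1 ⟨g, hg.symm⟩).elim | exact (l₂.2 ⟨g, hg.symm⟩).elim
          | exact (l₃.1 ⟨g, hg.symm⟩).elim | exact (l₃.2 ⟨g, hg.symm⟩).elim }
  let A : ℚ → Three → Three → ℚ × ℚ →ₗ[ℚ] ℚ × ℚ := fun l t i =>
    match t, i with
      | .a, .a => LinearMap.id | .b, .a => pencil 1 | .c, .a => pencil l | .a, .b => axisFst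
      | .a, .c => axisSnd | .b, .b => 0 | .b, .c => 0 | .c, .b => 0 | .c, .c => 0
  refine Z.not_repFin (U := ℚ × ℚ) A ?_ ?_ Three.a Three.a (1, 0) ?_
  · intro l t i hE
    cases t <;> cases i <;> first
      | exact (hE trivial).elim
      | rfl
  · intro l l' B hB
    have := pencil_rigid (l := l) (l' := l') (B₀ := B Three.a) (B₁ := B Three.b)
      (B₂ := B Three.c) ?_ ?_ ?_
    · refine this.imp ?_ ?_
      · rintro ⟨hl, r, h₀, h₁, h₂⟩
        have h₃ : ∀ t, B t 0 = r • (0 : ℚ × ℚ) := fun t => (map_zero _).trans (smul_zero _).symm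
        exact ⟨hl, r, fun t i v => match t, i with
          | .a, .a => h₀ v | .b, .a => h₁ v | .c, .a => h₂ v
          | .a, .b => h₀ (axisFst v) | .a, .c => h₀ (axisSnd v)
          | .b, .b => h₃ _ | .b, .c => h₃ _ | .c, .b => h₃ _ | .c, .c => h₃ _⟩
      · rintro ⟨h₀, h₁, h₂⟩
        have h₃ : ∀ t, B t 0 = 0 := fun t => map_zero _
        exact fun t i v => match t, i with
          | .a, .a => h₀ v | .b, .a => h₁ v | .c, .a => h₂ v
          | .a, .b => h₀ (axisFst v) | .a, .c => h₀ (axisSnd v)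
          | .b, .b => h₃ _ | .b, .c => h₃ _ | .c, .b => h₃ _ | .c, .c => h₃ _
    · obtain ⟨w, hw⟩ := hB Three.b (1, 0)
      have := hw Three.a
      simp only [A, axisFst_apply] at this
      exact ⟨w, this⟩
    · obtain ⟨w, hw⟩ := hB Three.c (0, 1)
      have := hw Three.a
      simp only [A, axisSnd_apply] at this
      exact ⟨w, this⟩
    · intro v
      obtain ⟨w, hw⟩ := hB Three.a v
      have e₀ := hw Three.a
      have e₁ := hw Three.b
      have e₂ := hw Three.c
      simp only [A, LinearMap.id_apply, pencil_apply] at e₀ e₁ e₂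
      rw [e₀]
      exact ⟨e₁, e₂⟩
  · intro l h
    have := congrArg Prod.fst h
    simp [A] at this

/-- Two vertices of valency three, joined by a path of length three. -/
theorem not_repFin_of_long_fork (hD : D.Finite) (hI : IsIdeal I)
    {x z b₁ b₂ d t₁ t₂ y : P.Obj}
    (hx : x ∈ D) (hz : z ∈ D) (hb₁ : b₁ ∈ D) (hb₂ : b₂ ∈ D) (hd : d ∈ D) (ht₁ : t₁ ∈ D)
    (ht₂ : t₂ ∈ D) (hy : y ∈ D)
    (hdt₁ : d ≠ t₁) (hdt₂ : d ≠ t₂) (ht : t₁ ≠ t₂) (hdy : d ≠ y) (hty₁ : t₁ ≠ y) (hty₂ : t₂ ≠ y)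
    {c : P.Hom x d} {r₁ : P.Hom x t₁} {r₂ : P.Hom x t₂} {h : P.Hom z d} {m : P.Hom z y}
    {q₁ : P.Hom b₁ y} {q₂ : P.Hom b₂ y}
    (nc : ¬ I _ _ c) (nr₁ : ¬ I _ _ r₁) (nr₂ : ¬ I _ _ r₂) (nh : ¬ I _ _ h) (nm : ¬ I _ _ m)
    (nq₁ : ¬ I _ _ q₁) (nq₂ : ¬ I _ _ q₂)
    (k₀ : RInc c h) (k₁ : RInc m q₁) (k₂ : RInc m q₂) (k₃ : RInc q₁ q₂)
    (l₁ : LInc c r₁) (l₂ : LInc c r₂) (l₃ : LInc r₁ r₂) (l₀ : LInc h m) : ¬ RepFin P D I := by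
  let E : Four → Four → Prop := fun t i =>
    match t, i with
      | .a, .a => True | .b, .a => True | .c, .a => True | .a, .b => True | .d, .b => True
      | .d, .c => True | .d, .d => True
      | .d, .a => False | .b, .b => False | .c, .b => False | .a, .c => False | .b, .c => False
      | .c, .c => False | .a, .d => False | .b, .d => False | .c, .d => False
  let Z : Zigzag P D I :=
    { S := Four
      T := Four
      finite_T := inferInstance
      finite_D := hD
      ideal := hI
      c := fun i => match i with | .a => x | .b => z | .c => b₁ | .d => b₂
      d := fun i => match i with | .a => d | .b => t₁ | .c => t₂ | .d => y
      d_inj := by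
        intro i j h
        cases i <;> cases j <;> first
          | rfl
          | exact (hdt₁ h).elim | exact (hdt₁ h.symm).elim
          | exact (hdt₂ h).elim | exact (hdt₂ h.symm).elim
          | exact (ht h).elim | exact (ht h.symm).elim
          | exact (hdy h).elim | exact (hdy h.symm).elim
          | exact (hty₁ h).elim | exact (hty₁ h.symm).elim
          | exact (hty₂ h).elim | exact (hty₂ h.symm).elim
      c_mem := fun i => match i with | .a => hx | .b => hz | .c => hb₁ | .d => hb₂
      d_mem := fun i => match i with | .a => hd | .b => ht₁ | .c => ht₂ | .d => hy
      p := fun t i => match t, i with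
        | .a, .a => c | .b, .a => r₁ | .c, .a => r₂ | .a, .b => h | .d, .b => m | .d, .c => q₁ | .d, .d => q₂
        | .d, .a => P.zero _ _ | .b, .b => P.zero _ _ | .c, .b => P.zero _ _ | .a, .c => P.zero _ _
        | .b, .c => P.zero _ _ | .c, .c => P.zero _ _ | .a, .d => P.zero _ _ | .b, .d => P.zero _ _
        | .c, .d => P.zero _ _
      E := E
      not_I := fun t i => match t, i with
        | .a, .a => fun _ => nc | .b, .a => fun _ => nr₁ | .c, .a => fun _ => nr₂
        | .a, .b => fun _ => nh | .d, .b => fun _ => nm | .d, .c => fun _ => nq₁ | .d, .d => fun _ => nq₂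
        | .d, .a => False.elim | .b, .b => False.elim | .c, .b => False.elim | .a, .c => False.elim
        | .b, .c => False.elim | .c, .c => False.elim | .a, .d => False.elim | .b, .d => False.elim
        | .c, .d => False.elim
      right_inc := by
        intro t i j hi hj g hg
        cases t <;> cases i <;> cases j <;> first
          | rfl
          | exact False.elim hi | exact False.elim hj
          | exact (k₀.1 ⟨g, hg.symm⟩).elim | exact (k₀.2 ⟨g, hg.symm⟩).elim
          | exact (k₁.1 ⟨g, hg.symm⟩).elim | exact (k₁.2 ⟨g, hg.symm⟩).elim
          | exact (k₂.1 ⟨g, hg.symm⟩).elim | exact (k₂.2 ⟨g, hg.symm⟩).elim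
          | exact (k₃.1 ⟨g, hg.symm⟩).elim | exact (k₃.2 ⟨g, hg.symm⟩).elim
      left_inc := by
        intro t t' i hi hj g hg
        cases i <;> cases t <;> cases t' <;> first
          | rfl
          | exact False.elim hi | exact False.elim hj
          | exact (l₀.1 ⟨g, hg.symm⟩).elim | exact (l₀.2 ⟨g, hg.symm⟩).elim
          | exact (l₁.1 ⟨g, hg.symm⟩).elim | exact (l₁.2 ⟨g, hg.symm⟩).elim
          | exact (l₂.1 ⟨g, hg.symm⟩).elim | exact (l₂.2 ⟨g, hg.symm⟩).elim
          | exact (l₃.1 ⟨g, hg.symm⟩).elim | exact (l₃.2 ⟨g, hg.symm⟩).elim }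
  let A : ℚ → Four → Four → ℚ × ℚ →ₗ[ℚ] ℚ × ℚ := fun l t i =>
    match t, i with
      | .a, .a => LinearMap.id | .b, .a => pencil 1 | .c, .a => pencil l | .a, .b => LinearMap.id
      | .d, .b => LinearMap.id | .d, .c => axisFst | .d, .d => axisSnd
      | .d, .a => 0 | .b, .b => 0 | .c, .b => 0 | .a, .c => 0
      | .b, .c => 0 | .c, .c => 0 | .a, .d => 0 | .b, .d => 0 | .c, .d => 0
  refine Z.not_repFin (U := ℚ × ℚ) A ?_ ?_ Four.a Four.a (1, 0) ?_
  · intro l t i hE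
    cases t <;> cases i <;> first
      | exact (hE trivial).elim
      | rfl
  · intro l l' B hB
    have hY : ∀ v, B Four.d v = B Four.a v := by
      intro v
      obtain ⟨w, hw⟩ := hB Four.b v
      have e₀ := hw Four.a
      have e₁ := hw Four.d
      simp only [A, LinearMap.id_apply] at e₀ e₁
      rw [e₀, e₁]
    have := pencil_rigid (l := l) (l' := l') (B₀ := B Four.a) (B₁ := B Four.b)
      (B₂ := B Four.c) ?_ ?_ ?_
    · refine this.imp ?_ ?_
      · rintro ⟨hl, r, h₀, h₁, h₂⟩
        have h₃ : ∀ t, B t 0 = r • (0 : ℚ × ℚ) := fun t => (map_zero _).trans (smul_zero _).symm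
        have h₄ : ∀ v, B Four.d v = r • v := fun v => (hY v).trans (h₀ v)
        exact ⟨hl, r, fun t i v => match t, i with
          | .a, .a => h₀ v | .b, .a => h₁ v | .c, .a => h₂ v | .a, .b => h₀ v | .d, .b => h₄ v
          | .d, .c => h₄ (axisFst v) | .d, .d => h₄ (axisSnd v)
          | .d, .a => h₃ _ | .b, .b => h₃ _ | .c, .b => h₃ _ | .a, .c => h₃ _ | .b, .c => h₃ _
          | .c, .c => h₃ _ | .a, .d => h₃ _ | .b, .d => h₃ _ | .c, .d => h₃ _⟩
      · rintro ⟨h₀, h₁, h₂⟩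
        have h₃ : ∀ t, B t 0 = 0 := fun t => map_zero _
        have h₄ : ∀ v, B Four.d v = 0 := fun v => (hY v).trans (h₀ v)
        exact fun t i v => match t, i with
          | .a, .a => h₀ v | .b, .a => h₁ v | .c, .a => h₂ v | .a, .b => h₀ v | .d, .b => h₄ v
          | .d, .c => h₄ (axisFst v) | .d, .d => h₄ (axisSnd v)
          | .d, .a => h₃ _ | .b, .b => h₃ _ | .c, .b => h₃ _ | .a, .c => h₃ _ | .b, .c => h₃ _
          | .c, .c => h₃ _ | .a, .d => h₃ _ | .b, .d => h₃ _ | .c, .d => h₃ _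
    · obtain ⟨w, hw⟩ := hB Four.c (1, 0)
      have := hw Four.d
      simp only [A, axisFst_apply, hY] at this
      exact ⟨w, this⟩
    · obtain ⟨w, hw⟩ := hB Four.d (0, 1)
      have := hw Four.d
      simp only [A, axisSnd_apply, hY] at this
      exact ⟨w, this⟩
    · intro v
      obtain ⟨w, hw⟩ := hB Four.a v
      have e₀ := hw Four.a
      have e₁ := hw Four.b
      have e₂ := hw Four.c
      simp only [A, LinearMap.id_apply, pencil_apply] at e₀ e₁ e₂
      rw [e₀]
      exact ⟨e₁, e₂⟩
  · intro l h
    have := congrArg Prod.fst h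
    simp [A] at this

end Shapes

end RayCategory

namespace RayCategory

section Setting

variable {P : RayCategory}

/-- Two incomparable factorizations of `π(z)` generate a four-cycle. -/
theorem pi_factorization_false {D : Set P.Obj} {I : ∀ a b : P.Obj, P.Hom a b → Prop}
    (hD : D.Finite) (hI : IsIdeal I) (hR : RepFin P D I) {z b₁ b₂ : P.Obj} (hb₁ : b₁ ∈ D)
    (hb₂ : b₂ ∈ D) (hz : P.pi z ≠ P.zero z z) {f₁ : P.Hom b₁ z} {k₁ : P.Hom z b₁}
    {f₂ : P.Hom b₂ z} {k₂ : P.Hom z b₂} (h₁ : P.pi z = f₁ ⬝ k₁) (h₂ : P.pi z = f₂ ⬝ k₂)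
    (hf : RInc f₁ f₂) (n₁₁ : ¬ I _ _ (k₁ ⬝ f₁)) (n₁₂ : ¬ I _ _ (k₁ ⬝ f₂))
    (n₂₁ : ¬ I _ _ (k₂ ⬝ f₁)) (n₂₂ : ¬ I _ _ (k₂ ⬝ f₂)) : False := by
  have e : ∀ {w : P.Obj} (k : P.Hom w z), k = P.id z ⬝ k := fun k => (P.id_comp k).symm
  have hne : b₁ ≠ b₂ := by
    rintro rfl
    rcases cyc f₁ f₂ with ⟨a, ha⟩ | ⟨a, ha⟩ | ha | ha
    · rcases endo_cases a with rfl | ⟨a, rfl⟩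
      · exact hf.1 ⟨P.id _, by rw [P.comp_id, ha, P.id_comp]⟩
      · exact hf.1 ⟨k₁ ⬝ a ⬝ f₁, by grind [_=_ RayCategory.assoc]⟩
    · rcases endo_cases a with rfl | ⟨a, rfl⟩
      · exact hf.2 ⟨P.id _, by rw [P.comp_id, ha, P.id_comp]⟩
      · exact hf.2 ⟨k₂ ⬝ a ⬝ f₂, by grind [_=_ RayCategory.assoc]⟩
    · exact hf.1 ha
    · exact hf.2 ha
  have z₁₁ := hI.ne_zero n₁₁
  have z₁₂ := hI.ne_zero n₁₂
  have z₂₁ := hI.ne_zero n₂₁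
  have z₂₂ := hI.ne_zero n₂₂
  have hk : LInc k₁ k₂ := by
    refine ⟨?_, ?_⟩
    · rintro ⟨h, rfl⟩
      exact hf.2 ⟨h, cancel_right (k := k₁) (by rw [P.assoc, ← h₁, ← h₂]) (by rwa [← h₁])⟩
    · rintro ⟨h, rfl⟩
      exact hf.1 ⟨h, cancel_right (k := k₂) (by rw [P.assoc, ← h₁, ← h₂]) (by rwa [← h₂])⟩
  have r : ∀ {b : P.Obj} (k : P.Hom z b), k ⬝ f₁ ≠ P.zero _ _ → k ⬝ f₂ ≠ P.zero _ _ →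
      RInc (k ⬝ f₁) (k ⬝ f₂) := by
    intro b k hk₁ hk₂
    refine ⟨?_, ?_⟩
    · rintro ⟨h, hh⟩
      exact hf.1 ⟨h, cancel_left (l := k) (by rw [hh, P.assoc]) hk₂⟩
    · rintro ⟨h, hh⟩
      exact hf.2 ⟨h, cancel_left (l := k) (by rw [hh, P.assoc]) hk₁⟩
  have l : ∀ {b : P.Obj} (f : P.Hom b z), k₁ ⬝ f ≠ P.zero _ _ → k₂ ⬝ f ≠ P.zero _ _ →
      LInc (k₁ ⬝ f) (k₂ ⬝ f) := by
    intro b f hk₁ hk₂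
    refine ⟨?_, ?_⟩
    · rintro ⟨h, hh⟩
      exact hk.1 ⟨h, cancel_right (k := f) (by rw [hh, P.assoc]) hk₂⟩
    · rintro ⟨h, hh⟩
      exact hk.2 ⟨h, cancel_right (k := f) (by rw [hh, P.assoc]) hk₁⟩
  exact not_repFin_of_cycle_four hD hI hb₁ hb₂ hb₁ hb₂ hne n₁₁ n₁₂ n₂₁ n₂₂ (r k₁ z₁₁ z₁₂)
    (r k₂ z₂₁ z₂₂) (l f₁ z₁₁ z₂₁) (l f₂ z₁₂ z₂₂) hR

/-- Two morphisms between the same objects, neither of which is divisible by `π(y)`, are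
comparable. -/
theorem not_rInc_of_not_pi_dvd {a y : P.Obj} {f f' : P.Hom a y} (h : ¬ ∃ k, f = P.pi y ⬝ k)
    (h' : ¬ ∃ k, f' = P.pi y ⬝ k) : ¬ RInc f f' := by
  rintro ⟨h₁, h₂⟩
  rcases cyc f f' with ⟨e, rfl⟩ | ⟨e, rfl⟩ | he | he
  · rcases endo_cases e with rfl | ⟨e, rfl⟩
    · exact h₁ ⟨P.id _, by rw [P.comp_id, P.id_comp]⟩
    · exact h' ⟨e ⬝ f, P.assoc _ _ _⟩
  · rcases endo_cases e with rfl | ⟨e, rfl⟩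
    · exact h₂ ⟨P.id _, by rw [P.comp_id, P.id_comp]⟩
    · exact h ⟨e ⬝ f', P.assoc _ _ _⟩
  · exact h₁ he
  · exact h₂ he

/-- A nonzero morphism `μ` with `π(y)μ ≠ 0` which is transit, such that the quotient of `P` by
`π(y)μ` is representation-finite on all the subcategories `{x, y, a, b}` with `a`, `b` in the
support of the injective at `y`. -/
structure Setting {x y : P.Obj} (μ : P.Hom x y) (I : ∀ a b : P.Obj, P.Hom a b → Prop) :
    Prop where
  ideal : IsIdeal I
  mem_iff : ∀ {a b : P.Obj} (f : P.Hom a b), I a b f ↔ ∃ g h, f = g ⬝ (P.pi y ⬝ μ) ⬝ h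
  pi_ne : P.pi y ⬝ μ ≠ P.zero x y
  transit : ∃ e, μ ⬝ P.pi x = e ⬝ μ
  repFin : ∀ {a b : P.Obj} {f : P.Hom a y} {g : P.Hom b y}, ¬ I _ _ f → ¬ I _ _ g →
    RepFin P {x, y, a, b} I

/-- A factorization of `μ` into two morphisms different from identities. -/
structure Fac {x y : P.Obj} (μ : P.Hom x y) {a : P.Obj} (f : P.Hom a y) (g : P.Hom x a) :
    Prop where
  comp : f ⬝ g = μ
  left : ¬ P.IsId f
  right : ¬ P.IsId g

namespace Setting

variable {x y : P.Obj} {μ : P.Hom x y} {I : ∀ a b : P.Obj, P.Hom a b → Prop}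

theorem finite (a b c d : P.Obj) : ({a, b, c, d} : Set P.Obj).Finite := Set.toFinite _

theorem ne_zero (S : Setting μ I) : μ ≠ P.zero x y := ne_zero_right S.pi_ne

theorem not_mem (S : Setting μ I) : ¬ I _ _ μ := by
  rw [S.mem_iff]
  rintro ⟨g, h, e⟩
  have : μ = (g ⬝ P.pi y) ⬝ μ ⬝ h := by grind [_=_ RayCategory.assoc]
  have := (absorb S.ne_zero this).1
  exact not_isId_pi y (isId_of_comp_eq_id this).2

theorem not_mem_left (S : Setting μ I) {a : P.Obj} {f : P.Hom a y} {g : P.Hom x a}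
    (h : f ⬝ g = μ) : ¬ I _ _ f := fun hf => S.not_mem (h ▸ S.ideal.right f g hf)

theorem not_mem_right (S : Setting μ I) {a : P.Obj} {f : P.Hom a y} {g : P.Hom x a}
    (h : f ⬝ g = μ) : ¬ I _ _ g := fun hg => S.not_mem (h ▸ S.ideal.left f g hg)

theorem not_mem_pi_left (S : Setting μ I) {a : P.Obj} {f : P.Hom a y} {g : P.Hom x a}
    (h : f ⬝ g = μ) (hg : ¬ P.IsId g) : ¬ I _ _ (P.pi y ⬝ f) := by
  rw [S.mem_iff]
  rintro ⟨c, d, e⟩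
  have h0 : P.pi y ⬝ f ≠ P.zero _ _ := by
    intro h0
    apply S.pi_ne
    rw [← h, ← P.assoc, h0, P.zero_comp]
  have e' : P.pi y ⬝ f = P.pi y ⬝ c ⬝ f ⬝ g ⬝ d := by
    rw [e, ← h]
    have := endo_comm (P.pi y) c
    grind [_=_ RayCategory.assoc]
  have e'' := cancel_left e' h0
  have := (absorb (ne_zero_right h0) e'').2
  exact hg (isId_of_comp_eq_id this).1

theorem not_mem_pi (S : Setting μ I) (hμ : ¬ P.IsId μ) : ¬ I _ _ (P.pi y) := by
  rw [S.mem_iff]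
  rintro ⟨c, d, e⟩
  have h0 := ne_zero_left S.pi_ne
  have e' : P.pi y = P.pi y ⬝ c ⬝ μ ⬝ d := by
    have := endo_comm (P.pi y) c
    grind [_=_ RayCategory.assoc]
  have := absorb_right h0 e'
  exact hμ (isId_of_comp_isId (isId_of_comp_isId ((isId_iff _).2 this)).2).1

end Setting

end Setting

end RayCategory

namespace RayCategory

section Comparability

variable {P : RayCategory}

theorem RInc.comp_left {a b y z : P.Obj} {f : P.Hom a y} {f' : P.Hom b y} (h : RInc f f')
    {e : P.Hom y z} (h₁ : e ⬝ f ≠ P.zero _ _) (h₂ : e ⬝ f' ≠ P.zero _ _) :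
    RInc (e ⬝ f) (e ⬝ f') := by
  refine ⟨?_, ?_⟩
  · rintro ⟨k, hk⟩
    exact h.1 ⟨k, cancel_left (l := e) (by rw [hk, P.assoc]) h₂⟩
  · rintro ⟨k, hk⟩
    exact h.2 ⟨k, cancel_left (l := e) (by rw [hk, P.assoc]) h₁⟩

theorem RInc.of_comp_left {a b y z : P.Obj} {f : P.Hom a y} {f' : P.Hom b y} {e : P.Hom y z}
    (h : RInc (e ⬝ f) (e ⬝ f')) : RInc f f' := by
  refine ⟨?_, ?_⟩
  · rintro ⟨k, rfl⟩
    exact h.1 ⟨k, (P.assoc _ _ _).symm⟩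
  · rintro ⟨k, rfl⟩
    exact h.2 ⟨k, (P.assoc _ _ _).symm⟩

theorem RInc.lInc {x y a b : P.Obj} {f : P.Hom a y} {f' : P.Hom b y} (h : RInc f f')
    {g : P.Hom x a} {g' : P.Hom x b} (e : f ⬝ g = f' ⬝ g') (h0 : f ⬝ g ≠ P.zero _ _) :
    LInc g g' := by
  refine ⟨?_, ?_⟩
  · rintro ⟨k, rfl⟩
    exact h.2 ⟨k, cancel_right (k := g) (by rw [e, P.assoc]) h0⟩
  · rintro ⟨k, rfl⟩
    exact h.1 ⟨k, cancel_right (k := g') (by rw [← e, P.assoc]) (e ▸ h0)⟩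

/-- `f` and `π(y)f` are incomparable as soon as `f` does not divide `π(y)f`. -/
theorem rInc_pi_comp {a y : P.Obj} {f : P.Hom a y} (hf : f ≠ P.zero a y)
    (h : ¬ ∃ θ, P.pi y ⬝ f = f ⬝ θ) : RInc f (P.pi y ⬝ f) := by
  refine ⟨h, ?_⟩
  rintro ⟨k, hk⟩
  exact pi_ne_id y (absorb hf (a := P.pi y) (b := k) (by rw [← P.assoc, ← hk])).1

/-- Removing the maximal common power of `π(y)`. -/
theorem exists_pi_power {a b y : P.Obj} (f₁ : P.Hom a y) (f₂ : P.Hom b y)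
    (h : f₁ ≠ P.zero _ _) : ∃ (i : ℕ) (f₁' : P.Hom a y) (f₂' : P.Hom b y),
      f₁ = P.pipow y i ⬝ f₁' ∧ f₂ = P.pipow y i ⬝ f₂' ∧
      ¬ ((∃ k, f₁' = P.pi y ⬝ k) ∧ ∃ k, f₂' = P.pi y ⬝ k) := by
  classical
  have ex : ∃ n, ∀ i f₁' f₂', f₁ = P.pipow y i ⬝ f₁' → f₂ = P.pipow y i ⬝ f₂' → i ≤ n := by
    refine ⟨P.nilp y, fun i f₁' f₂' h₁ _ => ?_⟩
    by_contra hi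
    rw [pipow_eq_zero (by omega), P.zero_comp] at h₁
    exact h h₁
  let Q : ℕ → Prop := fun i => ∃ f₁' f₂', f₁ = P.pipow y i ⬝ f₁' ∧ f₂ = P.pipow y i ⬝ f₂'
  have h0 : Q 0 := ⟨f₁, f₂, by simp only [P.pipow_zero, P.id_comp, and_self]⟩
  obtain ⟨n, hn⟩ := ex
  have hQ := Nat.findGreatest_spec (P := Q) (Nat.zero_le n) h0
  obtain ⟨f₁', f₂', h₁, h₂⟩ := hQ
  refine ⟨_, f₁', f₂', h₁, h₂, ?_⟩
  rintro ⟨⟨k₁, e₁⟩, k₂, e₂⟩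
  set i := Nat.findGreatest Q n
  have hi : Q (i + 1) := ⟨k₁, k₂, by
    rw [P.pipow_succ, ← endo_comm, P.assoc]
    exact e₁ ▸ h₁, by
    rw [P.pipow_succ, ← endo_comm, P.assoc]
    exact e₂ ▸ h₂⟩
  obtain ⟨u, v, hu, hv⟩ := hi
  have := Nat.le_findGreatest (P := Q) (hn _ u v hu hv) ⟨u, v, hu, hv⟩
  omega

theorem RInc.pi_cases {a b y : P.Obj} {f₁ : P.Hom a y} {f₂ : P.Hom b y} (h : RInc f₁ f₂)
    (h' : ¬ ((∃ k, f₁ = P.pi y ⬝ k) ∧ ∃ k, f₂ = P.pi y ⬝ k)) :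
    ((∃ q, P.pi y = f₁ ⬝ q) ∧ ∃ q, P.pi y = f₂ ⬝ q) ∨ RInc f₁ (P.pi y) ∨ RInc f₂ (P.pi y) := by
  unfold RInc at *
  grind [_=_ RayCategory.assoc]

theorem isId_cases {a : P.Obj} (f : P.Hom a a) : P.IsId f ∨ ∃ k, f = P.pi a ⬝ k := by
  rw [isId_iff]
  exact endo_cases f

/-- In the presence of `f g = f' g'`, incomparable `f`, `f'` not divisible by `π(y)` have
distinct sources. -/
theorem RInc.source_ne {a b y : P.Obj} {f : P.Hom a y} {f' : P.Hom b y} (h : RInc f f')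
    (h₁ : ¬ ∃ k, f = P.pi y ⬝ k) (h₂ : ¬ ∃ k, f' = P.pi y ⬝ k) : a ≠ b := by
  rintro rfl
  exact not_rInc_of_not_pi_dvd h₁ h₂ h

theorem RInc.not_isId_left {a b y : P.Obj} {f : P.Hom a y} {f' : P.Hom b y} (h : RInc f f') :
    ¬ P.IsId f := by
  rintro ⟨rfl, he⟩
  obtain rfl := eq_of_heq he
  exact h.1 ⟨f', (P.id_comp f').symm⟩

theorem RInc.source_ne_target {a b y : P.Obj} {f : P.Hom a y} {f' : P.Hom b y} (h : RInc f f')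
    (h₁ : ¬ ∃ k, f = P.pi y ⬝ k) : a ≠ y := by
  rintro rfl
  exact (isId_cases f).elim h.not_isId_left h₁

end Comparability

namespace Setting

variable {P : RayCategory} {x y : P.Obj} {μ : P.Hom x y} {I : ∀ a b : P.Obj, P.Hom a b → Prop}

/-- Two loops without a factorization of `π(y)` through the first of them excluded. -/
theorem loop_loop_of_dvd (S : Setting μ I) {τ : P.Hom x y} (hτ : ¬ ∃ k, τ = P.pi y ⬝ k)
    (hτ' : ∀ e, P.pi y ⬝ τ ≠ τ ⬝ e) (nτ : ¬ I _ _ τ) {a₁ a₂ : P.Obj} {f₁ : P.Hom a₁ y}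
    {g₁ : P.Hom x a₁} {f₂ : P.Hom a₂ y} {g₂ : P.Hom x a₂} (h₁ : f₁ ⬝ g₁ = τ) (h₂ : f₂ ⬝ g₂ = τ)
    (hf : RInc f₁ f₂) {θ₂ : P.Hom a₂ a₂} (l₂ : P.pi y ⬝ f₂ = f₂ ⬝ θ₂)
    (n₂ : ¬ I _ _ (P.pi y ⬝ f₂)) {q : P.Hom y a₁}
    (hq : P.pi y = f₁ ⬝ q) : False := by
  have d₁ : ¬ ∃ k, f₁ = P.pi y ⬝ k := by grind [_=_ RayCategory.assoc]
  have d₂ : ¬ ∃ k, f₂ = P.pi y ⬝ k := by grind [_=_ RayCategory.assoc]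
  have m₁ : ¬ I _ _ f₁ := fun h => nτ (h₁ ▸ S.ideal.right _ _ h)
  have m₂ : ¬ I _ _ f₂ := fun h => nτ (h₂ ▸ S.ideal.right _ _ h)
  have z₂ := S.ideal.ne_zero n₂
  have zτ := S.ideal.ne_zero nτ
  refine not_repFin_of_cycle_four (finite x y a₁ a₂) S.ideal (c₁ := x) (c₂ := a₂) (d₁ := a₁)
    (d₂ := a₂) (by simp) (by simp) (by simp) (by simp) (hf.source_ne d₁ d₂)
    (p₁₁ := g₁) (p₁₂ := q ⬝ f₂) (p₂₁ := g₂) (p₂₂ := θ₂)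
    (fun h => nτ (h₁ ▸ S.ideal.left _ _ h)) (fun h => n₂ ?_)
    (fun h => nτ (h₂ ▸ S.ideal.left _ _ h)) (fun h => n₂ (l₂ ▸ S.ideal.left _ _ h))
    ⟨?_, ?_⟩ ⟨?_, ?_⟩ (hf.lInc (h₁.trans h₂.symm) (h₁ ▸ zτ)) ⟨?_, ?_⟩ (S.repFin m₁ m₂)
  · rw [hq, P.assoc]
    exact S.ideal.left _ _ h
  · rintro ⟨h, hh⟩
    exact hτ' (h ⬝ g₂) (by grind [_=_ RayCategory.assoc])
  · rintro ⟨h, hh⟩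
    exact hτ ⟨f₂ ⬝ h, by grind [_=_ RayCategory.assoc]⟩
  · rintro ⟨h, hh⟩
    exact hτ' (h ⬝ g₂) (by grind [_=_ RayCategory.assoc])
  · rintro ⟨h, hh⟩
    exact hτ ⟨f₂ ⬝ h, by grind [_=_ RayCategory.assoc]⟩
  · rintro ⟨h, hh⟩
    have e : P.pi y = f₂ ⬝ h ⬝ q := cancel_right (k := f₂) (by grind [_=_ RayCategory.assoc]) z₂
    exact hf.2 ⟨h, cancel_right (k := q) (by grind [_=_ RayCategory.assoc])
      (hq ▸ ne_zero_left z₂)⟩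
  · rintro ⟨h, hh⟩
    exact hf.1 ⟨h, cancel_right (k := θ₂) (by grind [_=_ RayCategory.assoc]) (l₂ ▸ z₂)⟩

/-- Two incomparable loops through which a morphism not divisible by `π(y)` factors. -/
theorem loop_loop (S : Setting μ I) {τ : P.Hom x y} (hτ : ¬ ∃ k, τ = P.pi y ⬝ k)
    (hτ' : ∀ e, P.pi y ⬝ τ ≠ τ ⬝ e) (nτ : ¬ I _ _ τ) {a₁ a₂ : P.Obj} {f₁ : P.Hom a₁ y}
    {g₁ : P.Hom x a₁} {f₂ : P.Hom a₂ y} {g₂ : P.Hom x a₂} (h₁ : f₁ ⬝ g₁ = τ) (h₂ : f₂ ⬝ g₂ = τ)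
    (hf : RInc f₁ f₂) {θ₁ : P.Hom a₁ a₁} (l₁ : P.pi y ⬝ f₁ = f₁ ⬝ θ₁) {θ₂ : P.Hom a₂ a₂}
    (l₂ : P.pi y ⬝ f₂ = f₂ ⬝ θ₂) (n₁ : ¬ I _ _ (P.pi y ⬝ f₁)) (n₂ : ¬ I _ _ (P.pi y ⬝ f₂)) :
    False := by
  have q₁ : ∀ q, P.pi y ≠ f₁ ⬝ q := fun q hq =>
    S.loop_loop_of_dvd hτ hτ' nτ h₁ h₂ hf l₂ n₂ hq
  have q₂ : ∀ q, P.pi y ≠ f₂ ⬝ q := fun q hq =>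
    S.loop_loop_of_dvd hτ hτ' nτ h₂ h₁ hf.symm l₁ n₁ hq
  have d₁ : ¬ ∃ k, f₁ = P.pi y ⬝ k := by grind [_=_ RayCategory.assoc]
  have d₂ : ¬ ∃ k, f₂ = P.pi y ⬝ k := by grind [_=_ RayCategory.assoc]
  have m₁ : ¬ I _ _ f₁ := fun h => nτ (h₁ ▸ S.ideal.right _ _ h)
  have m₂ : ¬ I _ _ f₂ := fun h => nτ (h₂ ▸ S.ideal.right _ _ h)
  have z₁ := S.ideal.ne_zero n₁
  have z₂ := S.ideal.ne_zero n₂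
  have zτ := S.ideal.ne_zero nτ
  refine not_repFin_of_cycle_six (finite x y a₁ a₂) S.ideal (c₁ := x) (c₂ := a₂) (c₃ := a₁)
    (d₁ := a₁) (d₂ := a₂) (d₃ := y) (by simp) (by simp) (by simp) (by simp) (by simp) (by simp)
    (hf.source_ne d₁ d₂) (hf.source_ne_target d₁) (hf.symm.source_ne_target d₂)
    (p₁₁ := g₁) (p₂₁ := g₂) (p₂₂ := θ₂) (p₃₂ := f₂) (p₃₃ := f₁) (p₁₃ := θ₁)
    (fun h => nτ (h₁ ▸ S.ideal.left _ _ h)) (fun h => nτ (h₂ ▸ S.ideal.left _ _ h))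
    (fun h => n₂ (l₂ ▸ S.ideal.left _ _ h)) m₂ m₁ (fun h => n₁ (l₁ ▸ S.ideal.left _ _ h))
    ⟨?_, ?_⟩ ⟨?_, ?_⟩ hf.symm (hf.lInc (h₁.trans h₂.symm) (h₁ ▸ zτ)) ⟨?_, ?_⟩ ⟨?_, ?_⟩
    (S.repFin m₁ m₂)
  · rintro ⟨h, hh⟩
    exact hτ' (h ⬝ g₁) (by grind [_=_ RayCategory.assoc])
  · rintro ⟨h, hh⟩
    exact hτ ⟨f₁ ⬝ h, by grind [_=_ RayCategory.assoc]⟩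
  · rintro ⟨h, hh⟩
    exact hτ' (h ⬝ g₂) (by grind [_=_ RayCategory.assoc])
  · rintro ⟨h, hh⟩
    exact hτ ⟨f₂ ⬝ h, by grind [_=_ RayCategory.assoc]⟩
  · rintro ⟨h, hh⟩
    exact d₂ ⟨h, (cancel_right (k := θ₂) (by grind [_=_ RayCategory.assoc]) (l₂ ▸ z₂))⟩
  · rintro ⟨h, hh⟩
    exact q₂ h (cancel_right (k := f₂) (by grind [_=_ RayCategory.assoc]) z₂)
  · rintro ⟨h, hh⟩
    exact q₁ h (cancel_right (k := f₁) (by grind [_=_ RayCategory.assoc]) z₁)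
  · rintro ⟨h, hh⟩
    exact d₁ ⟨h, (cancel_right (k := θ₁) (by grind [_=_ RayCategory.assoc]) (l₁ ▸ z₁))⟩

end Setting

end RayCategory

namespace RayCategory

variable {P : RayCategory} {x y : P.Obj} {μ : P.Hom x y} {I : ∀ a b : P.Obj, P.Hom a b → Prop}

/-- If `μπ(x)` is a multiple of `μ` on the left and `π(y)μ ≠ 0` a multiple of `μ` on the right,
then the two are equal. -/
theorem pi_comp_eq_of_transit (pi_ne : P.pi y ⬝ μ ≠ P.zero x y)
    (transit : ∃ t, μ ⬝ P.pi x = t ⬝ μ) {e : P.Hom x x} (he : P.pi y ⬝ μ = μ ⬝ e) :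
    P.pi y ⬝ μ = μ ⬝ P.pi x := by
  have zμ := ne_zero_right pi_ne
  obtain ⟨t, ht⟩ := transit
  rcases endo_cases e with rfl | ⟨e, rfl⟩
  · rw [P.comp_id] at he
    exact absurd (absorb_left zμ he.symm) (pi_ne_id y)
  · rcases endo_cases t with rfl | ⟨t, rfl⟩
    · rw [P.id_comp] at ht
      exact absurd (absorb_right zμ ht.symm) (pi_ne_id x)
    · have h₁ : P.pi y ⬝ μ = t ⬝ (P.pi y ⬝ μ) ⬝ e := by
        have := endo_comm t (P.pi y)
        grind [_=_ RayCategory.assoc]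
      obtain ⟨rfl, rfl⟩ := absorb pi_ne h₁
      rw [ht, P.comp_id]

/-- A two-colouring of the left factors of `μ` which is constant along divisibility. -/
structure Coloring (μ : P.Hom x y) (col : ∀ a : P.Obj, P.Hom a y → Prop) : Prop where
  inv : ∀ {a b : P.Obj} {f : P.Hom a y} {g : P.Hom x a} {f' : P.Hom b y} {g' : P.Hom x b}
    (h : P.Hom a b), Fac μ f g → Fac μ f' g' → f = f' ⬝ h → (col a f ↔ col b f')

variable {col : ∀ a : P.Obj, P.Hom a y → Prop}

theorem Coloring.rInc (K : Coloring μ col) {a b : P.Obj} {f : P.Hom a y} {g : P.Hom x a}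
    {f' : P.Hom b y} {g' : P.Hom x b} (F : Fac μ f g) (F' : Fac μ f' g')
    (hc : ¬ (col a f ↔ col b f')) : RInc f f' := by
  refine ⟨?_, ?_⟩
  · rintro ⟨h, hh⟩
    exact hc (K.inv h F' F hh).symm
  · rintro ⟨h, hh⟩
    exact hc (K.inv h F F' hh)

namespace Fac

theorem not_mem (S : Setting μ I) {a : P.Obj} {f : P.Hom a y} {g : P.Hom x a} (F : Fac μ f g) :
    ¬ I _ _ f := S.not_mem_left F.comp

theorem not_mem_pi (S : Setting μ I) {a : P.Obj} {f : P.Hom a y} {g : P.Hom x a}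
    (F : Fac μ f g) : ¬ I _ _ (P.pi y ⬝ f) := S.not_mem_pi_left F.comp F.right

theorem not_mem_right (S : Setting μ I) {a : P.Obj} {f : P.Hom a y} {g : P.Hom x a}
    (F : Fac μ f g) : ¬ I _ _ g := S.not_mem_right F.comp

end Fac

namespace Setting

theorem pi_comp_ne (S : Setting μ I) (hL : P.pi y ⬝ μ ≠ μ ⬝ P.pi x) (e : P.Hom x x) :
    P.pi y ⬝ μ ≠ μ ⬝ e := fun he => hL (pi_comp_eq_of_transit S.pi_ne S.transit he)

theorem not_isId_of_ne {w : P.Hom x y} (hL : P.pi y ⬝ μ ≠ μ ⬝ P.pi x) : ¬ P.IsId w := by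
  rintro ⟨rfl, -⟩
  exact hL (endo_comm _ _)

theorem loop_of_pi_comp_eq (S : Setting μ I) (hL : P.pi y ⬝ μ ≠ μ ⬝ P.pi x)
    {a : P.Obj} {f : P.Hom a y} {g : P.Hom x a} (h : f ⬝ g = μ)
    {k : P.Hom x a} (hk : P.pi y ⬝ μ = f ⬝ k) : ∃ θ, P.pi y ⬝ f = f ⬝ θ := by
  rcases cyc k g with ⟨e, he⟩ | ⟨e, he⟩ | ⟨e, he⟩ | ⟨e, he⟩
  · rcases comp_dichotomy f with hd | hd
    · obtain ⟨e', he'⟩ := hd e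
      have : μ = (e' ⬝ P.pi y) ⬝ μ := by grind [_=_ RayCategory.assoc]
      have := absorb_left S.ne_zero this
      exact (not_isId_pi y (isId_of_comp_eq_id this).2).elim
    · exact hd _
  · exact ⟨e, cancel_right (k := g) (by grind [_=_ RayCategory.assoc])
      (by rw [P.assoc, h]; exact S.pi_ne)⟩
  · have : μ = P.pi y ⬝ μ ⬝ e := by grind [_=_ RayCategory.assoc]
    exact (pi_ne_id y (absorb S.ne_zero this).1).elim
  · exact (S.pi_comp_ne hL e (by grind [_=_ RayCategory.assoc])).elim

theorem loop_of_eq_pi_comp (S : Setting μ I) (hL : P.pi y ⬝ μ ≠ μ ⬝ P.pi x)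
    {a : P.Obj} {f : P.Hom a y} {g : P.Hom x a} (h : f ⬝ g = μ)
    {k : P.Hom x a} (hk : μ = P.pi y ⬝ f ⬝ k) : ∃ θ, P.pi y ⬝ f = f ⬝ θ := by
  have z := S.ne_zero
  rcases cyc k g with ⟨e, he⟩ | ⟨e, he⟩ | ⟨e, he⟩ | ⟨e, he⟩
  · exact ⟨e, (cancel_right (k := k) (by grind [_=_ RayCategory.assoc])
      (by rw [P.assoc, ← hk]; exact z))⟩
  · have zf : f ≠ P.zero _ _ := ne_zero_left (f := g) (by rwa [h])
    have : f = P.pi y ⬝ f ⬝ e := cancel_right (k := g) (by grind [_=_ RayCategory.assoc])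
      (by rwa [h])
    exact (pi_ne_id y (absorb zf this).1).elim
  · exact (S.pi_comp_ne hL e (by grind [_=_ RayCategory.assoc])).elim
  · have : μ = P.pi y ⬝ μ ⬝ e := by grind [_=_ RayCategory.assoc]
    exact (pi_ne_id y (absorb S.ne_zero this).1).elim

theorem nonloop_nonloop (S : Setting μ I) (hL : P.pi y ⬝ μ ≠ μ ⬝ P.pi x)
    {a b : P.Obj} {f : P.Hom a y} {g : P.Hom x a}
    {f' : P.Hom b y} {g' : P.Hom x b} (F : Fac μ f g) (F' : Fac μ f' g') (hf : RInc f f')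
    (l : ¬ ∃ θ, P.pi y ⬝ f = f ⬝ θ) (l' : ¬ ∃ θ, P.pi y ⬝ f' = f' ⬝ θ) : False := by
  have n := F.not_mem_pi S
  have n' := F'.not_mem_pi S
  have z := S.ideal.ne_zero n
  have z' := S.ideal.ne_zero n'
  have hx : ∀ {a b : P.Obj} {f : P.Hom a y} {g : P.Hom x a} {f' : P.Hom b y} {g' : P.Hom x b},
      Fac μ f g → Fac μ f' g' → (¬ ∃ θ, P.pi y ⬝ f = f ⬝ θ) → (¬ ∃ θ, P.pi y ⬝ f' = f' ⬝ θ) →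
      RInc f (P.pi y ⬝ f') := by
    intro a b f g f' g' F F' l l'
    have := F.comp
    have := F'.comp
    refine ⟨?_, ?_⟩
    · rintro ⟨h, hh⟩
      exact l (S.loop_of_pi_comp_eq hL F.comp (k := h ⬝ g') (by grind [_=_ RayCategory.assoc]))
    · rintro ⟨h, hh⟩
      exact l' (S.loop_of_eq_pi_comp hL F'.comp (k := h ⬝ g) (by grind [_=_ RayCategory.assoc]))
  exact not_repFin_of_four (finite x y a b) S.ideal (z := y) (by simp) (by simp) (by simp)
    (by simp) (by simp) (F.not_mem S) (F'.not_mem S) n n' hf (rInc_pi_comp (ne_zero_right z) l)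
    (hx F F' l l') (hx F' F l' l) (rInc_pi_comp (ne_zero_right z') l')
    (hf.comp_left z z') (S.repFin (F.not_mem S) (F'.not_mem S))

theorem loop_same_color (S : Setting μ I) (hL : P.pi y ⬝ μ ≠ μ ⬝ P.pi x)
    (K : Coloring μ col) {ω : P.Hom x y} (R : Fac μ (P.pi y) ω) {a : P.Obj}
    {f : P.Hom a y} {g : P.Hom x a} (F : Fac μ f g) {θ : P.Hom a a} (l : P.pi y ⬝ f = f ⬝ θ) :
    col _ f ↔ col _ (P.pi y) := by
  by_contra hc
  have hρ := K.rInc F R hc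
  have hμ := S.pi_comp_ne hL
  have zμ := S.ne_zero
  have zf := S.ideal.ne_zero (F.not_mem_pi S)
  have zω := ne_zero_right (R.comp ▸ S.ne_zero)
  have c := F.comp
  have c' := R.comp
  have key : ∀ h, ω ≠ f ⬝ h := by
    intro h hh
    by_cases hi : P.IsId h
    · obtain ⟨rfl, hi⟩ := hi
      obtain rfl := eq_of_heq hi
      rw [P.comp_id] at hh
      have : θ = g := cancel_left (l := f) (by grind [_=_ RayCategory.assoc]) (l ▸ zf)
      exact hμ g (by grind [_=_ RayCategory.assoc])
    · have G : Fac μ (P.pi y ⬝ f) h :=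
        ⟨by rw [P.assoc, ← hh, c'], fun h => F.left (isId_of_comp_isId h).2, hi⟩
      exact hc ((K.inv θ G F l).symm.trans (K.inv f G R rfl))
  refine not_repFin_of_cycle_four (finite x y a y) S.ideal (c₁ := x) (c₂ := a) (d₁ := y)
    (d₂ := a) (by simp) (by simp) (by simp) (by simp)
    (hρ.source_ne_target fun ⟨k, hk⟩ => hρ.2 ⟨k, hk⟩).symm
    (p₁₁ := ω) (p₁₂ := f) (p₂₁ := g) (p₂₂ := θ) (R.not_mem_right S)
    (F.not_mem S) (F.not_mem_right S)
    (fun h => F.not_mem_pi S (l ▸ S.ideal.left _ _ h))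
    ⟨?_, ?_⟩ ⟨?_, ?_⟩ (hρ.symm.lInc (c'.trans c.symm) (c' ▸ zμ)) ⟨?_, ?_⟩
    (S.repFin (F.not_mem S) (R.not_mem S))
  · rintro ⟨h, hh⟩
    have : θ = g ⬝ h := cancel_left (l := f) (by grind [_=_ RayCategory.assoc]) (l ▸ zf)
    exact hμ (h ⬝ g) (by grind [_=_ RayCategory.assoc])
  · rintro ⟨h, hh⟩
    exact key h hh
  · rintro ⟨h, hh⟩
    exact hμ (h ⬝ g) (by grind [_=_ RayCategory.assoc])
  · rintro ⟨h, hh⟩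
    exact key h (cancel_left (l := P.pi y) (by grind [_=_ RayCategory.assoc]) (c' ▸ zμ))
  · rintro ⟨h, hh⟩
    exact hρ.1 ⟨h, cancel_right (k := f) (by grind [_=_ RayCategory.assoc]) zf⟩
  · rintro ⟨h, hh⟩
    exact hρ.2 ⟨h, cancel_right (k := θ) (by grind [_=_ RayCategory.assoc]) (l ▸ zf)⟩

end Setting

end RayCategory

namespace RayCategory

variable {P : RayCategory} {x y : P.Obj} {μ : P.Hom x y} {I : ∀ a b : P.Obj, P.Hom a b → Prop}
  {col : ∀ a : P.Obj, P.Hom a y → Prop}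

namespace Setting

theorem nonloop_same_color (S : Setting μ I) (hL : P.pi y ⬝ μ ≠ μ ⬝ P.pi x)
    (K : Coloring μ col) {a b : P.Obj} {f : P.Hom a y} {g : P.Hom x a} {e : P.Hom y y}
    {p : P.Hom b y} {g' : P.Hom x b} {ω : P.Hom x y} (F : Fac μ f g) (G : Fac μ (e ⬝ p) g')
    (H : Fac μ (P.pi y ⬝ e) ω) (hG : ¬ (col _ f ↔ col _ (e ⬝ p)))
    (hH : ¬ (col _ f ↔ col _ (P.pi y ⬝ e))) (hp : RInc p (P.pi y))
    (l : ¬ ∃ θ, P.pi y ⬝ f = f ⬝ θ) : False := by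
  have nF := F.not_mem_pi S
  have nG := G.not_mem_pi S
  have nH := H.not_mem_pi S
  have zF := S.ideal.ne_zero nF
  have zG := S.ideal.ne_zero nG
  have zH := S.ideal.ne_zero nH
  have cF := F.comp
  have cG := G.comp
  have cH := H.comp
  have i₃₄ : RInc (P.pi y ⬝ e ⬝ p) (P.pi y ⬝ P.pi y ⬝ e) := by
    have e₁ : P.pi y ⬝ e ⬝ p = (P.pi y ⬝ e) ⬝ p := by grind [_=_ RayCategory.assoc]
    have e₂ : P.pi y ⬝ P.pi y ⬝ e = (P.pi y ⬝ e) ⬝ P.pi y := by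
      have := endo_comm e (P.pi y)
      grind [_=_ RayCategory.assoc]
    rw [e₁] at zG ⊢
    rw [e₂] at zH ⊢
    exact hp.comp_left zG zH
  refine not_repFin_of_four (finite x y a b) S.ideal (z := y) (by simp) (a₁ := a) (a₂ := a)
    (a₃ := b) (a₄ := y) (by simp) (by simp) (by simp) (by simp) (F.not_mem S) nF nG nH
    (rInc_pi_comp (ne_zero_right zF) l) ⟨?_, ?_⟩ ⟨?_, ?_⟩
    ((K.rInc F G hG).comp_left zF zG) ((K.rInc F H hH).comp_left zF zH) i₃₄
    (S.repFin (F.not_mem S) (G.not_mem S))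
  · rintro ⟨h, hh⟩
    exact l (S.loop_of_pi_comp_eq hL cF (k := h ⬝ g') (by grind [_=_ RayCategory.assoc]))
  · rintro ⟨h, hh⟩
    obtain ⟨θ, hθ⟩ := S.loop_of_eq_pi_comp hL cG (k := h ⬝ g) (by grind [_=_ RayCategory.assoc])
    exact (K.rInc F G hG).2 ⟨θ ⬝ h, by grind [_=_ RayCategory.assoc]⟩
  · rintro ⟨h, hh⟩
    exact l (S.loop_of_pi_comp_eq hL cF (k := h ⬝ ω) (by grind [_=_ RayCategory.assoc]))
  · rintro ⟨h, hh⟩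
    have := endo_comm e (P.pi y)
    exact (K.rInc F H hH).2 ⟨P.pi y ⬝ h, by grind [_=_ RayCategory.assoc]⟩

theorem core_of_ne (S : Setting μ I) (hL : P.pi y ⬝ μ ≠ μ ⬝ P.pi x) (K : Coloring μ col)
    {a₁ a₂ a₃ : P.Obj} {f₁ : P.Hom a₁ y} {g₁ : P.Hom x a₁} {f₂ : P.Hom a₂ y} {g₂ : P.Hom x a₂}
    {f₃ : P.Hom a₃ y} {g₃ : P.Hom x a₃} (F₁ : Fac μ f₁ g₁) (F₂ : Fac μ f₂ g₂)
    (F₃ : Fac μ f₃ g₃) (hf : RInc f₁ f₂) (h₁₂ : col _ f₁ ↔ col _ f₂)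
    (h₁₃ : ¬ (col _ f₁ ↔ col _ f₃)) : False := by
  have h₂₃ : ¬ (col _ f₂ ↔ col _ f₃) := by tauto
  have i₁₃ := K.rInc F₁ F₃ h₁₃
  have i₂₃ := K.rInc F₂ F₃ h₂₃
  have T := fun {a b : P.Obj} {f : P.Hom a y} {g : P.Hom x a} {f' : P.Hom b y} {g' : P.Hom x b}
    (F : Fac μ f g) (F' : Fac μ f' g') (hf : RInc f f') => S.nonloop_nonloop hL F F' hf
  by_cases hμ : ∃ k, μ = P.pi y ⬝ k
  · obtain ⟨ω, hω⟩ := hμ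
    have R : Fac μ (P.pi y) ω := ⟨hω.symm, not_isId_pi y, not_isId_of_ne hL⟩
    have C := fun {a : P.Obj} {f : P.Hom a y} {g : P.Hom x a} (F : Fac μ f g)
        (l : ∃ θ, P.pi y ⬝ f = f ⬝ θ) => l.elim fun _ l => S.loop_same_color hL K R F l
    have d₁ := C F₁
    have d₂ := C F₂
    have d₃ := C F₃
    have u₁₂ := T F₁ F₂ hf
    have u₁₃ := T F₁ F₃ i₁₃
    have u₂₃ := T F₂ F₃ i₂₃
    have l₃ : ¬ ∃ θ, P.pi y ⬝ f₃ = f₃ ⬝ θ := fun l₃ =>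
      u₁₂ (fun l₁ => h₁₃ ((d₁ l₁).trans (d₃ l₃).symm)) fun l₂ => h₂₃ ((d₂ l₂).trans (d₃ l₃).symm)
    have l₁ : ∃ θ, P.pi y ⬝ f₁ = f₁ ⬝ θ := not_not.1 fun n => u₁₃ n l₃
    have l₂ : ∃ θ, P.pi y ⬝ f₂ = f₂ ⬝ θ := not_not.1 fun n => u₂₃ n l₃
    obtain ⟨θ₁, l₁⟩ := l₁
    obtain ⟨θ₂, l₂⟩ := l₂
    have c₁ := F₁.comp
    have c₂ := F₂.comp
    have nn₁ := F₁.not_mem_pi S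
    have nn₂ := F₂.not_mem_pi S
    have m₁ := F₁.not_mem S
    have m₂ := F₂.not_mem S
    have zμ := S.ne_zero
    have cr := d₁ ⟨θ₁, l₁⟩
    obtain ⟨i, p₁, p₂, e₁, e₂, hp⟩ := exists_pi_power f₁ f₂ (ne_zero_left (c₁ ▸ zμ))
    set e := P.pipow y i with he
    have hce := endo_comm e (P.pi y)
    have hτ : p₂ ⬝ g₂ = p₁ ⬝ g₁ := cancel_left (l := e) (by grind [_=_ RayCategory.assoc])
      (by rw [← P.assoc, ← e₂, c₂]; exact zμ)
    have t₁ : P.pi y ⬝ p₁ = p₁ ⬝ θ₁ := cancel_left (l := e) (by grind [_=_ RayCategory.assoc])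
      (by rw [← P.assoc, hce, P.assoc, ← e₁]; exact S.ideal.ne_zero nn₁)
    have t₂ : P.pi y ⬝ p₂ = p₂ ⬝ θ₂ := cancel_left (l := e) (by grind [_=_ RayCategory.assoc])
      (by rw [← P.assoc, hce, P.assoc, ← e₂]; exact S.ideal.ne_zero nn₂)
    have hpp : RInc p₁ p₂ := RInc.of_comp_left (e := e) (e₁ ▸ e₂ ▸ hf)
    have hτμ : e ⬝ p₁ ⬝ g₁ = μ := by grind [_=_ RayCategory.assoc]
    have n₁ : ¬ I _ _ (P.pi y ⬝ p₁) := fun h => nn₁ (by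
      rw [e₁, ← P.assoc, ← hce, P.assoc]; exact S.ideal.left _ _ h)
    have n₂ : ¬ I _ _ (P.pi y ⬝ p₂) := fun h => nn₂ (by
      rw [e₂, ← P.assoc, ← hce, P.assoc]; exact S.ideal.left _ _ h)
    by_cases hd : ∃ k, p₁ ⬝ g₁ = P.pi y ⬝ k
    · obtain ⟨ω', hω'⟩ := hd
      have H : Fac μ (P.pi y ⬝ e) ω' := ⟨by grind [_=_ RayCategory.assoc],
        fun h => not_isId_pi y (isId_of_comp_isId h).1, not_isId_of_ne hL⟩
      have cH : col _ (P.pi y ⬝ e) ↔ col _ (P.pi y) := K.inv e H R rfl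
      rcases hpp.pi_cases hp with ⟨⟨q₁, hq₁⟩, q₂, hq₂⟩ | hr | hr
      · refine pi_factorization_false (finite x y a₁ a₂) S.ideal (S.repFin m₁ m₂) (by simp)
          (by simp) (ne_zero_left S.pi_ne) hq₁ hq₂ hpp (fun h => n₁ ?_) (fun h => n₂ ?_)
          (fun h => n₁ ?_) (fun h => n₂ ?_)
        · rw [hq₁, P.assoc]; exact S.ideal.left _ _ h
        · rw [hq₁, P.assoc]; exact S.ideal.left _ _ h
        · rw [hq₂, P.assoc]; exact S.ideal.left _ _ h
        · rw [hq₂, P.assoc]; exact S.ideal.left _ _ h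
      · exact S.nonloop_same_color hL K F₃ (e₁ ▸ F₁) H (by grind) (by grind) hr l₃
      · exact S.nonloop_same_color hL K F₃ (e₂ ▸ F₂) H (by grind) (by grind) hr l₃
    · exact S.loop_loop hd (fun k hk => S.pi_comp_ne hL k (by grind [_=_ RayCategory.assoc]))
        (fun h => S.not_mem (hτμ ▸ S.ideal.left _ _ h)) rfl hτ hpp t₁ t₂ n₁ n₂
  · have Lp : ∀ {a b : P.Obj} {f : P.Hom a y} {g : P.Hom x a} {f' : P.Hom b y} {g' : P.Hom x b},
        Fac μ f g → Fac μ f' g' → RInc f f' → (∃ θ, P.pi y ⬝ f = f ⬝ θ) →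
        ¬ ∃ θ, P.pi y ⬝ f' = f' ⬝ θ := by
      rintro a b f g f' g' F F' hf ⟨θ, l⟩ ⟨θ', l'⟩
      exact S.loop_loop hμ (S.pi_comp_ne hL) S.not_mem F.comp F'.comp hf l l'
        (F.not_mem_pi S) (F'.not_mem_pi S)
    by_cases L₁ : ∃ θ, P.pi y ⬝ f₁ = f₁ ⬝ θ
    · exact T F₂ F₃ i₂₃ (Lp F₁ F₂ hf L₁) (Lp F₁ F₃ i₁₃ L₁)
    · exact T F₁ F₂ hf L₁ fun L₂ => T F₁ F₃ i₁₃ L₁ (Lp F₂ F₃ i₂₃ L₂)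

end Setting

end RayCategory

namespace RayCategory

variable {P : RayCategory} {x y : P.Obj} {I : ∀ a b : P.Obj, P.Hom a b → Prop}

/-- A factorization `τ = f g` such that `f` does not divide `π(y)`, `g` does not divide `π(x)`,
and `π(y)f`, `gπ(x)` do not belong to `I`. -/
structure Transversal (τ : P.Hom x y) (I : ∀ a b : P.Obj, P.Hom a b → Prop) {a : P.Obj}
    (f : P.Hom a y) (g : P.Hom x a) : Prop where
  comp : f ⬝ g = τ
  left : ∀ q, P.pi y ≠ f ⬝ q
  right : ∀ k, P.pi x ≠ k ⬝ g
  not_left : ¬ I _ _ (P.pi y ⬝ f)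
  not_right : ¬ I _ _ (g ⬝ P.pi x)

/-- A morphism `τ ∉ I` with `π(y)τ = τπ(x)` which is not divisible by `π(y)`. -/
structure Central (τ : P.Hom x y) (I : ∀ a b : P.Obj, P.Hom a b → Prop) : Prop where
  ideal : IsIdeal I
  comm : P.pi y ⬝ τ = τ ⬝ P.pi x
  not_mem : ¬ I _ _ τ
  pi_ne : P.pi y ⬝ τ ≠ P.zero _ _
  not_dvd : ∀ k, τ ≠ P.pi y ⬝ k
  not_mem_left : ¬ I _ _ (P.pi y)
  not_mem_right : ¬ I _ _ (P.pi x)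

theorem LInc.target_ne_source {a : P.Obj} {g : P.Hom x a} (h : LInc g (P.pi x)) : a ≠ x := by
  rintro rfl
  rcases endo_cases g with rfl | ⟨k, rfl⟩
  · exact h.1 ⟨P.pi a, (P.comp_id _).symm⟩
  · exact h.2 ⟨k, endo_comm _ _⟩

namespace Central

variable {τ : P.Hom x y}

theorem not_dvd_right (C : Central τ I) (m : P.Hom x y) : τ ≠ m ⬝ P.pi x := by
  intro h
  have := C.comm
  exact C.not_dvd m (cancel_right (k := P.pi x) (by grind [_=_ RayCategory.assoc])
    (this ▸ C.pi_ne))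

theorem right_eq (C : Central τ I) {k : P.Hom x x} (h : P.pi y ⬝ τ = τ ⬝ k) : P.pi x = k :=
  cancel_left (l := τ) (C.comm ▸ h) (C.comm ▸ C.pi_ne)

theorem not_mem_fst (C : Central τ I) {a : P.Obj} {f : P.Hom a y} {g : P.Hom x a}
    (h : f ⬝ g = τ) : ¬ I _ _ f := fun n => C.not_mem (h ▸ C.ideal.right _ _ n)

theorem not_mem_snd (C : Central τ I) {a : P.Obj} {f : P.Hom a y} {g : P.Hom x a}
    (h : f ⬝ g = τ) : ¬ I _ _ g := fun n => C.not_mem (h ▸ C.ideal.left _ _ n)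

theorem not_pi_dvd (C : Central τ I) {a : P.Obj} {f : P.Hom a y} {g : P.Hom x a}
    (h : f ⬝ g = τ) : ¬ ∃ k, f = P.pi y ⬝ k := by
  rintro ⟨k, rfl⟩
  exact C.not_dvd (k ⬝ g) (by rw [← h, P.assoc])

theorem lInc (C : Central τ I) {a : P.Obj} {f : P.Hom a y} {g : P.Hom x a}
    (h : f ⬝ g = τ) (hg : ∀ k, P.pi x ≠ k ⬝ g) : LInc g (P.pi x) := by
  refine ⟨fun ⟨k, hk⟩ => hg k hk, ?_⟩
  rintro ⟨k, rfl⟩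
  exact C.not_dvd_right (f ⬝ k) (by rw [← h, P.assoc])

theorem ne (C : Central τ I) {a : P.Obj} {f : P.Hom a y} {g : P.Hom x a}
    (h : f ⬝ g = τ) (hf : ¬ P.IsId f) : x ≠ y := by
  rintro rfl
  rcases endo_cases τ with ht | ⟨k, hk⟩
  · exact hf (isId_of_comp_isId (g := f) (f := g) (by rw [h, ht]; exact isId_id _)).1
  · exact C.not_dvd k hk

theorem long_fork_false (C : Central τ I) {D : Set P.Obj} (hD : D.Finite) (hR : RepFin P D I)
    {a₁ a₂ a₃ a₄ : P.Obj} (hx : x ∈ D) (hy : y ∈ D) (h₁ : a₁ ∈ D) (h₂ : a₂ ∈ D) (h₃ : a₃ ∈ D)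
    (h₄ : a₄ ∈ D) {f₁ : P.Hom a₁ y} {g₁ : P.Hom x a₁} {f₂ : P.Hom a₂ y} {g₂ : P.Hom x a₂}
    {f₃ : P.Hom a₃ y} {g₃ : P.Hom x a₃} {f₄ : P.Hom a₄ y} {g₄ : P.Hom x a₄}
    (T₁ : Transversal τ I f₁ g₁) (T₂ : Transversal τ I f₂ g₂) (T₃ : Transversal τ I f₃ g₃)
    (T₄ : Transversal τ I f₄ g₄) (h₁₂ : RInc f₁ f₂) (h₃₄ : RInc f₃ f₄) {h : P.Hom a₁ a₃}
    (hh : P.pi y ⬝ f₁ = f₃ ⬝ h) : False := by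
  have zτ := C.ideal.ne_zero C.not_mem
  have z₁ := C.ideal.ne_zero T₁.not_left
  have c₁ := T₁.comp
  have c₂ := T₂.comp
  have c₃ := T₃.comp
  have c₄ := T₄.comp
  have cc := C.comm
  have d₃ := C.not_pi_dvd T₃.comp
  have d₄ := C.not_pi_dvd T₄.comp
  have hρ : ∀ {a : P.Obj} {f : P.Hom a y} {g : P.Hom x a}, Transversal τ I f g →
      RInc f (P.pi y) := fun T => ⟨fun ⟨q, hq⟩ => T.left q hq, C.not_pi_dvd T.comp⟩
  refine not_repFin_of_long_fork hD C.ideal (x := x) (z := a₁) (b₁ := a₂) (b₂ := y) (d := a₃)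
    (t₁ := x) (t₂ := a₄) (y := y) hx h₁ h₂ hy h₃ hx h₄ hy (C.lInc c₃ T₃.right).target_ne_source
    (h₃₄.source_ne d₃ d₄) (C.lInc c₄ T₄.right).target_ne_source.symm
    (h₃₄.source_ne_target d₃) (C.ne c₁ h₁₂.not_isId_left) (h₃₄.symm.source_ne_target d₄)
    (c := g₃) (r₁ := P.pi x) (r₂ := g₄) (h := h) (m := f₁) (q₁ := f₂) (q₂ := P.pi y)
    (C.not_mem_snd c₃) C.not_mem_right (C.not_mem_snd c₄)
    (fun n => T₁.not_left (hh ▸ C.ideal.left _ _ n)) (C.not_mem_fst c₁) (C.not_mem_fst c₂)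
    C.not_mem_left ⟨?_, ?_⟩ h₁₂ (hρ T₁) (hρ T₂) (C.lInc c₃ T₃.right)
    (h₃₄.lInc (c₃.trans c₄.symm) (c₃ ▸ zτ)) (C.lInc c₄ T₄.right).symm ⟨?_, ?_⟩ hR
  · rintro ⟨k, hk⟩
    exact T₁.right k (C.right_eq (k := k ⬝ g₁) (by grind [_=_ RayCategory.assoc]))
  · rintro ⟨k, hk⟩
    exact C.not_dvd (f₁ ⬝ k) (by grind [_=_ RayCategory.assoc])
  · rintro ⟨k, hk⟩
    exact d₃ ⟨k, cancel_right (k := h) (by grind [_=_ RayCategory.assoc]) (hh ▸ z₁)⟩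
  · rintro ⟨k, hk⟩
    exact T₃.left k (cancel_right (k := f₁) (by grind [_=_ RayCategory.assoc]) z₁)

theorem transversal_false (C : Central τ I) {D : Set P.Obj} (hD : D.Finite) (hR : RepFin P D I)
    {a₁ a₂ : P.Obj} (hx : x ∈ D) (hy : y ∈ D) (h₁ : a₁ ∈ D) (h₂ : a₂ ∈ D)
    {f₁ : P.Hom a₁ y} {g₁ : P.Hom x a₁} {f₂ : P.Hom a₂ y} {g₂ : P.Hom x a₂}
    (T₁ : Transversal τ I f₁ g₁) (T₂ : Transversal τ I f₂ g₂) (hf : RInc f₁ f₂) : False := by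
  have c₁ := T₁.comp
  have c₂ := T₂.comp
  have e₁₁ : ¬ ∃ h, P.pi y ⬝ f₁ = f₁ ⬝ h := fun ⟨h, hh⟩ =>
    C.long_fork_false hD hR hx hy h₁ h₂ h₁ h₂ T₁ T₂ T₁ T₂ hf hf hh
  have e₁₂ : ¬ ∃ h, P.pi y ⬝ f₁ = f₂ ⬝ h := fun ⟨h, hh⟩ =>
    C.long_fork_false hD hR hx hy h₁ h₂ h₂ h₁ T₁ T₂ T₂ T₁ hf hf.symm hh
  have e₂₁ : ¬ ∃ h, P.pi y ⬝ f₂ = f₁ ⬝ h := fun ⟨h, hh⟩ =>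
    C.long_fork_false hD hR hx hy h₂ h₁ h₁ h₂ T₂ T₁ T₁ T₂ hf.symm hf hh
  have e₂₂ : ¬ ∃ h, P.pi y ⬝ f₂ = f₂ ⬝ h := fun ⟨h, hh⟩ =>
    C.long_fork_false hD hR hx hy h₂ h₁ h₂ h₁ T₂ T₁ T₂ T₁ hf.symm hf.symm hh
  have z₁ := C.ideal.ne_zero T₁.not_left
  have z₂ := C.ideal.ne_zero T₂.not_left
  refine not_repFin_of_four hD C.ideal hy h₁ h₂ h₁ h₂ (C.not_mem_fst c₁) (C.not_mem_fst c₂)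
    T₁.not_left T₂.not_left hf (rInc_pi_comp (ne_zero_right z₁) e₁₁) ⟨e₂₁, ?_⟩ ⟨e₁₂, ?_⟩
    (rInc_pi_comp (ne_zero_right z₂) e₂₂) (hf.comp_left z₁ z₂) hR
  · rintro ⟨k, rfl⟩
    exact C.not_pi_dvd c₁ ⟨f₂ ⬝ k, P.assoc _ _ _⟩
  · rintro ⟨k, rfl⟩
    exact C.not_pi_dvd c₂ ⟨f₁ ⬝ k, P.assoc _ _ _⟩

/-- One of two incomparable factorizations has its left factor dividing `π(y)`. -/
theorem fork_false (C : Central τ I) {D : Set P.Obj} (hD : D.Finite) (hR : RepFin P D I)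
    {a₁ a₂ : P.Obj} (hx : x ∈ D) (h₁ : a₁ ∈ D) (h₂ : a₂ ∈ D)
    {f₁ : P.Hom a₁ y} {g₁ : P.Hom x a₁} {f₂ : P.Hom a₂ y} {g₂ : P.Hom x a₂}
    (c₁ : f₁ ⬝ g₁ = τ) (c₂ : f₂ ⬝ g₂ = τ) (n₁ : ¬ I _ _ (P.pi y ⬝ f₁))
    (n₂ : ¬ I _ _ (P.pi y ⬝ f₂)) (hg₁ : ∀ k, P.pi x ≠ k ⬝ g₁) (hg₂ : ∀ k, P.pi x ≠ k ⬝ g₂)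
    (hf : RInc f₁ f₂) {k : P.Hom y a₁} (hk : P.pi y = f₁ ⬝ k) : False := by
  have zτ := C.ideal.ne_zero C.not_mem
  have cc := C.comm
  have d₁ := C.not_pi_dvd c₁
  have d₂ := C.not_pi_dvd c₂
  have m₁ : ¬ I _ _ (k ⬝ f₁) := fun n => n₁ (by
    rw [hk, P.assoc]
    exact C.ideal.left _ _ n)
  have m₂ : ¬ I _ _ (k ⬝ f₂) := fun n => n₂ (by
    rw [hk, P.assoc]
    exact C.ideal.left _ _ n)
  refine not_repFin_of_fork hD C.ideal (x := x) (b₁ := a₁) (b₂ := a₂) (d := a₁) (t₁ := x)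
    (t₂ := a₂) hx h₁ h₂ h₁ hx h₂ (C.lInc c₁ hg₁).target_ne_source (hf.source_ne d₁ d₂)
    (C.lInc c₂ hg₂).target_ne_source.symm (c := g₁) (r₁ := P.pi x) (r₂ := g₂) (q₁ := k ⬝ f₁)
    (q₂ := k ⬝ f₂) (C.not_mem_snd c₁) C.not_mem_right (C.not_mem_snd c₂) m₁ m₂
    ⟨?_, ?_⟩ ⟨?_, ?_⟩ (hf.comp_left (C.ideal.ne_zero m₁) (C.ideal.ne_zero m₂)) (C.lInc c₁ hg₁)
    (hf.lInc (c₁.trans c₂.symm) (c₁ ▸ zτ)) (C.lInc c₂ hg₂).symm hR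
  · rintro ⟨h, hh⟩
    exact hg₁ h (C.right_eq (k := h ⬝ g₁) (by grind [_=_ RayCategory.assoc]))
  · rintro ⟨h, hh⟩
    exact C.not_dvd (f₁ ⬝ h) (by grind [_=_ RayCategory.assoc])
  · rintro ⟨h, hh⟩
    exact hg₂ h (C.right_eq (k := h ⬝ g₂) (by grind [_=_ RayCategory.assoc]))
  · rintro ⟨h, hh⟩
    exact C.not_dvd (f₂ ⬝ h) (by grind [_=_ RayCategory.assoc])

end Central

namespace Setting

variable {μ : P.Hom x y}

theorem not_mem_comp_pi (S : Setting μ I) (hL : P.pi y ⬝ μ = μ ⬝ P.pi x) {a : P.Obj}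
    {f : P.Hom a y} {g : P.Hom x a} (F : Fac μ f g) : ¬ I _ _ (g ⬝ P.pi x) := by
  rw [S.mem_iff]
  rintro ⟨c, d, e⟩
  have cF := F.comp
  have zg : g ⬝ P.pi x ≠ P.zero _ _ := ne_zero_right (g := f) (by
    rw [← P.assoc, cF, ← hL]
    exact S.pi_ne)
  have e' : g ⬝ P.pi x = (c ⬝ f) ⬝ (g ⬝ P.pi x) ⬝ d := by
    rw [e, hL]
    grind [_=_ RayCategory.assoc]
  exact F.left (isId_of_comp_eq_id (absorb zg e').1).2

theorem not_mem_pi_right (S : Setting μ I) (hL : P.pi y ⬝ μ = μ ⬝ P.pi x) (hμ : ¬ P.IsId μ) :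
    ¬ I _ _ (P.pi x) := by
  rw [S.mem_iff]
  rintro ⟨c, d, e⟩
  have z : P.pi x ≠ P.zero _ _ := ne_zero_right (g := μ) (hL ▸ S.pi_ne)
  have hx : P.pi x = (c ⬝ μ) ⬝ P.pi x ⬝ d := by
    rw [hL] at e
    exact e.trans (by grind [_=_ RayCategory.assoc])
  exact hμ (isId_of_comp_eq_id (absorb z hx).1).2

/-- Two incomparable left factors of `π(y)`. -/
theorem pi_target_false (S : Setting μ I) {a₁ a₂ : P.Obj} {f₁ : P.Hom a₁ y} {f₂ : P.Hom a₂ y}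
    (n₁ : ¬ I _ _ (P.pi y ⬝ f₁)) (n₂ : ¬ I _ _ (P.pi y ⬝ f₂)) (hf : RInc f₁ f₂)
    {k₁ : P.Hom y a₁} {k₂ : P.Hom y a₂} (h₁ : P.pi y = f₁ ⬝ k₁) (h₂ : P.pi y = f₂ ⬝ k₂) :
    False := by
  have key : ∀ {a b : P.Obj} {f : P.Hom a y} {k : P.Hom y a} {f' : P.Hom b y}, P.pi y = f ⬝ k →
      ¬ I _ _ (P.pi y ⬝ f') → ¬ I _ _ (k ⬝ f') := by
    intro a b f k f' h n m
    rw [h, P.assoc] at n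
    exact n (S.ideal.left _ _ m)
  exact pi_factorization_false (finite x y a₁ a₂) S.ideal
    (S.repFin (fun h => n₁ (S.ideal.left _ _ h)) (fun h => n₂ (S.ideal.left _ _ h))) (by simp)
    (by simp) (ne_zero_left S.pi_ne) h₁ h₂ hf (key h₁ n₁) (key h₁ n₂) (key h₂ n₁) (key h₂ n₂)

/-- Two incomparable right factors of `π(x)`. -/
theorem pi_source_false (S : Setting μ I) (hL : P.pi y ⬝ μ = μ ⬝ P.pi x) {a₁ a₂ : P.Obj}
    {f₁ : P.Hom a₁ y} {g₁ : P.Hom x a₁} {f₂ : P.Hom a₂ y} {g₂ : P.Hom x a₂} (F₁ : Fac μ f₁ g₁)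
    (F₂ : Fac μ f₂ g₂) (hf : RInc f₁ f₂) {k₁ : P.Hom a₁ x} {k₂ : P.Hom a₂ x}
    (h₁ : P.pi x = k₁ ⬝ g₁) (h₂ : P.pi x = k₂ ⬝ g₂) : False := by
  have z : P.pi x ≠ P.zero _ _ := ne_zero_right (g := μ) (hL ▸ S.pi_ne)
  have n₁ := S.not_mem_comp_pi hL F₁
  have n₂ := S.not_mem_comp_pi hL F₂
  have key : ∀ {a b : P.Obj} {g : P.Hom x a} {k : P.Hom a x} {g' : P.Hom x b}, P.pi x = k ⬝ g →
      ¬ I _ _ (g' ⬝ P.pi x) → ¬ I _ _ (g' ⬝ k) := by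
    intro a b g k g' h n m
    rw [h, ← P.assoc] at n
    exact n (S.ideal.right _ _ m)
  have hg := hf.lInc (F₁.comp.trans F₂.comp.symm) (F₁.comp ▸ S.ne_zero)
  refine pi_factorization_false (finite x y a₁ a₂) S.ideal
    (S.repFin (F₁.not_mem S) (F₂.not_mem S)) (by simp) (by simp) z h₁ h₂ ⟨?_, ?_⟩
    (key h₁ n₁) (key h₂ n₁) (key h₁ n₂) (key h₂ n₂)
  · rintro ⟨h, hh⟩
    exact hg.2 ⟨h, cancel_left (l := k₁) (by grind [_=_ RayCategory.assoc]) (h₁ ▸ z)⟩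
  · rintro ⟨h, hh⟩
    exact hg.1 ⟨h, cancel_left (l := k₂) (by grind [_=_ RayCategory.assoc]) (h₂ ▸ z)⟩

/-- The case where `μ` is not divisible by `π(y)`. -/
theorem three_false_of_not_dvd (S : Setting μ I) (hL : P.pi y ⬝ μ = μ ⬝ P.pi x)
    (hd : ∀ k, μ ≠ P.pi y ⬝ k) {a₁ a₂ a₃ : P.Obj}
    {f₁ : P.Hom a₁ y} {g₁ : P.Hom x a₁} {f₂ : P.Hom a₂ y} {g₂ : P.Hom x a₂}
    {f₃ : P.Hom a₃ y} {g₃ : P.Hom x a₃} (F₁ : Fac μ f₁ g₁) (F₂ : Fac μ f₂ g₂)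
    (F₃ : Fac μ f₃ g₃) (h₁₂ : RInc f₁ f₂) (h₁₃ : RInc f₁ f₃) (h₂₃ : RInc f₂ f₃) : False := by
  have hμ : ¬ P.IsId μ := fun h => F₁.left (isId_of_comp_isId (F₁.comp.symm ▸ h)).1
  have C : Central μ I :=
    ⟨S.ideal, hL, S.not_mem, S.pi_ne, hd, S.not_mem_pi hμ, S.not_mem_pi_right hL hμ⟩
  have key : ∀ {a b : P.Obj} {f : P.Hom a y} {g : P.Hom x a} {f' : P.Hom b y} {g' : P.Hom x b},
      Fac μ f g → Fac μ f' g' → RInc f f' → (¬ ∃ k, P.pi x = k ⬝ g) →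
      ¬ ¬ ∃ k, P.pi x = k ⬝ g' := by
    intro a b f g f' g' F F' hf hg hg'
    have fin := finite x y a b
    have hR := S.repFin (F.not_mem S) (F'.not_mem S)
    have u : ∀ k, P.pi x ≠ k ⬝ g := fun k hk => hg ⟨k, hk⟩
    have u' : ∀ k, P.pi x ≠ k ⬝ g' := fun k hk => hg' ⟨k, hk⟩
    have n := F.not_mem_pi S
    have n' := F'.not_mem_pi S
    have v : ∀ k, P.pi y ≠ f ⬝ k := fun k hk => C.fork_false fin hR (by simp) (by simp)
      (by simp) F.comp F'.comp n n' u u' hf hk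
    have v' : ∀ k, P.pi y ≠ f' ⬝ k := fun k hk => C.fork_false fin hR (by simp) (by simp)
      (by simp) F'.comp F.comp n' n u' u hf.symm hk
    exact C.transversal_false fin hR (by simp) (by simp) (by simp) (by simp)
      ⟨F.comp, v, u, n, S.not_mem_comp_pi hL F⟩ ⟨F'.comp, v', u', n', S.not_mem_comp_pi hL F'⟩ hf
  have key' : ∀ {a b : P.Obj} {f : P.Hom a y} {g : P.Hom x a} {f' : P.Hom b y} {g' : P.Hom x b},
      Fac μ f g → Fac μ f' g' → RInc f f' → (∃ k, P.pi x = k ⬝ g) → ¬ ∃ k, P.pi x = k ⬝ g' := by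
    rintro a b f g f' g' F F' hf ⟨k, hk⟩ ⟨k', hk'⟩
    exact S.pi_source_false hL F F' hf hk hk'
  by_cases Q : ∃ k, P.pi x = k ⬝ g₁
  · exact key F₂ F₃ h₂₃ (key' F₁ F₂ h₁₂ Q) (key' F₁ F₃ h₁₃ Q)
  · exact key F₁ F₂ h₁₂ Q fun Q₂ => key F₁ F₃ h₁₃ Q (key' F₂ F₃ h₂₃ Q₂)

end Setting

end RayCategory

namespace RayCategory

variable {P : RayCategory} {x y : P.Obj} {I : ∀ a b : P.Obj, P.Hom a b → Prop} {μ : P.Hom x y}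

theorem eq_of_comp_isId {a b : P.Obj} {f : P.Hom a y} {g : P.Hom b y} {h : P.Hom a b}
    (e : f = g ⬝ h) (hh : P.IsId h) : ∃ k, g = f ⬝ k := by
  obtain ⟨rfl, hh⟩ := hh
  obtain rfl := eq_of_heq hh
  exact ⟨P.id _, by rw [e, P.comp_id, P.comp_id]⟩

theorem pipow_succ_eq (y : P.Obj) (i : ℕ) : P.pipow y (i + 1) = P.pi y ⬝ P.pipow y i :=
  P.pipow_succ y i

theorem pipow_comp_of_comm {τ : P.Hom x y} (h : P.pi y ⬝ τ = τ ⬝ P.pi x) (i : ℕ) :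
    P.pipow y i ⬝ τ = τ ⬝ P.pipow x i := by
  induction i with
  | zero => simp only [P.pipow_zero, P.id_comp, P.comp_id]
  | succ i ih =>
    have h₁ := pipow_succ_eq x i
    have h₂ := pipow_succ_eq y i
    have h₃ := endo_comm (P.pi y) (P.pipow y i)
    have h₄ := endo_comm (P.pi x) (P.pipow x i)
    grind [_=_ RayCategory.assoc]

theorem pipow_cancel {τ ω : P.Hom x y} {i j : ℕ} (h : P.pipow y i ⬝ τ = P.pipow y j ⬝ ω)
    (h0 : P.pipow y i ⬝ τ ≠ P.zero _ _) (hτ : ¬ ∃ k, τ = P.pi y ⬝ k)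
    (hω : ¬ ∃ k, ω = P.pi y ⬝ k) : τ = ω := by
  rcases lt_trichotomy i j with hij | rfl | hij
  · obtain ⟨k, rfl⟩ := Nat.exists_eq_add_of_lt hij
    refine (hτ ⟨P.pipow y k ⬝ ω, cancel_left (l := P.pipow y i) ?_ h0⟩).elim
    rw [h, add_assoc, pipow_add, pipow_succ_eq, P.assoc, P.assoc]
  · exact cancel_left h h0
  · obtain ⟨k, rfl⟩ := Nat.exists_eq_add_of_lt hij
    refine (hω ⟨P.pipow y k ⬝ τ, cancel_left (l := P.pipow y j) ?_ (h ▸ h0)⟩).elim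
    rw [← h, add_assoc, pipow_add, pipow_succ_eq, P.assoc, P.assoc]

namespace Setting

/-- If `π(y)f = f'h`, then `f` or `f'` is comparable to `π(y)` or to `ω`. -/
theorem cross_false (S : Setting μ I) {ω : P.Hom x y} (R : Fac μ (P.pi y) ω) {a a' : P.Obj}
    {f : P.Hom a y} {g : P.Hom x a} {f' : P.Hom a' y} {g' : P.Hom x a'} (F : Fac μ f g)
    (F' : Fac μ f' g') (h' : RInc f' (P.pi y)) (hω : RInc f ω)
    {h : P.Hom a a'} (hh : P.pi y ⬝ f = f' ⬝ h) : False := by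
  have cR := R.comp
  have cF := F.comp
  have cF' := F'.comp
  have n := F.not_mem_pi S
  have z := S.ideal.ne_zero n
  have zμ := S.ne_zero
  refine not_repFin_of_cycle_four (finite x y a a') S.ideal (c₁ := x) (c₂ := a) (d₁ := a')
    (d₂ := y) (by simp) (by simp) (by simp) (by simp) (h'.source_ne_target fun ⟨k, hk⟩ =>
      h'.2 ⟨k, hk⟩) (p₁₁ := g') (p₁₂ := h) (p₂₁ := ω) (p₂₂ := f) (F'.not_mem_right S)
    (fun m => n (hh ▸ S.ideal.left _ _ m)) (R.not_mem_right S) (F.not_mem S) ⟨?_, ?_⟩ hω.symm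
    (h'.lInc (cF'.trans cR.symm) (cF' ▸ zμ)) ⟨?_, ?_⟩ (S.repFin (F.not_mem S) (F'.not_mem S))
  · rintro ⟨k, hk⟩
    exact hω.2 ⟨k, cancel_left (l := P.pi y) (by grind [_=_ RayCategory.assoc]) z⟩
  · rintro ⟨k, hk⟩
    exact hω.1 ⟨k, cancel_left (l := P.pi y) (by grind [_=_ RayCategory.assoc]) (cR ▸ zμ)⟩
  · rintro ⟨k, hk⟩
    exact h'.2 ⟨k, cancel_right (k := h) (by grind [_=_ RayCategory.assoc]) (hh ▸ z)⟩
  · rintro ⟨k, hk⟩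
    exact h'.1 ⟨k, cancel_right (k := f) (by grind [_=_ RayCategory.assoc]) z⟩

theorem pair_false (S : Setting μ I) {ω : P.Hom x y} (R : Fac μ (P.pi y) ω) {a a' : P.Obj}
    {f : P.Hom a y} {g : P.Hom x a} {f' : P.Hom a' y} {g' : P.Hom x a'} (F : Fac μ f g)
    (F' : Fac μ f' g') (hf : RInc f f') (h : RInc f (P.pi y)) (h' : RInc f' (P.pi y))
    (hω : RInc f ω) (hω' : RInc f' ω) : False := by
  have n := F.not_mem_pi S
  have n' := F'.not_mem_pi S
  have z := S.ideal.ne_zero n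
  have z' := S.ideal.ne_zero n'
  refine not_repFin_of_four (finite x y a a') S.ideal (z := y) (by simp) (by simp) (by simp)
    (by simp) (by simp) (F.not_mem S) (F'.not_mem S) n n' hf
    (rInc_pi_comp (ne_zero_right z) fun ⟨k, hk⟩ => S.cross_false R F F h hω hk)
    ⟨fun ⟨k, hk⟩ => S.cross_false R F' F h hω' hk, ?_⟩
    ⟨fun ⟨k, hk⟩ => S.cross_false R F F' h' hω hk, ?_⟩
    (rInc_pi_comp (ne_zero_right z') fun ⟨k, hk⟩ => S.cross_false R F' F' h' hω' hk)
    (hf.comp_left z z') (S.repFin (F.not_mem S) (F'.not_mem S))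
  · rintro ⟨k, hk⟩
    exact h.2 ⟨f' ⬝ k, by grind [_=_ RayCategory.assoc]⟩
  · rintro ⟨k, hk⟩
    exact h'.2 ⟨f ⬝ k, by grind [_=_ RayCategory.assoc]⟩

theorem comparable (S : Setting μ I) {ω : P.Hom x y} (R : Fac μ (P.pi y) ω)
    (W : Fac μ ω (P.pi x)) {a : P.Obj} {f : P.Hom a y} {g : P.Hom x a} (F : Fac μ f g)
    (h : RInc (P.pi y) ω) (hρ : RInc (P.pi y) f) (hω : RInc ω f) : False := by
  have zμ := S.ne_zero
  have cR := R.comp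
  have cW := W.comp
  have cF := F.comp
  have l₁ : LInc ω (P.pi x) := h.lInc (cR.trans cW.symm) (cR ▸ zμ)
  have l₂ : LInc (P.pi x) g := hω.lInc (cW.trans cF.symm) (cW ▸ zμ)
  exact not_repFin_of_fork (finite x y a a) S.ideal (x := x) (b₁ := y) (b₂ := a) (d := y)
    (t₁ := x) (t₂ := a) (by simp) (by simp) (by simp) (by simp) (by simp) (by simp)
    l₁.target_ne_source (hρ.symm.source_ne_target fun ⟨k, hk⟩ => hρ.1 ⟨k, hk⟩).symm
    l₂.symm.target_ne_source.symm (W.not_mem S) (W.not_mem_right S) (F.not_mem_right S)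
    (R.not_mem S) (F.not_mem S) h.symm hω hρ l₁ (hρ.lInc (cR.trans cF.symm) (cR ▸ zμ)) l₂
    (S.repFin (F.not_mem S) (F.not_mem S))

theorem four_pi_false (S : Setting μ I) {ω : P.Hom x y} (R : Fac μ (P.pi y) ω) {a b : P.Obj}
    {f : P.Hom a y} {g : P.Hom x a} {p : P.Hom b y} {q : P.Hom x b} (F : Fac μ f g)
    (G : Fac μ p q) (l : ¬ ∃ θ, P.pi y ⬝ f = f ⬝ θ) (hf : RInc f (P.pi y)) (hfp : RInc f p)
    (hp : RInc p (P.pi y)) (h₁ : RInc f (P.pi y ⬝ p)) (h₂ : RInc f (P.pi y ⬝ P.pi y)) :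
    False := by
  have nF := F.not_mem_pi S
  have nG := G.not_mem_pi S
  have nR := R.not_mem_pi S
  have zF := S.ideal.ne_zero nF
  have zG := S.ideal.ne_zero nG
  have zR := S.ideal.ne_zero nR
  exact not_repFin_of_four (finite x y a b) S.ideal (z := y) (by simp) (by simp) (by simp)
    (by simp) (by simp) (F.not_mem S) nF nG nR (rInc_pi_comp (ne_zero_right zF) l) h₁ h₂
    (hfp.comp_left zF zG) (hf.comp_left zF zR) (hp.comp_left zG zR)
    (S.repFin (F.not_mem S) (G.not_mem S))

variable {col : ∀ a : P.Obj, P.Hom a y → Prop}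

/-- `π(y)` and `ω` have different colours, and `f₁`, `f₂` have the colour of `ω`. -/
theorem core_of_split_right (S : Setting μ I) (hL : P.pi y ⬝ μ = μ ⬝ P.pi x)
    (K : Coloring μ col) {ω : P.Hom x y} (R : Fac μ (P.pi y) ω) (W : Fac μ ω (P.pi x))
    (hc : ¬ (col _ (P.pi y) ↔ col _ ω))
    {a₁ a₂ : P.Obj} {f₁ : P.Hom a₁ y} {g₁ : P.Hom x a₁} {f₂ : P.Hom a₂ y} {g₂ : P.Hom x a₂}
    (F₁ : Fac μ f₁ g₁) (F₂ : Fac μ f₂ g₂) (hf : RInc f₁ f₂) (h₁ : col _ f₁ ↔ col _ ω)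
    (h₂ : col _ f₂ ↔ col _ ω) : False := by
  have h := K.rInc R W hc
  have i₁ : RInc (P.pi y) f₁ := K.rInc R F₁ (by rwa [h₁])
  have i₂ : RInc (P.pi y) f₂ := K.rInc R F₂ (by rwa [h₂])
  have zμ := S.ne_zero
  have cR := R.comp
  have cW := W.comp
  have c₁ := F₁.comp
  have c₂ := F₂.comp
  have hμ : ¬ P.IsId μ := fun h => F₁.left (isId_of_comp_isId (F₁.comp.symm ▸ h)).1
  have j₁ := S.comparable R W F₁ h i₁
  have j₂ := S.comparable R W F₂ h i₂
  have C : Central ω I := ⟨S.ideal, cR.trans cW.symm, W.not_mem S, by rw [cR]; exact zμ,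
    fun k hk => h.1 ⟨k, hk⟩, R.not_mem S, S.not_mem_pi_right hL hμ⟩
  have key : ∀ {a : P.Obj} {f : P.Hom a y} {g r : P.Hom x a}, Fac μ f g → RInc (P.pi y) f →
      ω = f ⬝ r → ¬ P.IsId r → Transversal ω I f r := by
    intro a f g r F i hr hi
    have cF := F.comp
    have hg : g = r ⬝ P.pi x := cancel_left (l := f) (by grind [_=_ RayCategory.assoc])
      (cF ▸ zμ)
    refine ⟨hr.symm, fun q hq => i.2 ⟨q, hq⟩, fun k hk => ?_, F.not_mem_pi S,
      hg ▸ F.not_mem_right S⟩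
    have e : P.pi y ⬝ f = ω ⬝ k := cancel_right (k := r) (by grind [_=_ RayCategory.assoc])
      (by rw [P.assoc, ← hr, cR]; exact zμ)
    have G : Fac μ (P.pi y ⬝ f) r :=
      ⟨by rw [P.assoc, ← hr, cR], fun h => F.left (isId_of_comp_isId h).2, hi⟩
    exact hc ((K.inv _ G R rfl).symm.trans (K.inv _ G W e))
  have cmp : ∀ {a : P.Obj} {f : P.Hom a y}, (RInc ω f → False) →
      (∃ k, f = ω ⬝ k) ∨ ∃ r, ω = f ⬝ r := by
    intro a f hf
    unfold RInc at hf
    tauto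
  rcases cmp j₁ with ⟨k₁, hk₁⟩ | ⟨r₁, hr₁⟩ <;> rcases cmp j₂ with ⟨k₂, hk₂⟩ | ⟨r₂, hr₂⟩
  · refine S.pi_source_false hL F₁ F₂ hf (k₁ := k₁) (k₂ := k₂) ?_ ?_
    · exact cancel_left (l := ω) (by grind [_=_ RayCategory.assoc]) (cW ▸ zμ)
    · exact cancel_left (l := ω) (by grind [_=_ RayCategory.assoc]) (cW ▸ zμ)
  · exact hf.2 ⟨r₂ ⬝ k₁, by grind [_=_ RayCategory.assoc]⟩
  · exact hf.1 ⟨r₁ ⬝ k₂, by grind [_=_ RayCategory.assoc]⟩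
  · refine C.transversal_false (finite x y a₁ a₂) (S.repFin (F₁.not_mem S) (F₂.not_mem S))
      (by simp) (by simp) (by simp) (by simp) (key F₁ i₁ hr₁ fun hi => ?_)
      (key F₂ i₂ hr₂ fun hi => ?_) hf
    · obtain ⟨k, hk⟩ := eq_of_comp_isId hr₁ hi
      exact hf.2 ⟨r₂ ⬝ k, by grind [_=_ RayCategory.assoc]⟩
    · obtain ⟨k, hk⟩ := eq_of_comp_isId hr₂ hi
      exact hf.1 ⟨r₁ ⬝ k, by grind [_=_ RayCategory.assoc]⟩

/-- `π(y)` and `ω` have different colours. -/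
theorem core_of_split (S : Setting μ I) (hL : P.pi y ⬝ μ = μ ⬝ P.pi x)
    (K : Coloring μ col) {ω : P.Hom x y} (R : Fac μ (P.pi y) ω) (W : Fac μ ω (P.pi x))
    (hc : ¬ (col _ (P.pi y) ↔ col _ ω))
    {a₁ a₂ : P.Obj} {f₁ : P.Hom a₁ y} {g₁ : P.Hom x a₁} {f₂ : P.Hom a₂ y} {g₂ : P.Hom x a₂}
    (F₁ : Fac μ f₁ g₁) (F₂ : Fac μ f₂ g₂) (hf : RInc f₁ f₂) (h₁₂ : col _ f₁ ↔ col _ f₂) :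
    False := by
  by_cases h₁ : col _ f₁ ↔ col _ ω
  · exact S.core_of_split_right hL K R W hc F₁ F₂ hf h₁ (h₁₂.symm.trans h₁)
  have h₂ : ¬ (col _ f₂ ↔ col _ ω) := by rwa [← h₁₂]
  have h := K.rInc R W hc
  have j₁ := fun i => S.comparable R W F₁ h i (K.rInc F₁ W h₁).symm
  have j₂ := fun i => S.comparable R W F₂ h i (K.rInc F₂ W h₂).symm
  have zμ := S.ne_zero
  have cR := R.comp
  have cW := W.comp
  have c₁ := F₁.comp
  have c₂ := F₂.comp
  have cmp : ∀ {a : P.Obj} {f : P.Hom a y}, (RInc (P.pi y) f → False) →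
      (∃ k, f = P.pi y ⬝ k) ∨ ∃ r, P.pi y = f ⬝ r := by
    intro a f hf
    unfold RInc at hf
    tauto
  rcases cmp j₁ with ⟨k₁, hk₁⟩ | ⟨r₁, hr₁⟩ <;> rcases cmp j₂ with ⟨k₂, hk₂⟩ | ⟨r₂, hr₂⟩
  · have hk : RInc k₁ k₂ := RInc.of_comp_left (e := P.pi y) (hk₁ ▸ hk₂ ▸ hf)
    have e₁ : ω = k₁ ⬝ g₁ := cancel_left (l := P.pi y) (by grind [_=_ RayCategory.assoc])
      (cR ▸ zμ)
    have e₂ : ω = k₂ ⬝ g₂ := cancel_left (l := P.pi y) (by grind [_=_ RayCategory.assoc])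
      (cR ▸ zμ)
    have G₁ : Fac μ k₁ (g₁ ⬝ P.pi x) := ⟨by rw [← P.assoc, ← e₁, cW], hk.not_isId_left,
      fun h => F₁.right (isId_of_comp_isId h).1⟩
    have G₂ : Fac μ k₂ (g₂ ⬝ P.pi x) := ⟨by rw [← P.assoc, ← e₂, cW], hk.symm.not_isId_left,
      fun h => F₂.right (isId_of_comp_isId h).1⟩
    exact S.core_of_split_right hL K R W hc G₁ G₂ hk (K.inv _ W G₁ e₁).symm
      (K.inv _ W G₂ e₂).symm
  · exact hf.2 ⟨r₂ ⬝ k₁, by grind [_=_ RayCategory.assoc]⟩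
  · exact hf.1 ⟨r₁ ⬝ k₂, by grind [_=_ RayCategory.assoc]⟩
  · exact S.pi_target_false (F₁.not_mem_pi S) (F₂.not_mem_pi S) hf hr₁ hr₂

end Setting

end RayCategory

namespace RayCategory

variable {P : RayCategory} {x y : P.Obj} {I : ∀ a b : P.Obj, P.Hom a b → Prop} {μ : P.Hom x y}
  {col : ∀ a : P.Obj, P.Hom a y → Prop}

namespace Setting

/-- If `π(y)` and `ω = π(y)ω'` have one colour and `f` the other one, then the morphism `p`
incomparable to `π(y)` and `f` cannot strictly divide `ω`. -/
theorem pi_dvd_false (S : Setting μ I) (K : Coloring μ col) {ω : P.Hom x y}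
    (R : Fac μ (P.pi y) ω) {a b : P.Obj} {f : P.Hom a y} {g : P.Hom x a} {p : P.Hom b y}
    {q : P.Hom x b} {t : P.Hom x b} (F : Fac μ f g) (G : Fac μ p q)
    (l : ¬ ∃ θ, P.pi y ⬝ f = f ⬝ θ) (hρ : ¬ (col _ (P.pi y) ↔ col _ f))
    (hc : ¬ (col _ p ↔ col _ f)) (hp : RInc p (P.pi y)) {ω' : P.Hom x y} (hω : ω = P.pi y ⬝ ω')
    (ht : P.pi y ⬝ p ⬝ t = μ) (hi : ¬ P.IsId t) (hi' : ¬ P.IsId ω') : False := by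
  have cR := R.comp
  have H : Fac μ (P.pi y ⬝ p) t :=
    ⟨by rw [← ht, P.assoc], fun h => not_isId_pi y (isId_of_comp_isId h).1, hi⟩
  have H' : Fac μ (P.pi y ⬝ P.pi y) ω' :=
    ⟨by rw [← cR, hω, P.assoc], fun h => not_isId_pi y (isId_of_comp_isId h).1, hi'⟩
  have e := K.inv _ H R rfl
  have e' := K.inv _ H' R rfl
  exact S.four_pi_false R F G l (K.rInc R F hρ).symm (K.rInc G F hc).symm hp
    (K.rInc H F (by rwa [e])).symm (K.rInc H' F (by rwa [e'])).symm

set_option maxHeartbeats 1000000 in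
theorem core_of_same (S : Setting μ I) (hL : P.pi y ⬝ μ = μ ⬝ P.pi x)
    (K : Coloring μ col) {ω : P.Hom x y} (R : Fac μ (P.pi y) ω) (W : Fac μ ω (P.pi x))
    (hc : col _ (P.pi y) ↔ col _ ω)
    {a₁ a₂ a₃ : P.Obj} {f₁ : P.Hom a₁ y} {g₁ : P.Hom x a₁} {f₂ : P.Hom a₂ y} {g₂ : P.Hom x a₂}
    {f₃ : P.Hom a₃ y} {g₃ : P.Hom x a₃} (F₁ : Fac μ f₁ g₁) (F₂ : Fac μ f₂ g₂)
    (F₃ : Fac μ f₃ g₃) (hf : RInc f₁ f₂) (h₁ : col _ f₁ ↔ col _ (P.pi y))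
    (h₂ : col _ f₂ ↔ col _ (P.pi y)) (h₃ : ¬ (col _ (P.pi y) ↔ col _ f₃)) : False := by
  have i₃ := K.rInc R F₃ h₃
  have j₃ := K.rInc W F₃ (by rwa [← hc])
  have l : ¬ ∃ θ, P.pi y ⬝ f₃ = f₃ ⬝ θ := fun ⟨θ, l⟩ =>
    S.cross_false R F₃ F₃ i₃.symm j₃.symm l
  have cmp : ¬ RInc (P.pi y) ω := fun h => S.comparable R W F₃ h i₃ j₃
  have zμ := S.ne_zero
  have cR := R.comp
  have cW := W.comp
  have c₁ := F₁.comp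
  have c₂ := F₂.comp
  have zω := ne_zero_right (cR ▸ zμ)
  have comm : P.pi y ⬝ ω = ω ⬝ P.pi x := cR.trans cW.symm
  obtain ⟨i, ω₀, ω₁, e₀, e₀', hi⟩ := exists_pi_power ω ω zω
  replace hi : ¬ ∃ k, ω₀ = P.pi y ⬝ k := by
    have : ω₁ = ω₀ := cancel_left (l := P.pipow y i) (e₀'.symm.trans e₀) (e₀' ▸ zω)
    rintro ⟨k, hk⟩
    exact hi ⟨⟨k, hk⟩, k, this.trans hk⟩
  have comm₀ : P.pi y ⬝ ω₀ = ω₀ ⬝ P.pi x := by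
    have := endo_comm (P.pi y) (P.pipow y i)
    exact cancel_left (l := P.pipow y i) (by grind [_=_ RayCategory.assoc])
      (by rw [← P.assoc, ← this, P.assoc, ← e₀, cR]; exact zμ)
  have eω := pipow_comp_of_comm comm₀ i
  have hr : ∃ r, P.pi y = ω₀ ⬝ r := by
    cases i with
    | zero =>
      rw [P.pipow_zero, P.id_comp] at e₀
      subst e₀
      unfold RInc at cmp
      tauto
    | succ i =>
      by_contra hr
      have ρω : RInc ω₀ (P.pi y) := ⟨hr, hi⟩
      have e₁ : ω = P.pi y ⬝ (P.pipow y i ⬝ ω₀) := by rw [e₀, pipow_succ_eq, P.assoc]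
      have e₂ : P.pi y ⬝ ω₀ ⬝ P.pipow x (i + 1) = μ := by rw [← eω, ← e₀, cR]
      have e₃ : ω₀ ⬝ (P.pi x ⬝ P.pipow x (i + 1)) = μ := by
        rw [← P.assoc, ← comm₀, P.assoc, e₂]
      have n : ¬ P.IsId ω₀ := by
        intro h
        obtain ⟨rfl, h⟩ := h
        obtain rfl := eq_of_heq h
        exact hr ⟨P.pi x, (P.id_comp _).symm⟩
      have G : Fac μ ω₀ (P.pi x ⬝ P.pipow x (i + 1)) :=
        ⟨e₃, n, fun h => not_isId_pi x (isId_of_comp_isId h).1⟩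
      have hG := K.inv _ W G (e₀.trans eω)
      exact S.pi_dvd_false K R F₃ G l h₃ (by rwa [← hG, ← hc]) ρω e₁ e₂
        (by rw [pipow_succ_eq]; exact fun h => not_isId_pi x (isId_of_comp_isId h).1)
        (fun h => n (isId_of_comp_isId h).2)
  obtain ⟨r, hr⟩ := hr
  have hσ : P.pi x = r ⬝ ω₀ := cancel_left (l := ω₀) (by grind [_=_ RayCategory.assoc]) (by
    rw [← comm₀]
    intro h
    apply zμ
    rw [← cR, e₀, ← P.assoc, endo_comm, P.assoc, h, P.comp_zero])
  obtain ⟨j, p₁, p₂, e₁, e₂, hp⟩ := exists_pi_power f₁ f₂ (ne_zero_left (c₁ ▸ zμ))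
  set d := P.pipow y j with hd
  have hcd := endo_comm d (P.pi y)
  have hτ : p₂ ⬝ g₂ = p₁ ⬝ g₁ := cancel_left (l := d) (by grind [_=_ RayCategory.assoc])
    (by rw [← P.assoc, ← e₂, c₂]; exact zμ)
  have hpp : RInc p₁ p₂ := RInc.of_comp_left (e := d) (e₁ ▸ e₂ ▸ hf)
  have n₁ : ¬ I _ _ (P.pi y ⬝ p₁) := fun h => F₁.not_mem_pi S (by
    rw [e₁, ← P.assoc, ← hcd, P.assoc]; exact S.ideal.left _ _ h)
  have n₂ : ¬ I _ _ (P.pi y ⬝ p₂) := fun h => F₂.not_mem_pi S (by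
    rw [e₂, ← P.assoc, ← hcd, P.assoc]; exact S.ideal.left _ _ h)
  have hτμ : d ⬝ p₁ ⬝ g₁ = μ := by grind [_=_ RayCategory.assoc]
  by_cases ht : ∃ k, p₁ ⬝ g₁ = P.pi y ⬝ k
  · have commτ : P.pi y ⬝ p₁ ⬝ g₁ = (p₁ ⬝ g₁) ⬝ P.pi x :=
      cancel_left (l := d) (by grind [_=_ RayCategory.assoc])
        (by rw [← P.assoc, hcd, P.assoc, hτμ]; exact S.pi_ne)
    have key : ∀ {b : P.Obj} {f : P.Hom b y} {p : P.Hom b y} {g : P.Hom x b}, Fac μ f g →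
        f = d ⬝ p → p ⬝ g = p₁ ⬝ g₁ → RInc p (P.pi y) → (col _ f ↔ col _ (P.pi y)) → False := by
      intro b f p g F hf hpg hp hcf
      have cF := F.comp
      have G : Fac μ p (g ⬝ P.pipow x j) := by
        refine ⟨?_, hp.not_isId_left, fun h => F.right (isId_of_comp_isId h).1⟩
        rw [← P.assoc, hpg, ← pipow_comp_of_comm commτ, ← hd, hτμ]
      have cG := G.comp
      have hcp : col _ p ↔ col _ (P.pi y) := by
        cases j with
        | zero =>
          rw [P.pipow_zero] at hd
          rw [hd, P.id_comp] at hf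
          rw [← hf, hcf]
        | succ j =>
          rw [hc]
          refine (K.inv (g ⬝ P.pipow x j) W G ?_).symm
          rw [← P.assoc, hpg, ← pipow_comp_of_comm commτ]
          refine cancel_left (l := P.pi y) ?_ (cR ▸ zμ)
          rw [cR, ← hτμ, hd, pipow_succ_eq, P.assoc]
      have hpf : RInc p f₃ := K.rInc G F₃ (by rwa [hcp])
      by_cases hpω : RInc p ω
      · exact S.pair_false R G F₃ hpf hp i₃.symm hpω j₃.symm
      by_cases h : ∃ k, p = ω ⬝ k
      · obtain ⟨k, rfl⟩ := h
        cases i with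
        | succ i =>
          refine hp.2 ⟨P.pipow y i ⬝ ω₀ ⬝ k, ?_⟩
          rw [e₀, pipow_succ_eq]
          grind [_=_ RayCategory.assoc]
        | zero =>
          rw [P.pipow_zero, P.id_comp] at e₀
          subst e₀
          exact S.pi_source_false hL R G hp.symm hσ (k₂ := k)
            (cancel_left (l := ω) (by rw [cW, ← P.assoc, G.comp]) (cW ▸ zμ))
      · obtain ⟨t, ht⟩ : ∃ t, ω = p ⬝ t := by
          unfold RInc at hpω
          tauto
        cases i with
        | zero =>
          rw [P.pipow_zero, P.id_comp] at e₀
          subst e₀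
          exact hp.1 ⟨t ⬝ r, by grind [_=_ RayCategory.assoc]⟩
        | succ i =>
          have e₁ : ω = P.pi y ⬝ (P.pipow y i ⬝ ω₀) := by rw [e₀, pipow_succ_eq, P.assoc]
          refine S.pi_dvd_false K R F₃ G l h₃ (by rwa [hcp]) hp (t := t) e₁
            (by rw [← ht, cR]) (fun hi => ?_) fun hi => ?_
          · obtain ⟨k, hk⟩ := eq_of_comp_isId ht hi
            exact h ⟨k, hk⟩
          · obtain ⟨k, hk⟩ := eq_of_comp_isId e₁ hi
            exact hp.1 ⟨t ⬝ k, by grind [_=_ RayCategory.assoc]⟩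
    rcases hpp.pi_cases hp with ⟨⟨q₁, hq₁⟩, q₂, hq₂⟩ | h | h
    · exact S.pi_target_false n₁ n₂ hpp hq₁ hq₂
    · exact key F₁ e₁ rfl h h₁
    · exact key F₂ e₂ hτ h h₂
  · have e : p₁ ⬝ g₁ = ω₀ := pipow_cancel (i := j) (j := i + 1)
      (by rw [← hd, hτμ, pipow_succ_eq, P.assoc, ← e₀, cR]) (by rw [← hd, hτμ]; exact zμ) ht hi
    exact S.pi_target_false n₁ n₂ hpp (k₁ := g₁ ⬝ r) (k₂ := g₂ ⬝ r)
      (by rw [← P.assoc, e, hr]) (by rw [← P.assoc, hτ, e, hr])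

theorem core (S : Setting μ I)
    (K : Coloring μ col)
    {a₁ a₂ a₃ : P.Obj} {f₁ : P.Hom a₁ y} {g₁ : P.Hom x a₁} {f₂ : P.Hom a₂ y} {g₂ : P.Hom x a₂}
    {f₃ : P.Hom a₃ y} {g₃ : P.Hom x a₃} (F₁ : Fac μ f₁ g₁) (F₂ : Fac μ f₂ g₂)
    (F₃ : Fac μ f₃ g₃) (hf : RInc f₁ f₂) (h₁₂ : col _ f₁ ↔ col _ f₂)
    (h₁₃ : ¬ (col _ f₁ ↔ col _ f₃)) : False := by
  by_cases hL : P.pi y ⬝ μ = μ ⬝ P.pi x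
  swap
  · exact S.core_of_ne hL K F₁ F₂ F₃ hf h₁₂ h₁₃
  have h₂₃ : ¬ (col _ f₂ ↔ col _ f₃) := by rwa [← h₁₂]
  have c₁ := F₁.comp
  have c₂ := F₂.comp
  have zμ := S.ne_zero
  by_cases hd : ∃ k, μ = P.pi y ⬝ k
  · obtain ⟨ω, hω⟩ := hd
    by_cases hi : P.IsId ω
    · obtain ⟨k, hk⟩ := eq_of_comp_isId hω hi
      exact S.pi_target_false (F₁.not_mem_pi S) (F₂.not_mem_pi S) hf (k₁ := g₁ ⬝ k)
        (k₂ := g₂ ⬝ k) (by grind [_=_ RayCategory.assoc]) (by grind [_=_ RayCategory.assoc])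
    have R : Fac μ (P.pi y) ω := ⟨hω.symm, not_isId_pi y, hi⟩
    have W : Fac μ ω (P.pi x) := ⟨cancel_left (l := P.pi y)
      (by grind [_=_ RayCategory.assoc]) (by rw [← P.assoc, ← hω, ← hL]; exact S.pi_ne), hi,
      not_isId_pi x⟩
    by_cases hc : col _ (P.pi y) ↔ col _ ω
    · by_cases h₁ : col _ f₁ ↔ col _ (P.pi y)
      · exact S.core_of_same hL K R W hc F₁ F₂ F₃ hf h₁ (h₁₂.symm.trans h₁) (by rwa [← h₁])
      · have h₂ : ¬ (col _ f₂ ↔ col _ (P.pi y)) := by rwa [← h₁₂]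
        exact S.pair_false R F₁ F₂ hf (K.rInc F₁ R h₁) (K.rInc F₂ R h₂)
          (K.rInc F₁ W (by rwa [← hc])) (K.rInc F₂ W (by rwa [← hc]))
    · exact S.core_of_split hL K R W hc F₁ F₂ hf h₁₂
  · exact S.three_false_of_not_dvd hL (fun k hk => hd ⟨k, hk⟩) F₁ F₂ F₃ hf (K.rInc F₁ F₃ h₁₃)
      (K.rInc F₂ F₃ h₂₃)

end Setting

end RayCategory

namespace RayCategory

variable {P : RayCategory} {x y : P.Obj}

theorem Fac.of_rInc {μ : P.Hom x y} {a b : P.Obj} {f₁ : P.Hom a y} {g₁ : P.Hom x a}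
    {f₂ : P.Hom b y} {g₂ : P.Hom x b} (h₁ : f₁ ⬝ g₁ = μ) (h₂ : f₂ ⬝ g₂ = μ) (h : RInc f₁ f₂) :
    Fac μ f₁ g₁ := by
  refine ⟨h₁, h.not_isId_left, ?_⟩
  rintro ⟨rfl, hi⟩
  obtain rfl := eq_of_heq hi
  rw [P.comp_id] at h₁
  exact h.2 ⟨g₂, by rw [h₁, h₂]⟩

theorem transit_iff {μ : P.Hom x y} (h : P.IsTransit μ) : ∃ e, μ ⬝ P.pi x = e ⬝ μ := by
  obtain ⟨zμ, g, ⟨i, j, rfl⟩, hg⟩ := h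
  obtain ⟨m, hm⟩ := hg μ ⟨0, 0, by rw [P.pipow_zero, P.pipow_zero, P.comp_id, P.id_comp]⟩
  rw [← P.assoc, ← pipow_add] at hm
  obtain ⟨h₁, rfl⟩ := pipow_eq_id zμ _ _ hm
  obtain ⟨rfl, rfl⟩ := Nat.add_eq_zero_iff.1 h₁
  obtain ⟨l, hl⟩ := hg (μ ⬝ P.pi x) ⟨0, 1, by rw [P.pipow_zero, P.id_comp]; rfl⟩
  exact ⟨P.pipow y l, by rw [hl, P.pipow_zero, P.pipow_zero, P.comp_id, P.id_comp]⟩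

theorem cotransit_iff {μ : P.Hom x y} (h : P.IsCotransit μ) : ∃ e, P.pi y ⬝ μ = μ ⬝ e := by
  obtain ⟨zμ, g, ⟨i, j, rfl⟩, hg⟩ := h
  obtain ⟨m, hm⟩ := hg μ ⟨0, 0, by rw [P.pipow_zero, P.pipow_zero, P.comp_id, P.id_comp]⟩
  rw [P.assoc, P.assoc, ← pipow_add] at hm
  obtain ⟨rfl, h₁⟩ := pipow_eq_id zμ _ _ hm
  obtain ⟨rfl, rfl⟩ := Nat.add_eq_zero_iff.1 h₁
  obtain ⟨l, hl⟩ := hg (P.pi y ⬝ μ) ⟨1, 0, by rw [P.pipow_zero, P.comp_id]; rfl⟩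
  exact ⟨P.pipow x l, by rw [hl, P.pipow_zero, P.pipow_zero, P.comp_id, P.id_comp]⟩

theorem pi_comp_ne_zero {μ : P.Hom x y} (h : P.IsTransit μ) (hd : ¬ P.IsDeep μ) :
    P.pi y ⬝ μ ≠ P.zero x y := by
  obtain ⟨e, he⟩ := transit_iff h
  intro h₀
  apply hd
  refine ⟨h.1, h₀, ?_⟩
  rcases endo_cases e with rfl | ⟨e, rfl⟩
  · rw [P.id_comp] at he
    exact absurd (absorb_right h.1 he.symm) (pi_ne_id x)
  · rw [he, endo_comm, P.assoc, h₀, P.comp_zero]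

theorem Setting.of_transit {μ : P.Hom x y} (h : P.IsTransit μ) (hd : ¬ P.IsDeep μ)
    (hR : ∀ D : Set P.Obj, x ∈ D → y ∈ D →
      D ⊆ ProjSupp P (IdealOf P (P.pi y ⬝ μ)) x ∪ InjSupp P (IdealOf P (P.pi y ⬝ μ)) y →
      D.Finite → D.ncard ≤ 4 → RepFin P D (IdealOf P (P.pi y ⬝ μ))) :
    Setting μ (IdealOf P (P.pi y ⬝ μ)) := by
  have hI := isIdeal_idealOf (P.pi y ⬝ μ)
  have hμ : ¬ IdealOf P (P.pi y ⬝ μ) _ _ μ := by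
    rintro ⟨g, k, e⟩
    have e' : μ = (g ⬝ P.pi y) ⬝ μ ⬝ k := by grind [_=_ RayCategory.assoc]
    exact not_isId_pi y (isId_of_comp_eq_id (absorb h.1 e').1).2
  refine ⟨hI, fun f => Iff.rfl, pi_comp_ne_zero h hd, transit_iff h, ?_⟩
  intro a b f g hf hg
  refine hR _ (by simp) (by simp) ?_ (Set.toFinite _) ?_
  · rintro z (rfl | rfl | rfl | rfl)
    · exact Or.inr ⟨μ, h.1, hμ⟩
    · exact Or.inl ⟨μ, h.1, hμ⟩
    · exact Or.inr ⟨f, hI.ne_zero hf, hf⟩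
    · exact Or.inr ⟨g, hI.ne_zero hg, hg⟩
  · exact (Set.ncard_insert_le _ _).trans (Nat.succ_le_succ ((Set.ncard_insert_le _ _).trans
      (Nat.succ_le_succ ((Set.ncard_insert_le _ _).trans (by rw [Set.ncard_singleton])))))

theorem setting_of_mild (C : Contour P x y) (hM : C.Mild) (hT : P.IsTransit C.v.toHom) :
    Setting C.v.toHom C.It := by
  rcases hM with ⟨hd, -, hR⟩ | ⟨hd, hc, hR⟩
  · exact Setting.of_transit hT hd fun D hx hy hs => hR D ⟨hx, hy, hs⟩
  · obtain ⟨e, he⟩ := cotransit_iff hc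
    have h := pi_comp_eq_of_transit (pi_comp_ne_zero hT hd) (transit_iff hT) he
    have hI : C.Ic = C.It := by
      unfold Contour.Ic Contour.It
      rw [h]
    unfold Contour.DecisiveC at hR
    rw [hI] at hR
    exact Setting.of_transit hT hd fun D hx hy hs => hR D ⟨hx, hy, hs⟩

end RayCategory

open RayCategory

namespace RPath

variable {P : RayCategory} {x y : P.Obj}

@[simp]
theorem toHom_nil (a : P.Obj) : (nil a).toHom = P.id a := by rw [toHom]

@[simp]
theorem toHom_cons {a b c : P.Obj} (f : P.Hom b c) (hf : P.IsIrreducible f) (p : RPath P a b) :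
    (cons f hf p).toHom = f ⬝ p.toHom := by rw [toHom]

@[simp]
theorem nil_append {a b : P.Obj} (p : RPath P a b) : (nil b).append p = p := by rw [append]

@[simp]
theorem cons_append {a b c d : P.Obj} (f : P.Hom c d) (hf : P.IsIrreducible f)
    (p : RPath P b c) (q : RPath P a b) : (cons f hf p).append q = cons f hf (p.append q) := by
  rw [append]

theorem toHom_append {a b c : P.Obj} (p : RPath P b c) (q : RPath P a b) :
    (p.append q).toHom = p.toHom ⬝ q.toHom := by
  induction p with
  | nil => rw [nil_append, toHom_nil, P.id_comp]
  | cons f hf p ih => rw [cons_append, toHom_cons, toHom_cons, ih, P.assoc]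

theorem append_nil {a b : P.Obj} (p : RPath P a b) : p.append (.nil a) = p := by
  induction p with
  | nil => rw [nil_append]
  | cons f hf p ih => rw [cons_append, ih]

theorem append_assoc {a b c d : P.Obj} (p : RPath P c d) (q : RPath P b c) (r : RPath P a b) :
    (p.append q).append r = p.append (q.append r) := by
  induction p with
  | nil => rw [nil_append, nil_append]
  | cons f hf p ih => rw [cons_append, cons_append, cons_append, ih]

theorem isId_of_length {a b : P.Obj} (p : RPath P a b) (h : p.length = 0) :
    P.IsId p.toHom := by
  cases p with
  | nil => rw [toHom_nil]; exact isId_id _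
  | cons f hf p => rw [length] at h; exact absurd h (Nat.succ_ne_zero _)

theorem InterlaceStep.symm {p q : RPath P x y} (h : InterlaceStep p q) : InterlaceStep q p := by
  obtain ⟨a, b, p, v', w', q, hv, hw, e, h₀, hl⟩ := h
  exact ⟨a, b, p, w', v', q, hw, hv, e.symm, e ▸ h₀, hl⟩

theorem Interlaced.symm {p q : RPath P x y} (h : Interlaced p q) : Interlaced q p := by
  induction h with
  | single h => exact .single h.symm
  | tail _ h ih => exact .trans (.single h.symm) ih

theorem Interlaced.trans {p q r : RPath P x y} (hpq : Interlaced p q) (hqr : Interlaced q r) :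
    Interlaced p r := Relation.TransGen.trans hpq hqr

/-- Paths which pass through a common factorization are interlaced. -/
theorem interlaced_append {a : P.Obj} {p p' : RPath P a y} {q q' : RPath P x a}
    (hp : p.toHom = p'.toHom) (hq : q.toHom = q'.toHom) (h₀ : p.toHom ⬝ q.toHom ≠ P.zero x y)
    (ip : ¬ P.IsId p.toHom) (iq : ¬ P.IsId q.toHom) :
    Interlaced (p.append q) (p'.append q') := by
  refine Relation.TransGen.trans (b := p'.append q) (.single ?_) (.single ?_)
  · exact ⟨a, y, .nil y, p, p', q, (nil_append _).symm, (nil_append _).symm, hp, ne_zero_left h₀,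
      fun h => iq (isId_of_length q h.2)⟩
  · refine ⟨x, a, p', q, q', .nil x, by rw [append_nil], by rw [append_nil], hq,
      ne_zero_right h₀, fun h => ip ?_⟩
    have hi := isId_of_length p' h.1
    rwa [← hp] at hi

/-- Different paths with the same nonzero composition split at incomparable morphisms. -/
theorem exists_split : ∀ {y : P.Obj} (u v : RPath P x y), u.toHom = v.toHom →
    u.toHom ≠ P.zero x y → u ≠ v →
    ∃ (a b : P.Obj) (p₁ : RPath P a y) (q₁ : RPath P x a) (p₂ : RPath P b y) (q₂ : RPath P x b),
      u = p₁.append q₁ ∧ v = p₂.append q₂ ∧ RInc p₁.toHom p₂.toHom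
  | _, .nil _, .nil _, _, _, hne => absurd rfl hne
  | _, .nil _, .cons f hf p, h, _, _ => absurd (isId_of_comp_eq_id (by simpa using h.symm)).1 hf.2.1
  | _, .cons f hf p, .nil _, h, _, _ => absurd (isId_of_comp_eq_id (by simpa using h)).1 hf.2.1
  | _, @cons _ _ a _ f hf p, @cons _ _ a' _ f' hf' p', h, h₀, hne => by
    rw [toHom_cons] at h h₀
    rw [toHom_cons] at h
    have key : (∃ k, P.IsId k ∧ f = f' ⬝ k) → ∃ (_ : a = a'), HEq f f' := by
      rintro ⟨k, ⟨rfl, hk⟩, rfl⟩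
      obtain rfl := eq_of_heq hk
      exact ⟨rfl, by rw [P.comp_id]⟩
    have key' : (∃ k, P.IsId k ∧ f' = f ⬝ k) → ∃ (_ : a = a'), HEq f f' := by
      rintro ⟨k, ⟨rfl, hk⟩, rfl⟩
      obtain rfl := eq_of_heq hk
      exact ⟨rfl, by rw [P.comp_id]⟩
    by_cases hi : RInc f f'
    · exact ⟨a, a', .cons f hf (.nil a), p, .cons f' hf' (.nil a'), p', by simp, by simp, by
        simpa [P.comp_id] using hi⟩
    · have : ∃ (_ : a = a'), HEq f f' := by
        by_cases h₁ : ∃ k, f' = f ⬝ k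
        · obtain ⟨k, hk⟩ := h₁
          exact key' ⟨k, (hf'.2.2 _ _ _ hk).resolve_left hf.2.1, hk⟩
        · by_cases h₂ : ∃ k, f = f' ⬝ k
          · obtain ⟨k, hk⟩ := h₂
            exact key ⟨k, (hf.2.2 _ _ _ hk).resolve_left hf'.2.1, hk⟩
          · exact absurd ⟨h₁, h₂⟩ hi
      obtain ⟨rfl, hff⟩ := this
      obtain rfl := eq_of_heq hff
      have hpp := cancel_left h h₀
      obtain ⟨b, c, p₁, q₁, p₂, q₂, e₁, e₂, hr⟩ := exists_split p p' hpp (ne_zero_right h₀)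
        fun e => hne (by rw [e])
      have z₁ : f ⬝ p₁.toHom ≠ P.zero _ _ := ne_zero_left (f := q₁.toHom) (by
        rwa [P.assoc, ← toHom_append, ← e₁])
      have z₂ : f ⬝ p₂.toHom ≠ P.zero _ _ := ne_zero_left (f := q₂.toHom) (by
        rwa [P.assoc, ← toHom_append, ← e₂, ← hpp])
      refine ⟨b, c, .cons f hf p₁, q₁, .cons f hf p₂, q₂, by simp [e₁], by simp [e₂], ?_⟩
      rw [toHom_cons, toHom_cons]
      refine ⟨?_, ?_⟩
      · rintro ⟨k, hk⟩
        exact hr.1 ⟨k, cancel_left (l := f) (hk.trans (P.assoc _ _ _)) z₂⟩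
      · rintro ⟨k, hk⟩
        exact hr.2 ⟨k, cancel_left (l := f) (hk.trans (P.assoc _ _ _)) z₁⟩

end RPath

namespace RayCategory

variable {P : RayCategory} {x y : P.Obj}

/-- the right divisors of a morphism -/
def rightDivisors {a b : P.Obj} (f : P.Hom a b) : Set (Σ c, P.Hom a c) :=
  {s | ∃ g, g ⬝ s.2 = f}

theorem finite_rightDivisors {a b : P.Obj} {f : P.Hom a b} (h : f ≠ P.zero a b) :
    (rightDivisors f).Finite := by
  refine ((P.finite_target a).biUnion fun c _ => Set.finite_range (Sigma.mk c)).subset ?_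
  rintro ⟨c, k⟩ ⟨g, rfl⟩
  exact Set.mem_biUnion (x := c) ⟨k, ne_zero_right h⟩ ⟨k, rfl⟩

theorem ncard_rightDivisors_right {a b c : P.Obj} {g : P.Hom b c} {f : P.Hom a b}
    (h : g ⬝ f ≠ P.zero a c) (hg : ¬ P.IsId g) :
    (rightDivisors f).ncard < (rightDivisors (g ⬝ f)).ncard := by
  refine Set.ncard_lt_ncard ⟨?_, fun hs => ?_⟩ (finite_rightDivisors h)
  · rintro ⟨d, k⟩ ⟨l, rfl⟩
    exact ⟨g ⬝ l, P.assoc _ _ _⟩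
  · obtain ⟨l, hl⟩ := hs (a := ⟨c, g ⬝ f⟩) ⟨P.id c, P.id_comp _⟩
    exact hg (absorb_comp_left (ne_zero_right h) hl.symm).2

theorem ncard_rightDivisors_left {a b c : P.Obj} {g : P.Hom b c} {f : P.Hom a b}
    (h : g ⬝ f ≠ P.zero a c) (hf : ¬ P.IsId f) :
    (rightDivisors g).ncard < (rightDivisors (g ⬝ f)).ncard := by
  have hinj : Set.InjOn (fun s : Σ d, P.Hom b d => (⟨s.1, s.2 ⬝ f⟩ : Σ d, P.Hom a d))
      (rightDivisors g) := by
    rintro ⟨d, k⟩ ⟨l, rfl⟩ ⟨d', k'⟩ - e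
    obtain ⟨rfl, e⟩ := Sigma.mk.inj_iff.1 e
    have := cancel_right (eq_of_heq e) (ne_zero_right (g := l) (by rwa [← P.assoc]))
    exact congrArg (Sigma.mk d) this
  rw [← hinj.ncard_image]
  refine Set.ncard_lt_ncard ⟨?_, fun hs => ?_⟩ (finite_rightDivisors h)
  · rintro _ ⟨⟨d, k⟩, ⟨l, rfl⟩, rfl⟩
    exact ⟨l, (P.assoc _ _ _).symm⟩
  · obtain ⟨⟨d, k⟩, -, e⟩ := hs (a := ⟨a, P.id a⟩) ⟨g ⬝ f, P.comp_id _⟩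
    obtain ⟨rfl, e⟩ := Sigma.mk.inj_iff.1 e
    exact hf (isId_of_comp_eq_id (eq_of_heq e)).2

/-- Every nonzero morphism is the composition of a path. -/
theorem exists_path {a b : P.Obj} (f : P.Hom a b) (h : f ≠ P.zero a b) :
    ∃ p : RPath P a b, p.toHom = f := by
  by_cases hid : P.IsId f
  · obtain ⟨rfl, hid⟩ := hid
    exact ⟨.nil a, by rw [RPath.toHom_nil, eq_of_heq hid]⟩
  by_cases hirr : P.IsIrreducible f
  · exact ⟨.cons f hirr (.nil a), by simp [P.comp_id]⟩
  have : ∃ (c : P.Obj) (g : P.Hom c b) (k : P.Hom a c), f = g ⬝ k ∧ ¬ P.IsId g ∧ ¬ P.IsId k := by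
    by_contra hc
    refine hirr ⟨h, hid, fun c g k e => ?_⟩
    by_contra hn
    exact hc ⟨c, g, k, e, fun hg => hn (.inl hg), fun hk => hn (.inr hk)⟩
  obtain ⟨c, g, k, rfl, hg, hk⟩ := this
  have l₁ := ncard_rightDivisors_left h hk
  have l₂ := ncard_rightDivisors_right h hg
  obtain ⟨p, rfl⟩ := exists_path g (ne_zero_left h)
  obtain ⟨q, rfl⟩ := exists_path k (ne_zero_right h)
  exact ⟨p.append q, RPath.toHom_append p q⟩
termination_by (rightDivisors f).ncard

/-- The left factors `f` of `μ` such that the paths through `f` are interlaced with `w`. -/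
def InterlacedWith (μ : P.Hom x y) (w : RPath P x y) (a : P.Obj) (f : P.Hom a y) : Prop :=
  ∃ (p : RPath P a y) (q : RPath P x a), p.toHom = f ∧ p.toHom ⬝ q.toHom = μ ∧
    RPath.Interlaced (p.append q) w

theorem interlacedWith_iff {μ : P.Hom x y} (zμ : μ ≠ P.zero x y) {w : RPath P x y} {a : P.Obj}
    {p : RPath P a y} {q : RPath P x a} (F : Fac μ p.toHom q.toHom) :
    InterlacedWith μ w a p.toHom ↔ RPath.Interlaced (p.append q) w := by
  constructor
  · rintro ⟨p', q', hp, hμ, h⟩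
    refine (RPath.interlaced_append hp.symm ?_ (F.comp ▸ zμ) F.left F.right).trans h
    exact cancel_left (l := p.toHom) (by rw [F.comp, ← hμ, hp]) (F.comp ▸ zμ)
  · exact fun h => ⟨p, q, rfl, F.comp, h⟩

theorem coloring_interlacedWith {μ : P.Hom x y} (zμ : μ ≠ P.zero x y) (w : RPath P x y) :
    Coloring μ (InterlacedWith μ w) := by
  constructor
  rintro a b f g f' g' h F F' rfl
  have c := F.comp
  rw [P.assoc] at c
  obtain rfl : h ⬝ g = g' := cancel_left (c.trans F'.comp.symm) (c ▸ zμ)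
  obtain ⟨p, rfl⟩ := exists_path f' (ne_zero_left (c ▸ zμ))
  obtain ⟨t, rfl⟩ := exists_path g (ne_zero_right (F.comp ▸ zμ))
  obtain ⟨s, rfl⟩ := exists_path h (ne_zero_left (ne_zero_right (c ▸ zμ)))
  rw [← RPath.toHom_append] at F F' ⊢
  rw [interlacedWith_iff zμ F, interlacedWith_iff zμ F', RPath.append_assoc]

end RayCategory

/-- **Lemma 1.4 (uniqueness of the paths).** For a mild contour `C = {v,w}` with `v⃗`
transit, any path `u` with `u⃗ = v⃗` is equal to `v` or `w`. -/
theorem mild_contour_path_unique (P : RayCategory) {x y : P.Obj} (C : Contour P x y)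
    (hM : C.Mild) (hT : P.IsTransit C.v.toHom) :
    ∀ u : RPath P x y, u.toHom = C.v.toHom → u = C.v ∨ u = C.w := by
  intro u hu
  by_contra hne
  have hv : u ≠ C.v := fun h => hne (.inl h)
  have hw : u ≠ C.w := fun h => hne (.inr h)
  have zμ := C.nz
  have zu : u.toHom ≠ P.zero x y := hu ▸ zμ
  have S := RayCategory.setting_of_mild C hM hT
  have K := RayCategory.coloring_interlacedWith zμ C.w
  obtain ⟨a₁, a₂, p₁, q₁, p₂, q₂, e₁, e₂, h₁₂⟩ := RPath.exists_split u C.v hu zu hv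
  obtain ⟨a₃, a₄, p₃, q₃, p₄, q₄, e₃, e₄, h₃₄⟩ :=
    RPath.exists_split u C.w (hu.trans C.hom_eq) zu hw
  have c₁ : P.comp p₁.toHom q₁.toHom = C.v.toHom := by rw [← RPath.toHom_append, ← e₁, hu]
  have c₂ : P.comp p₂.toHom q₂.toHom = C.v.toHom := by rw [← RPath.toHom_append, ← e₂]
  have c₃ : P.comp p₃.toHom q₃.toHom = C.v.toHom := by rw [← RPath.toHom_append, ← e₃, hu]
  have c₄ : P.comp p₄.toHom q₄.toHom = C.v.toHom := by
    rw [← RPath.toHom_append, ← e₄, C.hom_eq]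
  have F₁ := RayCategory.Fac.of_rInc c₁ c₂ h₁₂
  have F₂ := RayCategory.Fac.of_rInc c₂ c₁ h₁₂.symm
  have F₃ := RayCategory.Fac.of_rInc c₃ c₄ h₃₄
  have F₄ := RayCategory.Fac.of_rInc c₄ c₃ h₃₄.symm
  have k₁ := RayCategory.interlacedWith_iff zμ (w := C.w) F₁
  have k₂ := RayCategory.interlacedWith_iff zμ (w := C.w) F₂
  have k₃ := RayCategory.interlacedWith_iff zμ (w := C.w) F₃
  have k₄ := RayCategory.interlacedWith_iff zμ (w := C.w) F₄
  rw [← e₁] at k₁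
  rw [← e₂, iff_false_right C.nint] at k₂
  rw [← e₃] at k₃
  have hww : RPath.Interlaced C.w C.w := by
    have := RPath.interlaced_append (p := p₄) (q := q₄) rfl rfl (c₄ ▸ zμ) F₄.left F₄.right
    rwa [← e₄] at this
  rw [← e₄, iff_true_right hww] at k₄
  by_cases h : RPath.Interlaced u C.w
  · exact S.core K F₃ F₄ F₂ h₃₄ (iff_of_true (k₃.2 h) k₄) fun e => k₂ (e.1 (k₃.2 h))
  · have n₁ := fun h' => h (k₁.1 h')
    exact S.core K F₁ F₂ F₄ h₁₂ (iff_of_false n₁ k₂) fun e => n₁ (e.2 k₄)
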